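/- arXiv:1302.4295 — 6 statements merged into one kernel-verified Lean document; each statement's English description precedes it below -/
import Mathlib

section
/- There exists a constant C > 0 such that the following holds. Let B be a finite set and V a linear subspace of functions f : B → ℚ satisfying, for integers c₁, c₂, c₃ ≥ 1: c₁ is the divisibility constant of V; V has a c₂-bounded integer basis in ℓ_∞; V^⊥ has a c₃-bounded integer basis in ℓ₁; for any b₁, b₂ ∈ B there exists a symmetry π of V with π(b₁) = b₂; and the constant functions belong to V. If N is an integer multiple of c₁ with min(N, |B| − N) ≥ C · c₂ · c₃² · dim(V)⁶ · (log(2·c₃·dim(V)))⁶, then the number of subsets T ⊆ B of size N satisfying (1/|T|)·Σ_{t∈T} f(t) = (1/|B|)·Σ_{b∈B} f(b) for all f ∈ V equals [ ρ(V) / ( (2π·p·(1−p))^(dim(V)/2) · p^N · (1−p)^(|B|−N) ) ] · (1+δ), where p := N/|B| and |δ| ≤ C · dim(V)³ · (log(2·c₂·dim(V)))^(3/2) / √(min(N, |B|−N)). -/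
/-- A vector `f : B → ℚ` is integer-valued. -/
def IsIntVec {B : Type} (f : B → ℚ) : Prop := ∀ b, ∃ z : ℤ, f b = (z : ℚ)

/-- `V` has a `c`-bounded integer basis in `ℓ_∞`: `V` is spanned by integer vectors
whose `ℓ_∞` norm is at most `c`. -/
def HasBoundedIntBasisLinf {B : Type} (V : Submodule ℚ (B → ℚ)) (c : ℕ) : Prop :=
  Submodule.span ℚ {f : B → ℚ | f ∈ V ∧ IsIntVec f ∧ ∀ b, |f b| ≤ (c : ℚ)} = V

/-- The orthogonal complement `V^⊥ = {g : Σ_b f(b)·g(b) = 0 for all f ∈ V}`. -/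
def perpSet {B : Type} [Fintype B] (V : Submodule ℚ (B → ℚ)) : Set (B → ℚ) :=
  {g | ∀ f ∈ V, ∑ b, f b * g b = 0}

/-- `V^⊥` has a `c`-bounded integer basis in `ℓ₁`. -/
def PerpHasBoundedIntBasisL1 {B : Type} [Fintype B] (V : Submodule ℚ (B → ℚ)) (c : ℕ) : Prop :=
  (Submodule.span ℚ {g : B → ℚ | g ∈ perpSet V ∧ IsIntVec g ∧ ∑ b, |g b| ≤ (c : ℚ)}
      : Set (B → ℚ)) = perpSet V

/-- `c` is the divisibility constant of `V`. -/
def IsDivisibilityConstant {B : Type} [Fintype B] (V : Submodule ℚ (B → ℚ)) (c : ℕ) : Prop :=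
  0 < c ∧ ∀ N : ℤ,
    (∃ γ : B → ℤ, ∀ f ∈ V,
        ∑ b, (γ b : ℚ) * f b = (N : ℚ) / (Fintype.card B : ℚ) * ∑ b, f b)
      ↔ (c : ℤ) ∣ N

/-- A symmetry of `V` is a permutation `π` of `B` with `f ∘ π ∈ V` for all `f ∈ V`. -/
def IsSymmetry {B : Type} (V : Submodule ℚ (B → ℚ)) (π : Equiv.Perm B) : Prop :=
  ∀ f ∈ V, (f ∘ π) ∈ V

/-- The characteristic function of a centred Bernoulli variable of parameter `p`. -/
noncomputable def bernoulliChar (p y : ℝ) : ℂ :=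
  ((1 - p : ℝ) + (p : ℝ) * Complex.exp (y * Complex.I)) * Complex.exp (-(p * y : ℝ) * Complex.I)

lemma norm_bernoulliChar_sq (p y : ℝ) :
    ‖bernoulliChar p y‖ ^ 2 = 1 - 2 * (p * (1 - p)) * (1 - Real.cos y) := by
  unfold bernoulliChar
  have h1 : ‖Complex.exp (-(p * y : ℝ) * Complex.I)‖ = 1 := by
    have := Complex.norm_exp_ofReal_mul_I (-(p * y))
    push_cast at this ⊢
    exact this
  rw [norm_mul, h1, mul_one, Complex.sq_norm, Complex.exp_mul_I, Complex.normSq_apply]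
  simp [← Complex.ofReal_cos, ← Complex.ofReal_sin]
  linear_combination p ^ 2 * Real.sin_sq_add_cos_sq y

lemma norm_bernoulliChar_le_exp {p : ℝ} (y : ℝ) :
    ‖bernoulliChar p y‖ ≤ Real.exp (-(p * (1 - p)) * (1 - Real.cos y)) := by
  refine le_of_sq_le_sq ?_ (Real.exp_pos _).le
  rw [norm_bernoulliChar_sq, ← Real.exp_nat_mul]
  refine le_trans (le_of_eq ?_) (Real.add_one_le_exp _)
  push_cast
  ring

lemma norm_bernoulliChar_le_exp_round {p : ℝ} (h0 : 0 ≤ p) (h1 : p ≤ 1) (x : ℝ) :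
    ‖bernoulliChar p (2 * Real.pi * x)‖
      ≤ Real.exp (-(8 * (p * (1 - p))) * |x - round x| ^ 2) := by
  refine (norm_bernoulliChar_le_exp _).trans (Real.exp_le_exp.2 ?_)
  have hc : Real.cos (2 * Real.pi * x) = Real.cos (2 * Real.pi * (x - round x)) := by
    rw [← Real.cos_sub_int_mul_two_pi (2 * Real.pi * x) (round x)]
    congr 1; ring
  have hr : |x - round x| ≤ 1 / 2 := abs_sub_round x
  have hb : Real.cos (2 * Real.pi * (x - round x)) ≤ 1 - 8 * |x - round x| ^ 2 := by
    have := Real.cos_le_one_sub_mul_cos_sq (x := 2 * Real.pi * (x - round x)) (by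
      rw [abs_mul, abs_of_pos Real.two_pi_pos]; nlinarith [Real.pi_pos])
    refine this.trans (le_of_eq ?_)
    rw [sq_abs]
    field_simp
    ring
  rw [hc]
  have := mul_nonneg (mul_nonneg h0 (sub_nonneg.2 h1)) (sub_nonneg.2 hb)
  nlinarith

lemma norm_bernoulliChar_le_gaussian {p : ℝ} (h0 : 0 ≤ p) (h1 : p ≤ 1) {y s : ℝ} (hy : |y| ≤ 1)
    (hs : 5 * y ^ 2 / 48 ≤ s) :
    ‖bernoulliChar p y‖ ≤ Real.exp (-(p * (1 - p) / 2 * (1 - s)) * y ^ 2) := by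
  refine (norm_bernoulliChar_le_exp _).trans (Real.exp_le_exp.2 ?_)
  have hb := (abs_le.1 (Real.cos_bound hy)).2
  have h4 : |y| ^ 4 = y ^ 4 := by
    rw [show |y| ^ 4 = (|y| ^ 2) ^ 2 by ring, sq_abs]; ring
  rw [h4] at hb
  have hb' : y ^ 2 / 2 * (1 - s) ≤ 1 - Real.cos y := by
    have : y ^ 2 * (5 * y ^ 2 / 48) ≤ y ^ 2 * s := mul_le_mul_of_nonneg_left hs (sq_nonneg y)
    nlinarith
  have := mul_nonneg (mul_nonneg h0 (sub_nonneg.2 h1)) (sub_nonneg.2 hb')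
  nlinarith

lemma norm_exp_sub_quadratic_le {u : ℝ} (hu : |u| ≤ 1) :
    ‖Complex.exp (u * Complex.I) - (1 + u * Complex.I - u ^ 2 / 2)‖ ≤ 2 / 9 * |u| ^ 3 := by
  have h := Complex.exp_bound (x := u * Complex.I) (by simpa using hu) (n := 3) (by norm_num)
  have e : ∑ m ∈ Finset.range 3, ((u : ℂ) * Complex.I) ^ m / (m.factorial : ℂ)
      = 1 + u * Complex.I - u ^ 2 / 2 := by
    simp [Finset.sum_range_succ, mul_pow, Nat.factorial]
    ring
  rw [e] at h
  refine h.trans (le_of_eq ?_)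
  simp [Nat.factorial]
  ring

lemma norm_bernoulliChar_sub_gaussian_le {p : ℝ} (h0 : 0 ≤ p) (h1 : p ≤ 1) {y : ℝ}
    (hy : |y| ≤ 1) :
    ‖bernoulliChar p y - (Real.exp (-(p * (1 - p) / 2) * y ^ 2) : ℝ)‖
      ≤ p * (1 - p) * |y| ^ 3 / 3 := by
  have hq : 0 ≤ 1 - p := by linarith
  have hs0 : 0 ≤ p * (1 - p) := mul_nonneg h0 hq
  have hs1 : p * (1 - p) ≤ 1 / 4 := by nlinarith [sq_nonneg (p - 1 / 2)]
  have hy0 := abs_nonneg y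
  have e : bernoulliChar p y - (Real.exp (-(p * (1 - p) / 2) * y ^ 2) : ℝ)
      = (1 - p : ℝ) * (Complex.exp ((-(p * y) : ℝ) * Complex.I)
          - (1 + (-(p * y) : ℝ) * Complex.I - ((-(p * y) : ℝ) : ℂ) ^ 2 / 2))
        + (p : ℝ) * (Complex.exp (((1 - p) * y : ℝ) * Complex.I)
          - (1 + ((1 - p) * y : ℝ) * Complex.I - (((1 - p) * y : ℝ) : ℂ) ^ 2 / 2))
        - ((Real.exp (-(p * (1 - p) / 2) * y ^ 2) - 1 - (-(p * (1 - p) / 2) * y ^ 2) : ℝ) : ℂ) := by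
    unfold bernoulliChar
    have : Complex.exp (((1 - p) * y : ℝ) * Complex.I)
        = Complex.exp (y * Complex.I) * Complex.exp (-(p * y : ℝ) * Complex.I) := by
      rw [← Complex.exp_add]; congr 1; push_cast; ring
    rw [this]
    push_cast
    ring
  have b1 := norm_exp_sub_quadratic_le (u := -(p * y)) (by
    rw [abs_neg, abs_mul, abs_of_nonneg h0]; nlinarith)
  have b2 := norm_exp_sub_quadratic_le (u := (1 - p) * y) (by
    rw [abs_mul, abs_of_nonneg hq]; nlinarith)
  have y2 : y ^ 2 = |y| ^ 2 := (sq_abs y).symm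
  have hy2 : y ^ 2 ≤ 1 := by rw [y2]; nlinarith
  have b3 := Real.abs_exp_sub_one_sub_id_le (x := -(p * (1 - p) / 2) * y ^ 2) (by
    rw [abs_mul, abs_neg, abs_of_nonneg (by positivity), abs_of_nonneg (by positivity)]
    nlinarith [sq_nonneg y])
  rw [e]
  refine (norm_sub_le _ _).trans ?_
  refine (add_le_add_left (norm_add_le _ _) _).trans ?_
  rw [norm_mul, norm_mul, Complex.norm_real, Complex.norm_real, Complex.norm_real,
    Real.norm_of_nonneg h0, Real.norm_of_nonneg hq]
  have c1 := mul_le_mul_of_nonneg_left b1 hq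
  have c2 := mul_le_mul_of_nonneg_left b2 h0
  have a1 : |-(p * y)| = p * |y| := by rw [abs_neg, abs_mul, abs_of_nonneg h0]
  have a2 : |(1 - p) * y| = (1 - p) * |y| := by rw [abs_mul, abs_of_nonneg hq]
  rw [a1] at c1
  rw [a2] at c2
  have e3 : (-(p * (1 - p) / 2) * y ^ 2) ^ 2
      = (p * (1 - p)) * (p * (1 - p)) * |y| ^ 3 * |y| / 4 := by
    rw [y2]; ring
  rw [e3] at b3
  rw [Real.norm_eq_abs]
  have hy3 : 0 ≤ |y| ^ 3 := by positivity
  have t1 : (1 - p) * (2 / 9 * (p * |y|) ^ 3) + p * (2 / 9 * ((1 - p) * |y|) ^ 3)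
      ≤ 2 / 9 * (p * (1 - p) * |y| ^ 3) := by
    have : p ^ 2 + (1 - p) ^ 2 ≤ 1 := by nlinarith
    have := mul_le_mul_of_nonneg_left this (mul_nonneg hs0 hy3)
    nlinarith
  have t2 : (p * (1 - p)) * (p * (1 - p)) * |y| ^ 3 * |y| / 4
      ≤ 1 / 16 * (p * (1 - p) * |y| ^ 3) := by
    have : (p * (1 - p)) * |y| ≤ 1 / 4 := by nlinarith
    have := mul_le_mul_of_nonneg_left this (mul_nonneg hs0 hy3)
    nlinarith
  have : 0 ≤ p * (1 - p) * |y| ^ 3 := mul_nonneg hs0 hy3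
  linarith

lemma norm_prod_sub_prod_le_sum {ι : Type*} [DecidableEq ι] (s : Finset ι) (z w : ι → ℂ)
    (q : ι → ℝ) (hz : ∀ i ∈ s, ‖z i‖ ≤ q i) (hw : ∀ i ∈ s, ‖w i‖ ≤ q i) :
    ‖∏ i ∈ s, z i - ∏ i ∈ s, w i‖ ≤ ∑ i ∈ s, ‖z i - w i‖ * ∏ j ∈ s.erase i, q j := by
  induction s using Finset.induction_on with
  | empty => simp
  | insert a s ha ih =>
    have ih := ih (fun i hi => hz i (Finset.mem_insert_of_mem hi))
      (fun i hi => hw i (Finset.mem_insert_of_mem hi))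
    have hqa : 0 ≤ q a := (norm_nonneg _).trans (hz a (Finset.mem_insert_self _ _))
    rw [Finset.prod_insert ha, Finset.prod_insert ha, Finset.sum_insert ha,
      Finset.erase_insert ha]
    have e : z a * ∏ i ∈ s, z i - w a * ∏ i ∈ s, w i
        = (z a - w a) * ∏ i ∈ s, w i + z a * (∏ i ∈ s, z i - ∏ i ∈ s, w i) := by ring
    rw [e]
    refine (norm_add_le _ _).trans (add_le_add ?_ ?_)
    · rw [norm_mul, norm_prod]
      exact mul_le_mul_of_nonneg_left (Finset.prod_le_prod (fun _ _ => norm_nonneg _)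
        fun i hi => hw i (Finset.mem_insert_of_mem hi)) (norm_nonneg _)
    · rw [norm_mul]
      refine (mul_le_mul (hz a (Finset.mem_insert_self _ _)) ih (norm_nonneg _) hqa).trans
        (le_of_eq ?_)
      rw [Finset.mul_sum]
      refine Finset.sum_congr rfl fun i hi => ?_
      have hia : i ≠ a := fun h => ha (h ▸ hi)
      rw [Finset.erase_insert_of_ne hia.symm,
        Finset.prod_insert (fun h => ha (Finset.mem_of_mem_erase h))]
      ring

lemma exists_small_relation {A B : Type*} [Fintype A] [Fintype B] (χ : A → B → ℤ) (c k : ℕ)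
    (hχ : ∀ a b, |χ a b| ≤ c) (hk : (2 * k * c + 1) ^ Fintype.card A < 2 ^ k) (t : Fin k → B) :
    ∃ ε : Fin k → ℤ, (∃ j, |ε j| = 1) ∧ (∀ i, |ε i| ≤ 1) ∧ ∀ a, ∑ i, ε i * χ a (t i) = 0 := by
  classical
  let box : Finset (A → ℤ) := Fintype.piFinset fun _ => Finset.Icc (-(k * c : ℤ)) (k * c)
  let F : Finset (Fin k) → A → ℤ := fun S a => ∑ i ∈ S, χ a (t i)
  have hbox : box.card = (2 * k * c + 1) ^ Fintype.card A := by
    rw [Fintype.card_piFinset]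
    simp only [Int.card_Icc, Finset.prod_const, Finset.card_univ]
    congr 1
    rw [show (k * c + 1 - -(k * c) : ℤ) = ((2 * k * c + 1 : ℕ) : ℤ) by push_cast; ring,
      Int.toNat_natCast]
  obtain ⟨S, -, T, -, hST, hF⟩ := Finset.exists_ne_map_eq_of_card_lt_of_maps_to
    (s := (Finset.univ : Finset (Finset (Fin k)))) (t := box) (f := F)
    (by rw [hbox]; simpa using hk) (by
      intro S _
      simp only [box, Finset.mem_coe, Fintype.mem_piFinset, Finset.mem_Icc, ← abs_le]
      intro a
      calc |∑ i ∈ S, χ a (t i)| ≤ ∑ i ∈ S, |χ a (t i)| := Finset.abs_sum_le_sum_abs _ _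
        _ ≤ ∑ i ∈ S, (c : ℤ) := Finset.sum_le_sum fun i _ => hχ a (t i)
        _ ≤ k * c := by
          rw [Finset.sum_const, nsmul_eq_mul]
          have : S.card ≤ k := by simpa using Finset.card_le_univ S
          gcongr)
  refine ⟨fun i => (if i ∈ S then 1 else 0) - (if i ∈ T then 1 else 0), ?_, ?_, ?_⟩
  · by_contra! h
    apply hST
    ext i
    have := h i
    by_cases h1 : i ∈ S <;> by_cases h2 : i ∈ T <;> simp [h1, h2] at this ⊢
  · intro i
    by_cases h1 : i ∈ S <;> by_cases h2 : i ∈ T <;> simp [h1, h2]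
  · intro a
    have := congrFun hF a
    simp only [F] at this
    simp only [sub_mul, Finset.sum_sub_distrib, ite_mul, one_mul, zero_mul]
    simp [this]

/-- If `G` is a set of permutations with `#{g ∈ G | g x = y}` independent of `x, y`, and every
`k`-tuple has an entry whose `h`-value is, along `G`, dominated by the sum of the other ones, then
`h` is bounded by its average times `k ^ 2`. -/
lemma le_average_of_local_relations {B : Type*} [Fintype B] [DecidableEq B]
    (G : Finset (Equiv.Perm B)) (s k : ℕ) (hs : 0 < s)
    (hG : ∀ x y, (G.filter fun g => g x = y).card = s)
    (h : B → ℝ) (h0 : ∀ x, 0 ≤ h x)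
    (hrel : ∀ t : Fin k → B, ∃ j, ∀ g ∈ G, h (g (t j)) ≤ ∑ i ∈ Finset.univ.erase j, h (g (t i)))
    (b : B) : h b ≤ (k : ℝ) ^ 2 * ((Fintype.card B : ℝ)⁻¹ * ∑ x, h x) := by
  classical
  choose j hj using hrel
  set n := Fintype.card B with hn
  have hnpos : 0 < n := Fintype.card_pos_iff.2 ⟨b⟩
  have hGcard : G.card = n * s := by
    have := Finset.card_eq_sum_card_fiberwise (f := fun g : Equiv.Perm B => g b) (s := G)
      (t := Finset.univ) (fun _ _ => Finset.mem_coe.2 (Finset.mem_univ _))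
    rw [this, Finset.sum_congr rfl fun y _ => hG b y]
    simp [hn]
  let Sg : (Fin k → B) → Fin k → ℝ := fun t j =>
    ∑ g ∈ G with g (t j) = b, ∑ i ∈ Finset.univ.erase j, h (g (t i))
  have hSg0 : ∀ t j, 0 ≤ Sg t j := fun t j =>
    Finset.sum_nonneg fun g _ => Finset.sum_nonneg fun i _ => h0 _
  have low : (n : ℝ) ^ k * s * h b ≤ ∑ t : Fin k → B, Sg t (j t) := by
    have : ∀ t : Fin k → B, s * h b ≤ Sg t (j t) := by
      intro t
      have e : ∑ g ∈ G with g (t (j t)) = b, h b = s * h b := by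
        rw [Finset.sum_const, hG, nsmul_eq_mul]
      rw [← e]
      refine Finset.sum_le_sum fun g hg => ?_
      rw [Finset.mem_filter] at hg
      have := hj t g hg.1
      rwa [hg.2] at this
    calc (n : ℝ) ^ k * s * h b = ∑ t : Fin k → B, s * h b := by
          simp [hn, mul_assoc]
      _ ≤ _ := Finset.sum_le_sum fun t _ => this t
  have up : ∑ t : Fin k → B, Sg t (j t) ≤ ∑ t : Fin k → B, ∑ l, Sg t l :=
    Finset.sum_le_sum fun t _ => Finset.single_le_sum (f := Sg t) (fun l _ => hSg0 t l)
      (Finset.mem_univ _)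
  have key : ∀ l i : Fin k, i ≠ l →
      n ^ 2 * ∑ t : Fin k → B, ∑ g ∈ G with g (t l) = b, h (g (t i))
        = n ^ k * (G.card * ∑ x, h x) := by
    intro l i hil
    have e1 : ∑ t : Fin k → B, ∑ g ∈ G with g (t l) = b, h (g (t i))
        = ∑ g ∈ G, ∑ t : Fin k → B, if t l = b then h (t i) else 0 := by
      simp only [Finset.sum_filter]
      rw [Finset.sum_comm]
      refine Finset.sum_congr rfl fun g _ => ?_
      exact Fintype.sum_equiv (Equiv.arrowCongr (Equiv.refl _) g) _ _ (fun t => by simp)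
    have e2 : (n : ℝ) ^ 2 * ∑ t : Fin k → B, (if t l = b then h (t i) else 0)
        = n ^ k * ∑ x, h x := by
      have hp : ∀ t : Fin k → B, (if t l = b then h (t i) else 0)
          = ∏ m, (if m = l then (if t m = b then 1 else 0) else if m = i then h (t m) else 1) := by
        intro t
        rw [← Finset.mul_prod_erase _ _ (Finset.mem_univ l),
          ← Finset.mul_prod_erase _ _ (Finset.mem_erase.2 ⟨hil, Finset.mem_univ i⟩),
          Finset.prod_eq_one]
        · simp [hil]
        · intro m hm
          simp only [Finset.mem_erase, Finset.mem_univ, and_true] at hm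
          simp [hm.1, hm.2]
      rw [Finset.sum_congr rfl fun t _ => hp t,
        ← Fintype.prod_sum (fun (m : Fin k) (x : B) =>
          (if m = l then (if x = b then (1 : ℝ) else 0) else if m = i then h x else 1)),
        ← Finset.mul_prod_erase _ _ (Finset.mem_univ l),
        ← Finset.mul_prod_erase _ _ (Finset.mem_erase.2 ⟨hil, Finset.mem_univ i⟩)]
      have : ∀ m ∈ (Finset.univ.erase l).erase i,
          ∑ x : B, (if m = l then (if x = b then (1 : ℝ) else 0) else if m = i then h x else 1)
            = n := by
        intro m hm
        simp only [Finset.mem_erase, Finset.mem_univ, and_true] at hm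
        simp [hm.1, hm.2, hn]
      rw [Finset.prod_congr rfl this, Finset.prod_const, Finset.card_erase_of_mem
        (Finset.mem_erase.2 ⟨hil, Finset.mem_univ i⟩), Finset.card_erase_of_mem (Finset.mem_univ _)]
      have hk2 : 2 ≤ k := by
        have h1 := l.2
        have h2 := i.2
        have : (i : ℕ) ≠ l := fun h => hil (Fin.ext h)
        omega
      obtain ⟨k', rfl⟩ := Nat.exists_eq_add_of_le hk2
      simp only [Finset.card_univ, Fintype.card_fin, if_true, hil, if_false]
      rw [show 2 + k' - 1 - 1 = k' by omega]
      simp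
      ring
    rw [e1, Finset.sum_const, nsmul_eq_mul]
    calc (n : ℝ) ^ 2 * (G.card * ∑ t : Fin k → B, (if t l = b then h (t i) else 0))
        = G.card * (n ^ 2 * ∑ t : Fin k → B, (if t l = b then h (t i) else 0)) := by ring
      _ = _ := by rw [e2]; ring
  have tot : (n : ℝ) ^ 2 * ∑ t : Fin k → B, ∑ l, Sg t l
      ≤ k ^ 2 * (n ^ k * (G.card * ∑ x, h x)) := by
    have : ∑ t : Fin k → B, ∑ l, Sg t l
        = ∑ l, ∑ i ∈ Finset.univ.erase l, ∑ t : Fin k → B,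
          ∑ g ∈ G with g (t l) = b, h (g (t i)) := by
      rw [Finset.sum_comm]
      refine Finset.sum_congr rfl fun l _ => ?_
      rw [Finset.sum_comm]
      exact Finset.sum_congr rfl fun t _ => Finset.sum_comm
    rw [this, Finset.mul_sum]
    have hX : 0 ≤ (n : ℝ) ^ k * (G.card * ∑ x, h x) :=
      mul_nonneg (by positivity) (mul_nonneg (by positivity) (Finset.sum_nonneg fun x _ => h0 x))
    calc _ ≤ ∑ l : Fin k, (k : ℝ) * (n ^ k * (G.card * ∑ x, h x)) := by
          refine Finset.sum_le_sum fun l _ => ?_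
          rw [Finset.mul_sum, Finset.sum_congr rfl fun i hi => key l i (Finset.ne_of_mem_erase hi),
            Finset.sum_const, nsmul_eq_mul]
          refine mul_le_mul_of_nonneg_right ?_ hX
          exact_mod_cast (Finset.card_le_univ _).trans (by simp)
      _ = _ := by
          rw [Finset.sum_const, nsmul_eq_mul]
          simp
          ring
  have hnr : (0 : ℝ) < n := by exact_mod_cast hnpos
  have hsr : (0 : ℝ) < s := by exact_mod_cast hs
  rw [hGcard] at tot
  push_cast at tot
  have fin : (n : ℝ) ^ 2 * (n ^ k * s * h b) ≤ k ^ 2 * (n ^ k * (n * s * ∑ x, h x)) :=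
    (mul_le_mul_of_nonneg_left (low.trans up) (by positivity)).trans tot
  have hpos : (0 : ℝ) < n ^ 2 * n ^ k * s := by positivity
  refine le_of_mul_le_mul_left ?_ hpos
  calc (n : ℝ) ^ 2 * n ^ k * s * h b = n ^ 2 * (n ^ k * s * h b) := by ring
    _ ≤ _ := fin
    _ = _ := by field_simp

lemma card_filter_apply_eq_of_transitive {B : Type*} [Fintype B] [DecidableEq B]
    (G : Finset (Equiv.Perm B)) (hmul : ∀ g ∈ G, ∀ g' ∈ G, g * g' ∈ G)
    (htrans : ∀ x y, ∃ g ∈ G, g x = y) :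
    ∃ s, 0 < s ∧ ∀ x y, (G.filter fun g => g x = y).card = s := by
  classical
  rcases isEmpty_or_nonempty B with hB | ⟨⟨b⟩⟩
  · exact ⟨1, one_pos, fun x => isEmptyElim x⟩
  have left : ∀ x y y', (G.filter fun g => g x = y).card ≤ (G.filter fun g => g x = y').card := by
    intro x y y'
    obtain ⟨τ, hτ, e⟩ := htrans y y'
    refine Finset.card_le_card_of_injOn (fun g => τ * g) ?_ (fun _ _ _ _ h => mul_left_cancel h)
    intro g hg
    simp only [Finset.coe_filter, Set.mem_ofPred_eq] at hg ⊢
    exact ⟨hmul _ hτ _ hg.1, by simp [hg.2, e]⟩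
  have right : ∀ x x' y, (G.filter fun g => g x = y).card ≤ (G.filter fun g => g x' = y).card := by
    intro x x' y
    obtain ⟨τ, hτ, e⟩ := htrans x' x
    refine Finset.card_le_card_of_injOn (fun g => g * τ) ?_ (fun _ _ _ _ h => mul_right_cancel h)
    intro g hg
    simp only [Finset.coe_filter, Set.mem_ofPred_eq] at hg ⊢
    exact ⟨hmul _ hg.1 _ hτ, by simp [hg.2, e]⟩
  refine ⟨(G.filter fun g => g b = b).card, ?_, fun x y => ?_⟩
  · obtain ⟨g, hg, e⟩ := htrans b b
    exact Finset.card_pos.2 ⟨g, Finset.mem_filter.2 ⟨hg, e⟩⟩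
  · exact le_antisymm ((left x y b).trans (right x b b)) ((right b x b).trans (left x b y))

/-- The distance to the nearest integer of one entry of a relation with coefficients in
`{-1, 0, 1}` is at most the sum of the distances of the other entries. -/
lemma abs_sub_round_le_of_relation {ι : Type*} [Fintype ι] [DecidableEq ι] (ε : ι → ℤ) (x : ι → ℝ)
    (j : ι) (hj : |ε j| = 1) (hε : ∀ i, |ε i| ≤ 1) (h : ∑ i, (ε i : ℝ) * x i = 0) :
    |x j - round (x j)| ≤ ∑ i ∈ Finset.univ.erase j, |x i - round (x i)| := by
  rw [← Finset.add_sum_erase _ _ (Finset.mem_univ j)] at h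
  have hsq : (ε j : ℝ) * ε j = 1 := by
    have : ε j * ε j = 1 := by rw [← abs_mul_abs_self, hj]; rfl
    exact_mod_cast this
  refine (round_le (x j) (-(ε j * ∑ i ∈ Finset.univ.erase j, ε i * round (x i)))).trans ?_
  have e : x j - ((-(ε j * ∑ i ∈ Finset.univ.erase j, ε i * round (x i)) : ℤ) : ℝ)
      = -(ε j * ∑ i ∈ Finset.univ.erase j, ε i * (x i - round (x i))) := by
    push_cast
    simp only [mul_sub, Finset.sum_sub_distrib]
    linear_combination (ε j : ℝ) * h - x j * hsq
  rw [e, abs_neg, abs_mul]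
  have : |(ε j : ℝ)| = 1 := by exact_mod_cast hj
  rw [this, one_mul]
  refine (Finset.abs_sum_le_sum_abs _ _).trans (Finset.sum_le_sum fun i _ => ?_)
  rw [abs_mul]
  have : |(ε i : ℝ)| ≤ 1 := by exact_mod_cast hε i
  exact mul_le_of_le_one_left (abs_nonneg _) this

/-- If the symmetries of a space of functions act transitively on points, then the
`ℓ_∞` norm on this space is controlled by the normalised `ℓ₂` norm times `√dim`. -/
lemma sq_apply_le_of_transitive {B : Type*} [Fintype B] [DecidableEq B]
    (W : Submodule ℝ (EuclideanSpace ℝ B))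
    (hsym : ∀ x y : B, ∃ π : Equiv.Perm B, π x = y ∧
      ∀ w ∈ W, (WithLp.toLp 2 (fun b => w (π b)) : EuclideanSpace ℝ B) ∈ W)
    (w : EuclideanSpace ℝ B) (hw : w ∈ W) (b : B) :
    w b ^ 2 ≤ Module.finrank ℝ W / Fintype.card B * ∑ x, w x ^ 2 := by
  set u := stdOrthonormalBasis ℝ W
  let K : B → ℝ := fun b => ∑ i, (u i : EuclideanSpace ℝ B) b ^ 2
  have norm_sq : ∀ w : W, ‖w‖ ^ 2 = ∑ x, (w : EuclideanSpace ℝ B) x ^ 2 := by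
    intro w
    rw [Submodule.coe_norm, EuclideanSpace.real_norm_sq_eq]
  have eval : ∀ (w : W) (b : B),
      (w : EuclideanSpace ℝ B) b = ∑ i, u.repr w i * (u i : EuclideanSpace ℝ B) b := by
    intro w b
    conv_lhs => rw [← u.sum_repr w]
    simp
  have bound : ∀ (w : W) (b : B), (w : EuclideanSpace ℝ B) b ^ 2 ≤ K b * ‖w‖ ^ 2 := by
    intro w b
    rw [eval, ← u.repr.norm_map w, EuclideanSpace.real_norm_sq_eq, mul_comm]
    exact Finset.sum_mul_sq_le_sq_mul_sq _ _ _
  have K0 : ∀ b, 0 ≤ K b := fun b => Finset.sum_nonneg fun i _ => sq_nonneg _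
  have mono : ∀ x y, K x ≤ K y := by
    intro x y
    obtain ⟨π, hπ, hW⟩ := hsym y x
    let k : W := u.repr.symm (WithLp.toLp 2 fun i => (u i : EuclideanSpace ℝ B) x)
    have hk : (k : EuclideanSpace ℝ B) x = K x := by
      rw [eval]; simp [k, K, sq]
    have hkn : ‖k‖ ^ 2 = K x := by
      rw [u.repr.symm.norm_map, EuclideanSpace.real_norm_sq_eq]
    let k' : W := ⟨_, hW k k.2⟩
    have hk' : (k' : EuclideanSpace ℝ B) y = K x := by
      change (k : EuclideanSpace ℝ B) (π y) = _
      rw [hπ, hk]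
    have hkn' : ‖k'‖ ^ 2 = K x := by
      rw [← hkn, norm_sq, norm_sq]
      exact Equiv.sum_comp π fun b => (k : EuclideanSpace ℝ B) b ^ 2
    have := bound k' y
    rw [hk', hkn', sq] at this
    rcases (K0 x).eq_or_lt with h | h
    · rw [← h]; exact K0 y
    · exact le_of_mul_le_mul_right this h
  have Ksum : ∑ b, K b = Module.finrank ℝ W := by
    simp only [K]
    rw [Finset.sum_comm]
    have : ∀ i, ∑ x, (u i : EuclideanSpace ℝ B) x ^ 2 = 1 := by
      intro i
      rw [← norm_sq, u.norm_eq_one]; norm_num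
    simp [this]
  have hn : (0 : ℝ) < Fintype.card B := by exact_mod_cast Fintype.card_pos_iff.2 ⟨b⟩
  have Kb : K b = Module.finrank ℝ W / Fintype.card B := by
    rw [eq_div_iff hn.ne', ← Ksum,
      Finset.sum_congr rfl fun x _ => le_antisymm (mono x b) (mono b x)]
    simp [mul_comm]
  have := bound ⟨w, hw⟩ b
  rwa [norm_sq, Kb] at this

lemma mem_of_forall_dotProduct_eq_zero {B : Type*} [Fintype B] (V : Submodule ℚ (B → ℚ))
    (v : B → ℚ) (h : ∀ g : B → ℚ, (∀ f ∈ V, ∑ b, f b * g b = 0) → ∑ b, v b * g b = 0) : v ∈ V := by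
  classical
  by_contra hv
  obtain ⟨f, hf, hV⟩ := Submodule.exists_dual_map_eq_bot_of_notMem hv inferInstance
  have key : ∀ w : B → ℚ, f w = ∑ b, w b * f (Pi.single b 1) := by
    intro w
    conv_lhs => rw [← Finset.univ_sum_single w, map_sum]
    refine Finset.sum_congr rfl fun b _ => ?_
    rw [← smul_eq_mul, ← map_smul, ← Pi.single_smul, smul_eq_mul, mul_one]
  apply hf
  rw [key]
  refine h _ fun w hw => ?_
  rw [← key]
  have : f w ∈ V.map f := Submodule.mem_map_of_mem hw
  rwa [hV, Submodule.mem_bot] at this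

/-- The real function `b ↦ ∑ a, θ a * Ψ a b`. -/
def intEval {A B : Type} [Fintype A] (Ψ : A → B → ℤ) (θ : A → ℝ) (b : B) : ℝ :=
  ∑ a, θ a * Ψ a b

/-- The rows of `Ψ` span `V` and its columns generate `ℤ ^ A`. -/
structure IsPrimitiveBasis {A B : Type} [Fintype A] [DecidableEq A] [Fintype B]
    (V : Submodule ℚ (B → ℚ)) (Ψ : A → B → ℤ) : Prop where
  span : Submodule.span ℚ (Set.range fun a b => (Ψ a b : ℚ)) = V
  gen : ∃ γ : A → B → ℤ, ∀ a a', ∑ b, γ a b * Ψ a' b = if a = a' then 1 else 0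

lemma intEval_sub {A B : Type} [Fintype A] {Ψ : A → B → ℤ} (θ θ' : A → ℝ) (b : B) :
    intEval Ψ (θ - θ') b = intEval Ψ θ b - intEval Ψ θ' b := by
  simp [intEval, sub_mul]

lemma intEval_add {A B : Type} [Fintype A] {Ψ : A → B → ℤ} (θ θ' : A → ℝ) (b : B) :
    intEval Ψ (θ + θ') b = intEval Ψ θ b + intEval Ψ θ' b := by
  simp [intEval, add_mul, Finset.sum_add_distrib]

lemma intEval_intCast {A B : Type} [Fintype A] {Ψ : A → B → ℤ} (α : A → ℤ) (b : B) :
    intEval Ψ (fun a => (α a : ℝ)) b = ((∑ a, α a * Ψ a b : ℤ) : ℝ) := by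
  simp [intEval]

section Geometry

variable {A B : Type} [Fintype A] [DecidableEq A] [Fintype B] {V : Submodule ℚ (B → ℚ)}
  {Ψ : A → B → ℤ}

lemma IsPrimitiveBasis.mem (h : IsPrimitiveBasis V Ψ) (a : A) : (fun b => (Ψ a b : ℚ)) ∈ V := by
  rw [← h.span]; exact Submodule.subset_span ⟨a, rfl⟩

lemma IsPrimitiveBasis.recover (h : IsPrimitiveBasis V Ψ) :
    ∃ γ : A → B → ℤ, ∀ (θ : A → ℝ) a, ∑ b, γ a b * intEval Ψ θ b = θ a := by
  obtain ⟨γ, hγ⟩ := h.gen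
  refine ⟨γ, fun θ a => ?_⟩
  have : ∀ a', (∑ b, (γ a b : ℝ) * Ψ a' b) = if a = a' then 1 else 0 := by
    intro a'
    have := hγ a a'
    have := congrArg (Int.cast : ℤ → ℝ) this
    push_cast at this
    simpa using this
  simp only [intEval, Finset.mul_sum]
  rw [Finset.sum_comm]
  calc ∑ a', ∑ b, (γ a b : ℝ) * (θ a' * Ψ a' b) = ∑ a', θ a' * ∑ b, (γ a b : ℝ) * Ψ a' b := by
        refine Finset.sum_congr rfl fun a' _ => ?_
        rw [Finset.mul_sum]
        exact Finset.sum_congr rfl fun b _ => by ring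
    _ = θ a := by simp [this]

lemma IsPrimitiveBasis.linearIndependent (h : IsPrimitiveBasis V Ψ) :
    LinearIndependent ℚ fun a b => (Ψ a b : ℚ) := by
  obtain ⟨γ, hγ⟩ := h.gen
  rw [Fintype.linearIndependent_iff]
  intro q hq a
  have h1 : ∑ b, (γ a b : ℚ) * (∑ a', q a' • fun b => (Ψ a' b : ℚ)) b = 0 := by
    rw [hq]; simp
  have h2 : ∀ a', (∑ b, (γ a b : ℚ) * Ψ a' b) = if a = a' then 1 else 0 := by
    intro a'
    have := congrArg (Int.cast : ℤ → ℚ) (hγ a a')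
    push_cast at this
    simpa using this
  rw [← h1]
  simp only [Finset.sum_apply, Pi.smul_apply, smul_eq_mul, Finset.mul_sum]
  rw [Finset.sum_comm]
  symm
  calc ∑ a', ∑ b, (γ a b : ℚ) * (q a' * Ψ a' b) = ∑ a', q a' * ∑ b, (γ a b : ℚ) * Ψ a' b := by
        refine Finset.sum_congr rfl fun a' _ => ?_
        rw [Finset.mul_sum]
        exact Finset.sum_congr rfl fun b _ => by ring
    _ = q a := by simp [h2]

lemma IsPrimitiveBasis.finrank_eq (h : IsPrimitiveBasis V Ψ) :
    Module.finrank ℚ V = Fintype.card A := by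
  rw [← h.span, finrank_span_eq_card h.linearIndependent]

lemma IsPrimitiveBasis.exists_intEval_comp (h : IsPrimitiveBasis V Ψ) {π : Equiv.Perm B}
    (hπ : IsSymmetry V π) (θ : A → ℝ) : ∃ θ' : A → ℝ, ∀ b, intEval Ψ θ' b = intEval Ψ θ (π b) := by
  have h1 : ∀ a, ∃ q : A → ℚ, ∀ b, (Ψ a (π b) : ℚ) = ∑ a', q a' * Ψ a' b := by
    intro a
    have := hπ _ (h.mem a)
    rw [← h.span, Submodule.mem_span_range_iff_exists_fun] at this
    obtain ⟨q, hq⟩ := this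
    refine ⟨q, fun b => ?_⟩
    have := congrFun hq b
    simp only [Finset.sum_apply, Pi.smul_apply, smul_eq_mul, Function.comp] at this
    exact this.symm
  choose q hq using h1
  refine ⟨fun a' => ∑ a, θ a * q a a', fun b => ?_⟩
  simp only [intEval, Finset.sum_mul]
  rw [Finset.sum_comm]
  refine Finset.sum_congr rfl fun a _ => ?_
  have : (Ψ a (π b) : ℝ) = ∑ a', (q a a' : ℝ) * Ψ a' b := by
    have := congrArg (Rat.cast : ℚ → ℝ) (hq a b)
    push_cast at this
    exact this
  rw [this, Finset.mul_sum]
  exact Finset.sum_congr rfl fun a' _ => by ring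

lemma IsPrimitiveBasis.sum_intEval_mul_eq_zero (h : IsPrimitiveBasis V Ψ) {ι : Type*} [Fintype ι]
    (t : ι → B) (ε : ι → ℚ) (hε : ∀ f ∈ V, ∑ i, ε i * f (t i) = 0) (θ : A → ℝ) :
    ∑ i, (ε i : ℝ) * intEval Ψ θ (t i) = 0 := by
  simp only [intEval, Finset.mul_sum]
  rw [Finset.sum_comm]
  refine Finset.sum_eq_zero fun a _ => ?_
  have := congrArg (Rat.cast : ℚ → ℝ) (hε _ (h.mem a))
  push_cast at this
  calc ∑ i, (ε i : ℝ) * (θ a * Ψ a (t i)) = θ a * ∑ i, (ε i : ℝ) * Ψ a (t i) := by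
        rw [Finset.mul_sum]
        exact Finset.sum_congr rfl fun i _ => by ring
    _ = 0 := by rw [this, mul_zero]

lemma IsPrimitiveBasis.exists_of_intCast_mem (h : IsPrimitiveBasis V Ψ) (m : B → ℤ)
    (hm : (fun b => (m b : ℚ)) ∈ V) : ∃ α : A → ℤ, ∀ b, m b = ∑ a, α a * Ψ a b := by
  obtain ⟨γ, hγ⟩ := h.gen
  rw [← h.span, Submodule.mem_span_range_iff_exists_fun] at hm
  obtain ⟨q, hq⟩ := hm
  have hq' : ∀ b, (m b : ℚ) = ∑ a, q a * Ψ a b := by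
    intro b
    have := congrFun hq b
    simp only [Finset.sum_apply, Pi.smul_apply, smul_eq_mul] at this
    exact this.symm
  have hγ' : ∀ a a', (∑ b, (γ a b : ℚ) * Ψ a' b) = if a = a' then 1 else 0 := by
    intro a a'
    have := congrArg (Int.cast : ℤ → ℚ) (hγ a a')
    push_cast at this
    simpa using this
  have hα : ∀ a, q a = ((∑ b, γ a b * m b : ℤ) : ℚ) := by
    intro a
    push_cast
    simp only [hq', Finset.mul_sum]
    rw [Finset.sum_comm]
    symm
    calc ∑ a', ∑ b, (γ a b : ℚ) * (q a' * Ψ a' b) = ∑ a', q a' * ∑ b, (γ a b : ℚ) * Ψ a' b := by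
          refine Finset.sum_congr rfl fun a' _ => ?_
          rw [Finset.mul_sum]
          exact Finset.sum_congr rfl fun b _ => by ring
      _ = q a := by simp [hγ']
  refine ⟨fun a => ∑ b, γ a b * m b, fun b => ?_⟩
  have := hq' b
  simp only [hα] at this
  exact_mod_cast this

lemma IsPrimitiveBasis.exists_round_eq (h : IsPrimitiveBasis V Ψ) {c₃ : ℕ} (hc₃ : 1 ≤ c₃)
    (hV : PerpHasBoundedIntBasisL1 V c₃) (θ : A → ℝ)
    (hθ : ∀ b, |intEval Ψ θ b - round (intEval Ψ θ b)| < 1 / c₃) :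
    ∃ α : A → ℤ, ∀ b, round (intEval Ψ θ b) = ∑ a, α a * Ψ a b := by
  set v := intEval Ψ θ
  have hc : (0 : ℝ) < c₃ := by exact_mod_cast hc₃
  refine h.exists_of_intCast_mem (fun b => round (v b)) ?_
  refine mem_of_forall_dotProduct_eq_zero V _ fun g hg' => ?_
  have hg : g ∈ (Submodule.span ℚ {g : B → ℚ | g ∈ perpSet V ∧ IsIntVec g ∧
      ∑ b, |g b| ≤ (c₃ : ℚ)} : Set (B → ℚ)) := by
    rw [hV]; exact hg'
  rw [SetLike.mem_coe] at hg
  clear hg'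
  induction hg using Submodule.span_induction with
  | zero => simp
  | add x y _ _ hx hy => simp [mul_add, Finset.sum_add_distrib, hx, hy]
  | smul r x _ hx =>
    calc ∑ b, (round (v b) : ℚ) * (r • x) b = r * ∑ b, (round (v b) : ℚ) * x b := by
          rw [Finset.mul_sum]
          exact Finset.sum_congr rfl fun b _ => by simp; ring
      _ = 0 := by rw [hx, mul_zero]
  | mem g hg =>
    obtain ⟨hperp, hint, hl1⟩ := hg
    choose z hz using hint
    have h1 : ∑ b, (g b : ℝ) * v b = 0 :=
      h.sum_intEval_mul_eq_zero id g (fun f hf => by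
        rw [← hperp f hf]; exact Finset.sum_congr rfl fun b _ => mul_comm _ _) θ
    have hl1' : ∑ b, |(z b : ℝ)| ≤ c₃ := by
      have : ((∑ b, |g b| : ℚ) : ℝ) ≤ ((c₃ : ℚ) : ℝ) := by exact_mod_cast hl1
      push_cast at this
      simpa [hz] using this
    have h2 : |((∑ b, round (v b) * z b : ℤ) : ℝ)| < 1 := by
      have e : ((∑ b, round (v b) * z b : ℤ) : ℝ) = -∑ b, (z b : ℝ) * (v b - round (v b)) := by
        simp only [hz, Rat.cast_intCast] at h1
        push_cast
        simp only [mul_sub, Finset.sum_sub_distrib, h1]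
        rw [zero_sub, neg_neg]
        exact Finset.sum_congr rfl fun b _ => mul_comm _ _
      rw [e, abs_neg]
      refine (Finset.abs_sum_le_sum_abs _ _).trans_lt ?_
      simp only [abs_mul]
      by_cases hz0 : ∀ b, z b = 0
      · simp [hz0]
      · push Not at hz0
        obtain ⟨b₀, hb₀⟩ := hz0
        calc ∑ b, |(z b : ℝ)| * |v b - round (v b)| < ∑ b, |(z b : ℝ)| * (1 / c₃) := by
              refine Finset.sum_lt_sum (fun b _ =>
                mul_le_mul_of_nonneg_left (hθ b).le (abs_nonneg _)) ⟨b₀, Finset.mem_univ _, ?_⟩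
              exact mul_lt_mul_of_pos_left (hθ b₀) (by simpa using hb₀)
          _ = (∑ b, |(z b : ℝ)|) / c₃ := by rw [← Finset.sum_mul]; ring
          _ ≤ 1 := by rw [div_le_one hc]; exact hl1'
    have h3 : ∑ b, round (v b) * z b = 0 := by
      rw [← Int.abs_lt_one_iff]; exact_mod_cast h2
    have := congrArg (Int.cast : ℤ → ℚ) h3
    push_cast at this
    simpa [hz] using this

/-- The range of `intEval Ψ` as a subspace of Euclidean space. -/
noncomputable def intEvalLin (Ψ : A → B → ℤ) :
    (A → ℝ) →ₗ[ℝ] EuclideanSpace ℝ B where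
  toFun θ := WithLp.toLp 2 (intEval Ψ θ)
  map_add' θ θ' := by ext b; simp [intEval_add]
  map_smul' r θ := by ext b; simp [intEval, Finset.mul_sum, mul_assoc]

lemma IsPrimitiveBasis.intEvalLin_injective (h : IsPrimitiveBasis V Ψ) :
    Function.Injective (intEvalLin Ψ) := by
  obtain ⟨γ, hγ⟩ := h.recover
  intro θ θ' e
  have e' : ∀ b, intEval Ψ θ b = intEval Ψ θ' b := fun b =>
    congrArg (fun x : EuclideanSpace ℝ B => x b) e
  funext a
  rw [← hγ θ a, ← hγ θ' a]
  simp [e']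

lemma IsPrimitiveBasis.sq_intEval_le (h : IsPrimitiveBasis V Ψ)
    (hsym : ∀ b₁ b₂ : B, ∃ π : Equiv.Perm B, IsSymmetry V π ∧ π b₁ = b₂) (θ : A → ℝ) (b : B) :
    intEval Ψ θ b ^ 2 ≤ Fintype.card A / Fintype.card B * ∑ x, intEval Ψ θ x ^ 2 := by
  classical
  have hr : Module.finrank ℝ (LinearMap.range (intEvalLin Ψ)) = Fintype.card A := by
    rw [LinearMap.finrank_range_of_inj h.intEvalLin_injective, Module.finrank_fintype_fun_eq_card]
  have := sq_apply_le_of_transitive (LinearMap.range (intEvalLin Ψ)) (fun x y => by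
    obtain ⟨π, hπ, e⟩ := hsym x y
    refine ⟨π, e, ?_⟩
    rintro _ ⟨θ, rfl⟩
    obtain ⟨θ', hθ'⟩ := h.exists_intEval_comp hπ θ
    exact ⟨θ', by ext b; exact hθ' b⟩) (intEvalLin Ψ θ) ⟨θ, rfl⟩ b
  rw [hr] at this
  exact this

omit [Fintype B] in
lemma exists_bounded_int_spanning [Finite B] {c₂ : ℕ} (hV : HasBoundedIntBasisLinf V c₂) :
    ∃ χ : Fin (Module.finrank ℚ V) → B → ℤ, (∀ a b, |χ a b| ≤ c₂) ∧
      LinearIndependent ℚ (fun a b => (χ a b : ℚ)) ∧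
      Submodule.span ℚ (Set.range fun a b => (χ a b : ℚ)) = V := by
  have key := Submodule.exists_fun_fin_finrank_span_eq ℚ
    {f : B → ℚ | f ∈ V ∧ IsIntVec f ∧ ∀ b, |f b| ≤ (c₂ : ℚ)}
  rw [hV] at key
  obtain ⟨f, hf, hspan, hli⟩ := key
  choose z hz using fun i => (hf i).2.1
  have e : (fun a b => (z a b : ℚ)) = f := by funext a b; exact (hz a b).symm
  refine ⟨z, fun a b => ?_, e ▸ hli, e ▸ hspan⟩
  have := (hf a).2.2 b
  rw [hz] at this
  exact_mod_cast this

lemma IsPrimitiveBasis.abs_sub_round_le_average (h : IsPrimitiveBasis V Ψ)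
    (hsym : ∀ b₁ b₂ : B, ∃ π : Equiv.Perm B, IsSymmetry V π ∧ π b₁ = b₂) {c₂ k : ℕ}
    (hV : HasBoundedIntBasisLinf V c₂) (hk : (2 * k * c₂ + 1) ^ Fintype.card A < 2 ^ k)
    (θ : A → ℝ) (b : B) :
    |intEval Ψ θ b - round (intEval Ψ θ b)| ≤ (k : ℝ) ^ 2 *
      ((Fintype.card B : ℝ)⁻¹ * ∑ x, |intEval Ψ θ x - round (intEval Ψ θ x)|) := by
  classical
  obtain ⟨χ, hχ, -, hspan⟩ := exists_bounded_int_spanning hV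
  let G : Finset (Equiv.Perm B) := Finset.univ.filter (IsSymmetry V)
  obtain ⟨s, hs, hG⟩ := card_filter_apply_eq_of_transitive G (by
    intro g hg g' hg'
    simp only [G, Finset.mem_filter, Finset.mem_univ, true_and] at hg hg' ⊢
    exact fun f hf => hg' _ (hg f hf)) (by
    intro x y
    obtain ⟨π, hπ, e⟩ := hsym x y
    exact ⟨π, by simpa [G] using hπ, e⟩)
  refine le_average_of_local_relations G s k hs hG
    (fun x => |intEval Ψ θ x - round (intEval Ψ θ x)|) (fun x => abs_nonneg _) (fun t => ?_) b
  obtain ⟨ε, ⟨j, hj⟩, hε, hrel⟩ := exists_small_relation χ c₂ k hχ (by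
    rwa [Fintype.card_fin, h.finrank_eq]) t
  have hV' : ∀ f ∈ V, ∑ i, (ε i : ℚ) * f (t i) = 0 := by
    intro f hf
    rw [← hspan] at hf
    induction hf using Submodule.span_induction with
    | zero => simp
    | add x y _ _ hx hy => simp [mul_add, Finset.sum_add_distrib, hx, hy]
    | smul r x _ hx =>
      calc ∑ i, (ε i : ℚ) * (r • x) (t i) = r * ∑ i, (ε i : ℚ) * x (t i) := by
            rw [Finset.mul_sum]
            exact Finset.sum_congr rfl fun b _ => by simp; ring
        _ = 0 := by rw [hx, mul_zero]
    | mem f hf =>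
      obtain ⟨a, rfl⟩ := hf
      have := congrArg (Int.cast : ℤ → ℚ) (hrel a)
      push_cast at this
      exact this
  refine ⟨j, fun g hg => ?_⟩
  simp only [G, Finset.mem_filter, Finset.mem_univ, true_and] at hg
  refine abs_sub_round_le_of_relation ε (fun i => intEval Ψ θ (g (t i))) j hj hε ?_
  have := h.sum_intEval_mul_eq_zero (fun i => g (t i)) (fun i => (ε i : ℚ))
    (fun f hf => hV' _ (hg f hf)) θ
  simpa using this

/-- Outside the neighbourhood of `ℤ ^ A` on which `intEval Ψ` is small modulo integers, the
distances of its values to the integers are large on average. -/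
lemma IsPrimitiveBasis.le_sum_sq_sub_round (h : IsPrimitiveBasis V Ψ)
    (hsym : ∀ b₁ b₂ : B, ∃ π : Equiv.Perm B, IsSymmetry V π ∧ π b₁ = b₂) {c₂ c₃ k : ℕ}
    (hc₃ : 1 ≤ c₃) (hA : 0 < Fintype.card A)
    (hV : HasBoundedIntBasisLinf V c₂) (hV' : PerpHasBoundedIntBasisL1 V c₃)
    (hk : (2 * k * c₂ + 1) ^ Fintype.card A < 2 ^ k) (hdk : 8 * Fintype.card A ≤ k)
    (θ : A → ℝ)
    (hθ : ∀ α : A → ℤ, ∃ b, min (1 / (8 * Fintype.card A : ℝ)) (1 / c₃)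
      ≤ |intEval Ψ (θ - fun a => (α a : ℝ)) b|) :
    (Fintype.card B : ℝ) / (c₃ ^ 2 * k ^ 4)
      ≤ ∑ b, |intEval Ψ θ b - round (intEval Ψ θ b)| ^ 2 := by
  set n := Fintype.card B
  set d := Fintype.card A
  obtain ⟨b₀, -⟩ := hθ 0
  have hn : (0 : ℝ) < n := by exact_mod_cast Fintype.card_pos_iff.2 ⟨b₀⟩
  have hc : (0 : ℝ) < c₃ := by exact_mod_cast hc₃
  have hc1 : (1 : ℝ) ≤ c₃ := by exact_mod_cast hc₃
  have hd : (1 : ℝ) ≤ d := by exact_mod_cast hA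
  have hdk' : (8 : ℝ) * d ≤ k := by exact_mod_cast hdk
  have hk0 : (0 : ℝ) < k := by linarith
  set H : B → ℝ := fun b => |intEval Ψ θ b - round (intEval Ψ θ b)| with hH
  by_cases hcase : ∀ b, H b < 1 / c₃
  · obtain ⟨α, hα⟩ := h.exists_round_eq hc₃ hV' θ hcase
    have hsub : ∀ b, intEval Ψ (θ - fun a => (α a : ℝ)) b
        = intEval Ψ θ b - round (intEval Ψ θ b) := by
      intro b
      rw [intEval_sub, intEval_intCast, hα]
    obtain ⟨b, hb⟩ := hθ α
    have hb1 : 1 / (8 * d : ℝ) ≤ |intEval Ψ (θ - fun a => (α a : ℝ)) b| := by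
      rcases min_le_iff.1 hb with h1 | h1
      · exact h1
      · rw [hsub] at h1
        exact absurd (hcase b) (not_lt.2 h1)
    have hlev := h.sq_intEval_le hsym (θ - fun a => (α a : ℝ)) b
    have e : ∑ x, intEval Ψ (θ - fun a => (α a : ℝ)) x ^ 2 = ∑ x, H x ^ 2 :=
      Finset.sum_congr rfl fun x _ => by rw [hsub, hH]; simp only [sq_abs]
    rw [e] at hlev
    have h2 : (1 / (8 * d : ℝ)) ^ 2 ≤ d / n * ∑ x, H x ^ 2 := by
      refine le_trans ?_ hlev
      rw [← sq_abs (intEval Ψ _ b)]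
      exact pow_le_pow_left₀ (by positivity) hb1 2
    have h3 : n / (64 * d ^ 3 : ℝ) ≤ ∑ x, H x ^ 2 := by
      have := mul_le_mul_of_nonneg_left h2 (show (0 : ℝ) ≤ n / d by positivity)
      calc n / (64 * d ^ 3 : ℝ) = n / d * (1 / (8 * d : ℝ)) ^ 2 := by field_simp; norm_num
        _ ≤ _ := this
        _ = _ := by field_simp
    refine le_trans ?_ h3
    refine div_le_div_of_nonneg_left hn.le (by positivity) ?_
    calc (64 * d ^ 3 : ℝ) ≤ 1 ^ 2 * (8 * d) ^ 4 := by
          have : (0 : ℝ) < d ^ 3 := by positivity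
          nlinarith
      _ ≤ _ := by gcongr
  · push Not at hcase
    obtain ⟨b, hb⟩ := hcase
    have h1 := hb.trans (h.abs_sub_round_le_average hsym hV hk θ b)
    have h2 : (∑ x, H x) ^ 2 ≤ n * ∑ x, H x ^ 2 := by
      simpa [n] using sq_sum_le_card_mul_sum_sq (s := Finset.univ) (f := H)
    have h3 := pow_le_pow_left₀ (by positivity) h1 2
    have h4 : (1 / (c₃ : ℝ)) ^ 2 ≤ k ^ 4 / n ^ 2 * (n * ∑ x, H x ^ 2) := by
      refine h3.trans ?_
      calc ((k : ℝ) ^ 2 * ((n : ℝ)⁻¹ * ∑ x, H x)) ^ 2 = k ^ 4 / n ^ 2 * (∑ x, H x) ^ 2 := by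
            field_simp
        _ ≤ _ := by gcongr
    have h5 := mul_le_mul_of_nonneg_left h4 (show (0 : ℝ) ≤ n / k ^ 4 by positivity)
    calc n / (c₃ ^ 2 * k ^ 4 : ℝ) = n / k ^ 4 * (1 / (c₃ : ℝ)) ^ 2 := by field_simp
      _ ≤ _ := h5
      _ = ∑ x, H x ^ 2 := by field_simp

end Geometry

section Fourier

open MeasureTheory

lemma integral_Ico_exp_two_pi_int_mul (m : ℤ) :
    ∫ x in Set.Ico (0 : ℝ) 1, Complex.exp (2 * Real.pi * Complex.I * m * x)
      = if m = 0 then 1 else 0 := by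
  rw [integral_Ico_eq_integral_Ioc, ← intervalIntegral.integral_of_le zero_le_one]
  split_ifs with h
  · simp [h]
  · have hc : (2 * Real.pi * Complex.I * m : ℂ) ≠ 0 := by
      simp [h, Real.pi_ne_zero]
    rw [integral_exp_mul_complex hc]
    have : Complex.exp (2 * Real.pi * Complex.I * m * (1 : ℝ)) = 1 := by
      rw [Complex.exp_eq_one_iff]
      exact ⟨m, by push_cast; ring⟩
    rw [this]
    simp

lemma integral_unitCube_exp {A : Type*} [Fintype A] (m : A → ℤ) :
    ∫ θ in Set.univ.pi fun _ : A => Set.Ico (0 : ℝ) 1,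
        Complex.exp (2 * Real.pi * Complex.I * ∑ a, m a * (θ a : ℂ))
      = if m = 0 then 1 else 0 := by
  have h1 : ∀ θ : A → ℝ, Complex.exp (2 * Real.pi * Complex.I * ∑ a, m a * (θ a : ℂ))
      = ∏ a, Complex.exp (2 * Real.pi * Complex.I * m a * θ a) := by
    intro θ
    rw [← Complex.exp_sum, Finset.mul_sum]
    congr 1
    exact Finset.sum_congr rfl fun a _ => by ring
  simp only [h1]
  rw [volume_pi, Measure.restrict_pi_pi,
    integral_fintype_prod_eq_prod (fun (a : A) (x : ℝ) =>
      Complex.exp (2 * Real.pi * Complex.I * m a * x))]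
  simp only [integral_Ico_exp_two_pi_int_mul]
  by_cases h : m = 0
  · simp [h]
  · rw [if_neg h]
    obtain ⟨a, ha⟩ := Function.ne_iff.1 h
    exact Finset.prod_eq_zero (Finset.mem_univ a) (by simpa using ha)

variable {A B : Type} [Fintype A] [Fintype B] {Ψ : A → B → ℤ}

/-- The characteristic function of the centred random vector `∑ b, ξ b * Ψ · b` with
independent Bernoulli variables `ξ b`. -/
noncomputable def charProd (Ψ : A → B → ℤ) (p : ℝ) (θ : A → ℝ) : ℂ :=
  ∏ b, bernoulliChar p (2 * Real.pi * intEval Ψ θ b)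

omit [Fintype B] in
lemma continuous_intEval (b : B) : Continuous fun θ : A → ℝ => intEval Ψ θ b := by
  unfold intEval; fun_prop

lemma continuous_charProd (p : ℝ) : Continuous (charProd Ψ p) := by
  unfold charProd bernoulliChar
  have := fun b => continuous_intEval (Ψ := Ψ) b
  fun_prop

lemma charProd_eq_sum (p : ℝ) (lam : A → ℤ) (hlam : ∀ a, (lam a : ℝ) = p * ∑ b, (Ψ a b : ℝ))
    (θ : A → ℝ) :
    charProd Ψ p θ = ∑ T : Finset B, (p : ℂ) ^ T.card * (1 - p : ℂ) ^ (Fintype.card B - T.card) *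
      Complex.exp (2 * Real.pi * Complex.I *
        ∑ a, ((∑ b ∈ T, Ψ a b - lam a : ℤ) : ℂ) * (θ a : ℂ)) := by
  classical
  unfold charProd bernoulliChar
  rw [Finset.prod_mul_distrib]
  have e1 : ∏ b, Complex.exp (-(p * (2 * Real.pi * intEval Ψ θ b) : ℝ) * Complex.I)
      = Complex.exp (2 * Real.pi * Complex.I * -∑ a, (lam a : ℂ) * (θ a : ℂ)) := by
    rw [← Complex.exp_sum]
    congr 1
    have : ∑ b, p * intEval Ψ θ b = ∑ a, (lam a : ℝ) * θ a := by
      simp only [intEval, Finset.mul_sum, hlam, Finset.sum_mul]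
      rw [Finset.sum_comm]
      exact Finset.sum_congr rfl fun a _ => Finset.sum_congr rfl fun b _ => by ring
    have this' := congrArg (Complex.ofReal) this
    push_cast at this' ⊢
    rw [← this', ← Finset.sum_neg_distrib, Finset.mul_sum]
    exact Finset.sum_congr rfl fun b _ => by ring
  rw [e1]
  simp only [add_comm (((1 - p : ℝ) : ℂ))]
  rw [Finset.prod_add, Finset.sum_mul, ← Finset.powerset_univ]
  refine Finset.sum_congr rfl fun T _ => ?_
  rw [Finset.prod_mul_distrib, Finset.prod_const, Finset.prod_const, ← Complex.exp_sum,
    Finset.card_sdiff_of_subset (Finset.subset_univ _), Finset.card_univ]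
  push_cast
  have h3 : ∀ x y z w : ℂ, x * Complex.exp y * z * Complex.exp w
      = x * z * Complex.exp (y + w) := fun x y z w => by rw [Complex.exp_add]; ring
  rw [h3]
  congr 2
  have : ∑ b ∈ T, (intEval Ψ θ b : ℂ) = ∑ a, (∑ b ∈ T, (Ψ a b : ℂ)) * θ a := by
    simp only [intEval, Finset.sum_mul]
    push_cast
    rw [Finset.sum_comm]
    exact Finset.sum_congr rfl fun a _ => Finset.sum_congr rfl fun b _ => by ring
  simp only [sub_mul, Finset.sum_sub_distrib]
  rw [← this, ← Finset.sum_mul, ← Finset.mul_sum]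
  ring

lemma integral_charProd [DecidableEq A] (p : ℝ) (lam : A → ℤ)
    (hlam : ∀ a, (lam a : ℝ) = p * ∑ b, (Ψ a b : ℝ)) :
    ∫ θ in Set.univ.pi fun _ : A => Set.Ico (0 : ℝ) 1, charProd Ψ p θ
      = ∑ T : Finset B, if (fun a => ∑ b ∈ T, Ψ a b) = lam then
          (p : ℂ) ^ T.card * (1 - p : ℂ) ^ (Fintype.card B - T.card) else 0 := by
  simp only [charProd_eq_sum p lam hlam]
  rw [integral_finsetSum]
  · refine Finset.sum_congr rfl fun T _ => ?_
    rw [integral_const_mul, integral_unitCube_exp (fun a => ∑ b ∈ T, Ψ a b - lam a)]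
    have : ((fun a => ∑ b ∈ T, Ψ a b - lam a) = 0) ↔ (fun a => ∑ b ∈ T, Ψ a b) = lam := by
      simp only [funext_iff, Pi.zero_apply, sub_eq_zero]
    simp only [this]
    split_ifs <;> simp
  · intro T _
    have hK : IsCompact (Set.univ.pi fun _ : A => Set.Icc (0 : ℝ) 1) :=
      isCompact_univ_pi fun _ => isCompact_Icc
    refine IntegrableOn.mono_set ?_ (Set.pi_mono fun _ _ => Set.Ico_subset_Icc_self)
    exact ContinuousOn.integrableOn_compact hK (by fun_prop)

lemma charProd_add_int {p : ℝ} (lam : A → ℤ) (hlam : ∀ a, (lam a : ℝ) = p * ∑ b, (Ψ a b : ℝ))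
    (θ : A → ℝ) (α : A → ℤ) : charProd Ψ p (θ + fun a => (α a : ℝ)) = charProd Ψ p θ := by
  rw [charProd_eq_sum p lam hlam, charProd_eq_sum p lam hlam]
  refine Finset.sum_congr rfl fun T _ => ?_
  congr 1
  rw [Complex.exp_eq_exp_iff_exists_int]
  refine ⟨∑ a, (∑ b ∈ T, Ψ a b - lam a) * α a, ?_⟩
  simp only [Pi.add_apply]
  push_cast
  simp only [mul_add, Finset.sum_add_distrib]
  ring

end Fourier

section FundamentalDomain

open MeasureTheory

variable {A B : Type} [Fintype A] [DecidableEq A] [Fintype B] {V : Submodule ℚ (B → ℚ)}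
  {Ψ : A → B → ℤ}

lemma mem_span_int_basisFun_iff {A : Type*} [Fintype A] (x : A → ℝ) :
    x ∈ Submodule.span ℤ (Set.range (Pi.basisFun ℝ A)) ↔ ∃ α : A → ℤ, x = fun a => (α a : ℝ) := by
  rw [Module.Basis.mem_span_iff_repr_mem]
  constructor
  · intro h
    choose α hα using h
    exact ⟨α, funext fun a => by simpa using (hα a).symm⟩
  · rintro ⟨α, rfl⟩ a
    exact ⟨α a, by simp⟩

lemma IsPrimitiveBasis.eq_zero_of_abs_intEval_lt_one (h : IsPrimitiveBasis V Ψ) (α : A → ℤ)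
    (hα : ∀ b, |intEval Ψ (fun a => (α a : ℝ)) b| < 1) : α = 0 := by
  obtain ⟨γ, hγ⟩ := h.recover
  have h0 : ∀ b, intEval Ψ (fun a => (α a : ℝ)) b = 0 := by
    intro b
    have := hα b
    rw [intEval_intCast] at this ⊢
    have : |∑ a, α a * Ψ a b| < 1 := by exact_mod_cast this
    rw [Int.abs_lt_one_iff.1 this]
    simp
  funext a
  have := hγ (fun a => (α a : ℝ)) a
  simp only [h0, mul_zero, Finset.sum_const_zero] at this
  exact_mod_cast this.symm

lemma IsPrimitiveBasis.norm_integral_unitCube_sub_le (h : IsPrimitiveBasis V Ψ) {κ ε : ℝ}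
    (hκ : κ ≤ 1 / 2) (F : (A → ℝ) → ℂ) (hF : Continuous F)
    (hper : ∀ θ, ∀ α : A → ℤ, F (θ + fun a => (α a : ℝ)) = F θ) (hε : 0 ≤ ε)
    (hbound : ∀ θ, (∀ α : A → ℤ, ∃ b, κ ≤ |intEval Ψ (θ - fun a => (α a : ℝ)) b|) → ‖F θ‖ ≤ ε) :
    IntegrableOn F {θ | ∀ b, |intEval Ψ θ b| < κ} ∧
    ‖(∫ θ in Set.univ.pi fun _ : A => Set.Ico (0 : ℝ) 1, F θ)
      - ∫ θ in {θ | ∀ b, |intEval Ψ θ b| < κ}, F θ‖ ≤ ε := by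
  set D : Set (A → ℝ) := {θ | ∀ b, |intEval Ψ θ b| < κ} with hD
  set box : Set (A → ℝ) := Set.univ.pi fun _ : A => Set.Ico (0 : ℝ) 1 with hbox
  set Λ := Submodule.span ℤ (Set.range (Pi.basisFun ℝ A)) with hΛ
  set U : Set (A → ℝ) := {θ | ∃ α : A → ℤ, θ - (fun a => (α a : ℝ)) ∈ D} with hU
  have hmem : ∀ α : A → ℤ, (fun a => (α a : ℝ)) ∈ Λ := fun α =>
    (mem_span_int_basisFun_iff _).2 ⟨α, rfl⟩
  have hDopen : IsOpen D := by
    rw [hD, Set.ofPred_forall]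
    exact isOpen_iInter_of_finite fun b =>
      isOpen_lt (continuous_intEval b).abs continuous_const
  have hUopen : IsOpen U := by
    rw [hU, Set.ofPred_exists]
    exact isOpen_iUnion fun α => hDopen.preimage (by fun_prop)
  have hboxm : MeasurableSet box := MeasurableSet.univ_pi fun _ => measurableSet_Ico
  have fbox : IsAddFundamentalDomain Λ box := by
    rw [hbox, ← ZSpan.fundamentalDomain_pi_basisFun]
    exact ZSpan.isAddFundamentalDomain _ _
  have hDU : D ⊆ U := fun θ hθ => ⟨0, by
    have : (fun a : A => (((0 : A → ℤ) a : ℤ) : ℝ)) = 0 := by funext a; simp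
    rwa [this, sub_zero]⟩
  have hUinv : ∀ (x : Λ) (θ : A → ℝ), x +ᵥ θ ∈ U ↔ θ ∈ U := by
    rintro ⟨x, hx⟩ θ
    obtain ⟨β, rfl⟩ := (mem_span_int_basisFun_iff x).1 hx
    constructor
    · rintro ⟨α, hα⟩
      refine ⟨α - β, ?_⟩
      convert hα using 1
      funext a
      simp [Submodule.vadd_def]
      ring
    · rintro ⟨α, hα⟩
      refine ⟨α + β, ?_⟩
      convert hα using 1
      funext a
      simp [Submodule.vadd_def]
      ring
  have fS : IsAddFundamentalDomain Λ (D ∪ (box \ U)) := by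
    refine IsAddFundamentalDomain.mk'
      (hDopen.measurableSet.union (hboxm.diff hUopen.measurableSet)).nullMeasurableSet
      fun θ => ?_
    by_cases hθ : θ ∈ U
    · obtain ⟨α, hα⟩ := id hθ
      refine ⟨⟨_, hmem (-α)⟩, ?_, ?_⟩
      · refine Or.inl ?_
        change (fun a => (((-α) a : ℤ) : ℝ)) + θ ∈ D
        convert hα using 1
        funext a
        simp
        ring
      · rintro ⟨x, hx⟩ hxθ
        obtain ⟨β, rfl⟩ := (mem_span_int_basisFun_iff x).1 hx
        rcases hxθ with hxθ | hxθ
        · change (fun a => (β a : ℝ)) + θ ∈ D at hxθ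
          have : α + β = 0 := by
            refine h.eq_zero_of_abs_intEval_lt_one _ fun b => ?_
            have e : (fun a => (((α + β) a : ℤ) : ℝ))
                = ((fun a => (β a : ℝ)) + θ) - (θ - fun a => (α a : ℝ)) := by
              funext a; simp; ring
            rw [e, intEval_sub]
            refine (abs_sub _ _).trans_lt ?_
            have h1 := hxθ b
            have h2 := hα b
            linarith
          have : β = -α := by rw [eq_neg_iff_add_eq_zero, add_comm]; exact this
          subst this
          rfl
        · exact absurd ((hUinv ⟨_, hx⟩ θ).2 hθ) hxθ.2
    · have hbx : ∃! x : Λ, x +ᵥ θ ∈ box := by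
        have := ZSpan.exist_unique_vadd_mem_fundamentalDomain (Pi.basisFun ℝ A) θ
        rwa [ZSpan.fundamentalDomain_pi_basisFun] at this
      obtain ⟨x, hx, hux⟩ := hbx
      refine ⟨x, Or.inr ⟨hx, fun h' => hθ ((hUinv x θ).1 h')⟩, fun y hy => ?_⟩
      rcases hy with hy | hy
      · exact absurd ((hUinv y θ).1 (hDU hy)) hθ
      · exact hux y hy.1
  have hper' : ∀ (x : Λ) (θ : A → ℝ), F (x +ᵥ θ) = F θ := by
    rintro ⟨x, hx⟩ θ
    obtain ⟨β, rfl⟩ := (mem_span_int_basisFun_iff x).1 hx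
    rw [← hper θ β, add_comm]
    rfl
  have ibox : IntegrableOn F box := by
    have hK : IsCompact (Set.univ.pi fun _ : A => Set.Icc (0 : ℝ) 1) :=
      isCompact_univ_pi fun _ => isCompact_Icc
    exact (hF.continuousOn.integrableOn_compact hK).mono_set
      (Set.pi_mono fun _ _ => Set.Ico_subset_Icc_self)
  have : VAddInvariantMeasure Λ (A → ℝ) volume :=
    inferInstanceAs (VAddInvariantMeasure Λ.toAddSubgroup (A → ℝ) volume)
  have iS : IntegrableOn F (D ∪ (box \ U)) := (fS.integrableOn_iff fbox hper').2 ibox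
  have iD : IntegrableOn F D := iS.mono_set Set.subset_union_left
  refine ⟨iD, ?_⟩
  rw [fbox.setIntegral_eq fS hper', setIntegral_union
    (Set.disjoint_left.2 fun θ h1 h2 => h2.2 (hDU h1)) (hboxm.diff hUopen.measurableSet) iD
    (iS.mono_set Set.subset_union_right), add_sub_cancel_left]
  have vbox : volume box = 1 := by
    rw [hbox, volume_pi_pi]; simp
  have hvol : volume (box \ U) ≤ 1 := vbox ▸ measure_mono Set.sdiff_subset
  refine (norm_setIntegral_le_of_norm_le_const (hvol.trans_lt ENNReal.one_lt_top)
    (C := ε) fun θ hθ => hbound θ fun α => ?_).trans ?_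
  · by_contra! hcon
    exact hθ.2 ⟨α, hcon⟩
  · refine mul_le_of_le_one_right hε ?_
    exact ENNReal.toReal_le_of_le_ofReal zero_le_one (by simpa using hvol)

end FundamentalDomain

section Gaussian

open MeasureTheory Matrix
open scoped MatrixOrder ComplexOrder

lemma integral_exp_neg_mul_sum_sq {A : Type*} [Fintype A] {a : ℝ} (ha : 0 < a) :
    Integrable (fun x : A → ℝ => Real.exp (-a * ∑ i, x i ^ 2)) ∧
      ∫ x : A → ℝ, Real.exp (-a * ∑ i, x i ^ 2) = Real.sqrt (Real.pi / a) ^ Fintype.card A := by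
  have e : (fun x : A → ℝ => Real.exp (-a * ∑ i, x i ^ 2))
      = fun x => ∏ i, Real.exp (-a * x i ^ 2) := by
    funext x
    rw [← Real.exp_sum, Finset.mul_sum]
  rw [e]
  refine ⟨Integrable.fintype_prod (f := fun _ y => Real.exp (-a * y ^ 2))
    fun _ => integrable_exp_neg_mul_sq ha, ?_⟩
  rw [integral_fintype_prod_volume_eq_pow (fun y => Real.exp (-a * y ^ 2)), integral_gaussian]

lemma integral_exp_neg_mul_posDef {A : Type*} [Fintype A] [DecidableEq A] {G : Matrix A A ℝ}
    (hG : G.PosDef) {a : ℝ} (ha : 0 < a) :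
    Integrable (fun x : A → ℝ => Real.exp (-a * (x ⬝ᵥ G *ᵥ x))) ∧
      ∫ x : A → ℝ, Real.exp (-a * (x ⬝ᵥ G *ᵥ x))
        = Real.sqrt (Real.pi / a) ^ Fintype.card A / Real.sqrt G.det := by
  obtain ⟨S, hS⟩ := CStarAlgebra.nonneg_iff_eq_star_mul_self.1 hG.posSemidef.nonneg
  have hdet : G.det = S.det ^ 2 := by
    rw [hS, det_mul, star_eq_conjTranspose, det_conjTranspose]; simp [sq]
  have hS0 : S.det ≠ 0 := by
    intro h0
    have := hG.det_pos
    rw [hdet, h0] at this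
    simp at this
  have hq : ∀ x : A → ℝ, x ⬝ᵥ G *ᵥ x = ∑ i, (toLin' S x) i ^ 2 := by
    intro x
    rw [hS, ← mulVec_mulVec, dotProduct_mulVec, star_eq_conjTranspose,
      conjTranspose_eq_transpose_of_trivial,
      vecMul_transpose, toLin'_apply]
    simp [dotProduct, sq]
  simp only [hq]
  obtain ⟨h1, h2⟩ := integral_exp_neg_mul_sum_sq (A := A) ha
  have hmap := Real.map_matrix_volume_pi_eq_smul_volume_pi hS0
  have hm : Measurable (toLin' S : (A → ℝ) → A → ℝ) :=
    (LinearMap.continuous_of_finiteDimensional (toLin' S)).measurable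
  have h3 : Integrable (fun x : A → ℝ => Real.exp (-a * ∑ i, x i ^ 2))
      (Measure.map (toLin' S) volume) := by
    rw [hmap]; exact h1.smul_measure ENNReal.ofReal_ne_top
  refine ⟨h3.comp_measurable hm, ?_⟩
  rw [← integral_map (f := fun x : A → ℝ => Real.exp (-a * ∑ i, x i ^ 2)) hm.aemeasurable
    h3.aestronglyMeasurable, hmap, integral_smul_measure, h2, hdet, Real.sqrt_sq_eq_abs,
    ENNReal.toReal_ofReal (abs_nonneg _), smul_eq_mul, abs_inv, inv_mul_eq_div]

variable {A B : Type} [Fintype A] [DecidableEq A] [Fintype B] {V : Submodule ℚ (B → ℚ)}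
  {Ψ : A → B → ℤ}

/-- The Gram matrix of the rows of `Ψ`. -/
def gramInt (Ψ : A → B → ℤ) : Matrix A A ℝ := Matrix.of fun a a' => ∑ b, (Ψ a b : ℝ) * Ψ a' b

omit [DecidableEq A] in
lemma dotProduct_gramInt_mulVec (θ : A → ℝ) :
    θ ⬝ᵥ gramInt Ψ *ᵥ θ = ∑ b, intEval Ψ θ b ^ 2 := by
  simp only [dotProduct, mulVec, gramInt, of_apply, intEval, sq, Finset.mul_sum, Finset.sum_mul]
  rw [Finset.sum_congr rfl fun a _ => Finset.sum_comm, Finset.sum_comm]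
  exact Finset.sum_congr rfl fun b _ => Finset.sum_congr rfl fun a _ =>
    Finset.sum_congr rfl fun a' _ => by ring

lemma IsPrimitiveBasis.posDef_gramInt (h : IsPrimitiveBasis V Ψ) : (gramInt Ψ).PosDef := by
  refine PosDef.of_dotProduct_mulVec_pos ?_ fun x hx => ?_
  · ext a a'
    simp [gramInt, conjTranspose_apply, mul_comm]
  · rw [star_trivial, dotProduct_gramInt_mulVec]
    refine lt_of_le_of_ne (Finset.sum_nonneg fun _ _ => sq_nonneg _) fun h0 => hx ?_
    have h1 := (Finset.sum_eq_zero_iff_of_nonneg fun _ _ => sq_nonneg _).1 h0.symm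
    obtain ⟨γ, hγ⟩ := h.recover
    funext a
    rw [← hγ x a]
    refine Finset.sum_eq_zero fun b _ => ?_
    rw [pow_eq_zero_iff two_ne_zero |>.1 (h1 b (Finset.mem_univ b)), mul_zero]

lemma IsPrimitiveBasis.integral_gaussian (h : IsPrimitiveBasis V Ψ) {a : ℝ} (ha : 0 < a) :
    Integrable (fun θ : A → ℝ => Real.exp (-a * ∑ b, intEval Ψ θ b ^ 2)) ∧
      ∫ θ : A → ℝ, Real.exp (-a * ∑ b, intEval Ψ θ b ^ 2)
        = Real.sqrt (Real.pi / a) ^ Fintype.card A / Real.sqrt (gramInt Ψ).det := by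
  simpa only [dotProduct_gramInt_mulVec] using integral_exp_neg_mul_posDef h.posDef_gramInt ha

end Gaussian

section CentralRegion

open MeasureTheory

variable {A B : Type} [Fintype A] [DecidableEq A] [Fintype B] {V : Submodule ℚ (B → ℚ)}
  {Ψ : A → B → ℤ}

lemma mul_sqrt_le_exp {u : ℝ} (hu : 0 ≤ u) : u * Real.sqrt u ≤ Real.exp u := by
  have h1 := Real.quadratic_le_exp_of_nonneg hu
  have h2 := Real.sq_sqrt hu
  nlinarith [sq_nonneg (Real.sqrt u - 1), mul_nonneg hu (sq_nonneg (Real.sqrt u - 1))]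

lemma IsPrimitiveBasis.sum_abs_pow_three_le (h : IsPrimitiveBasis V Ψ)
    (hsym : ∀ b₁ b₂ : B, ∃ π : Equiv.Perm B, IsSymmetry V π ∧ π b₁ = b₂) (θ : A → ℝ) :
    ∑ b, |intEval Ψ θ b| ^ 3 ≤ Real.sqrt (Fintype.card A / Fintype.card B) *
      ((∑ b, intEval Ψ θ b ^ 2) * Real.sqrt (∑ b, intEval Ψ θ b ^ 2)) := by
  have hb : ∀ b, |intEval Ψ θ b| ≤ Real.sqrt (Fintype.card A / Fintype.card B) *
      Real.sqrt (∑ b, intEval Ψ θ b ^ 2) := by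
    intro b
    rw [← Real.sqrt_mul (by positivity)]
    exact Real.abs_le_sqrt (h.sq_intEval_le hsym θ b)
  calc ∑ b, |intEval Ψ θ b| ^ 3
      ≤ ∑ b, Real.sqrt (Fintype.card A / Fintype.card B) *
      Real.sqrt (∑ b, intEval Ψ θ b ^ 2) * intEval Ψ θ b ^ 2 := by
        refine Finset.sum_le_sum fun b _ => ?_
        rw [pow_succ', sq_abs]
        exact mul_le_mul_of_nonneg_right (hb b) (sq_nonneg _)
    _ = _ := by rw [← Finset.mul_sum]; ring

/-- The exponent `2 π² p (1 - p)` of the Gaussian approximation of `charProd`. -/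
noncomputable def gaussExponent (p : ℝ) : ℝ := 2 * Real.pi ^ 2 * (p * (1 - p))

lemma prod_erase_exp_le {p δ : ℝ} (h0 : 0 ≤ p) (h1 : p ≤ 1) (hδ : 0 ≤ δ) [DecidableEq B]
    (v : B → ℝ) (b : B) (hv : |v b| ≤ 1 / 8) :
    ∏ j ∈ Finset.univ.erase b, Real.exp (-(p * (1 - p) / 2 * (1 - δ)) * (2 * Real.pi * v j) ^ 2)
      ≤ 2 * Real.exp (-(gaussExponent p * (1 - δ)) * ∑ j, v j ^ 2) := by
  have hpi := Real.pi_lt_d2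
  have hpi0 := Real.pi_pos
  have e : ∀ j, -(p * (1 - p) / 2 * (1 - δ)) * (2 * Real.pi * v j) ^ 2
      = -(gaussExponent p * (1 - δ)) * v j ^ 2 := fun j => by unfold gaussExponent; ring
  simp only [e]
  rw [← Real.exp_sum, ← Finset.mul_sum, ← Finset.add_sum_erase _ _ (Finset.mem_univ b), mul_add,
    Real.exp_add]
  have hs : gaussExponent p * (1 - δ) * v b ^ 2 ≤ 1 / 2 := by
    have h2 : p * (1 - p) ≤ 1 / 4 := by nlinarith [sq_nonneg (p - 1 / 2)]
    have h3 : 0 ≤ p * (1 - p) := mul_nonneg h0 (by linarith)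
    have h4 : v b ^ 2 ≤ 1 / 64 := by
      rw [← sq_abs]; nlinarith [abs_nonneg (v b)]
    have h5 : Real.pi ^ 2 ≤ 10 := by nlinarith
    have h6 : gaussExponent p ≤ 5 := by
      unfold gaussExponent
      nlinarith [mul_le_mul h5 h2 h3 (by norm_num)]
    have h7 : 0 ≤ gaussExponent p := by unfold gaussExponent; positivity
    calc gaussExponent p * (1 - δ) * v b ^ 2 ≤ gaussExponent p * 1 * v b ^ 2 := by
          gcongr; linarith
      _ ≤ 5 * 1 * (1 / 64) := by gcongr
      _ ≤ 1 / 2 := by norm_num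
  have h8 : 1 ≤ 2 * Real.exp (-(gaussExponent p * (1 - δ)) * v b ^ 2) := by
    have := Real.add_one_le_exp (-(gaussExponent p * (1 - δ)) * v b ^ 2)
    linarith
  have h9 := Real.exp_pos (-(gaussExponent p * (1 - δ)) * ∑ j ∈ Finset.univ.erase b, v j ^ 2)
  nlinarith

omit [DecidableEq A] in
lemma norm_charProd_sub_gaussian_le {p : ℝ} (h0 : 0 ≤ p) (h1 : p ≤ 1) (hA : 0 < Fintype.card A)
    (θ : A → ℝ) (hθ : ∀ b, |intEval Ψ θ b| ≤ 1 / (8 * Fintype.card A)) :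
    ‖charProd Ψ p θ - (Real.exp (-gaussExponent p * ∑ b, intEval Ψ θ b ^ 2) : ℝ)‖
      ≤ 16 / 3 * Real.pi ^ 3 * (p * (1 - p)) * (∑ b, |intEval Ψ θ b| ^ 3) *
        Real.exp (-(gaussExponent p * (1 - 1 / (4 * Fintype.card A))) *
          ∑ b, intEval Ψ θ b ^ 2) := by
  classical
  set v := intEval Ψ θ
  set d : ℝ := (Fintype.card A : ℝ) with hd
  have hd1 : (1 : ℝ) ≤ d := by rw [hd]; exact_mod_cast hA
  have hpi := Real.pi_lt_d2
  have hpi0 := Real.pi_pos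
  have hp : 0 ≤ p * (1 - p) := mul_nonneg h0 (by linarith)
  have hv8 : ∀ b, |v b| ≤ 1 / 8 := fun b => (hθ b).trans (by
    rw [div_le_div_iff₀ (by positivity) (by norm_num)]; linarith)
  have hy : ∀ b, |2 * Real.pi * v b| ≤ 1 := by
    intro b
    rw [abs_mul, abs_of_pos (by positivity)]
    have := hv8 b
    nlinarith [abs_nonneg (v b)]
  have hs : ∀ b, 5 * (2 * Real.pi * v b) ^ 2 / 48 ≤ 1 / (4 * d) := by
    intro b
    have h2 : v b ^ 2 ≤ (1 / (8 * d)) ^ 2 := by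
      rw [← sq_abs]; exact pow_le_pow_left₀ (abs_nonneg _) (hθ b) 2
    have h5 : Real.pi ^ 2 ≤ 10 := by nlinarith
    have h3 : Real.pi ^ 2 * v b ^ 2 ≤ 10 * (1 / (8 * d)) ^ 2 := by gcongr
    have h4 : (1 / (8 * d)) ^ 2 ≤ 1 / (64 * d) := by
      rw [div_pow, one_pow]
      apply one_div_le_one_div_of_le (by positivity)
      nlinarith
    have h6 : 1 / (64 * d) = 1 / (4 * d) / 16 := by field_simp; norm_num
    have h7 : 0 ≤ 1 / (4 * d) := by positivity
    nlinarith
  have e : ((Real.exp (-gaussExponent p * ∑ b, v b ^ 2) : ℝ) : ℂ)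
      = ∏ b, ((Real.exp (-(p * (1 - p) / 2) * (2 * Real.pi * v b) ^ 2) : ℝ) : ℂ) := by
    rw [← Complex.ofReal_prod, ← Real.exp_sum, Finset.mul_sum]
    congr 2
    exact Finset.sum_congr rfl fun b _ => by unfold gaussExponent; ring
  rw [e]
  refine (norm_prod_sub_prod_le_sum Finset.univ _ _
    (fun b => Real.exp (-(p * (1 - p) / 2 * (1 - 1 / (4 * d))) * (2 * Real.pi * v b) ^ 2))
    (fun b _ => norm_bernoulliChar_le_gaussian h0 h1 (hy b) (hs b)) fun b _ => ?_).trans ?_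
  · rw [Complex.norm_real, Real.norm_eq_abs, Real.abs_exp, Real.exp_le_exp]
    have : 0 ≤ 1 / (4 * d) := by positivity
    have h2 := mul_nonneg (mul_nonneg (mul_nonneg hp this) (by norm_num : (0:ℝ) ≤ 1 / 2))
      (sq_nonneg (2 * Real.pi * v b))
    linarith
  · rw [Finset.mul_sum, Finset.sum_mul]
    refine Finset.sum_le_sum fun b _ => ?_
    refine (mul_le_mul (norm_bernoulliChar_sub_gaussian_le h0 h1 (hy b))
      (prod_erase_exp_le h0 h1 (by positivity) v b (hv8 b))
      (Finset.prod_nonneg fun _ _ => (Real.exp_pos _).le) (by positivity)).trans (le_of_eq ?_)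
    rw [abs_mul, abs_of_pos (by positivity : 0 < 2 * Real.pi)]
    ring

lemma IsPrimitiveBasis.norm_charProd_sub_gaussian_le (h : IsPrimitiveBasis V Ψ)
    (hsym : ∀ b₁ b₂ : B, ∃ π : Equiv.Perm B, IsSymmetry V π ∧ π b₁ = b₂) {p : ℝ}
    (h0 : 0 < p) (h1 : p < 1) (hA : 0 < Fintype.card A) (hB : 0 < Fintype.card B)
    (θ : A → ℝ) (hθ : ∀ b, |intEval Ψ θ b| ≤ 1 / (8 * Fintype.card A)) :
    ‖charProd Ψ p θ - (Real.exp (-gaussExponent p * ∑ b, intEval Ψ θ b ^ 2) : ℝ)‖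
      ≤ 16 * Fintype.card A ^ 2 / Real.sqrt (p * (1 - p) * Fintype.card B) *
        Real.exp (-(gaussExponent p * (1 - 1 / (2 * Fintype.card A))) *
          ∑ b, intEval Ψ θ b ^ 2) := by
  refine (_root_.norm_charProd_sub_gaussian_le h0.le h1.le hA θ hθ).trans ?_
  have h3 := h.sum_abs_pow_three_le hsym θ
  set S := ∑ b, intEval Ψ θ b ^ 2
  set d : ℝ := (Fintype.card A : ℝ) with hd
  set n : ℝ := (Fintype.card B : ℝ) with hn
  set a := gaussExponent p with ha
  have hd1 : (1 : ℝ) ≤ d := by rw [hd]; exact_mod_cast hA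
  have hn0 : 0 < n := by rw [hn]; exact_mod_cast hB
  have hpi0 := Real.pi_pos
  have hp : 0 < p * (1 - p) := mul_pos h0 (by linarith)
  have ha0 : 0 < a := by rw [ha]; unfold gaussExponent; positivity
  have hS : 0 ≤ S := Finset.sum_nonneg fun _ _ => sq_nonneg _
  have h4 := mul_sqrt_le_exp (u := a * S / (4 * d)) (by positivity)
  have hexp : Real.exp (-(a * (1 - 1 / (2 * d))) * S)
      = Real.exp (a * S / (4 * d)) * Real.exp (-(a * (1 - 1 / (4 * d))) * S) := by
    rw [← Real.exp_add]; congr 1; field_simp; ring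
  rw [hexp, ← mul_assoc (16 * d ^ 2 / _)]
  refine mul_le_mul_of_nonneg_right ?_ (Real.exp_pos _).le
  calc 16 / 3 * Real.pi ^ 3 * (p * (1 - p)) * ∑ b, |intEval Ψ θ b| ^ 3
      ≤ 16 / 3 * Real.pi ^ 3 * (p * (1 - p)) * (Real.sqrt (d / n) * (S * Real.sqrt S)) := by
        gcongr
    _ = 32 * Real.sqrt 2 / 3 * d ^ 2 / Real.sqrt (p * (1 - p) * n) *
        (a * S / (4 * d) * Real.sqrt (a * S / (4 * d))) := by
        have e1 : Real.sqrt (a * S / (4 * d))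
            = Real.pi * Real.sqrt (p * (1 - p)) * Real.sqrt S / (Real.sqrt 2 * Real.sqrt d) := by
          have : a * S / (4 * d) = Real.pi ^ 2 * (p * (1 - p)) * S / (2 * d) := by
            rw [ha]; unfold gaussExponent; field_simp; ring
          rw [this, Real.sqrt_div (by positivity),
            Real.sqrt_mul (by positivity : 0 ≤ Real.pi ^ 2 * (p * (1 - p))) S,
            Real.sqrt_mul (sq_nonneg _), Real.sqrt_sq hpi0.le, Real.sqrt_mul zero_le_two d]
        rw [e1, Real.sqrt_div (by positivity), Real.sqrt_mul hp.le, ha]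
        have s2 : 0 < Real.sqrt 2 := by positivity
        have sn : 0 < Real.sqrt n := by positivity
        have sd : 0 < Real.sqrt d := by positivity
        have sp : 0 < Real.sqrt (p * (1 - p)) := by positivity
        have sd2 := Real.sq_sqrt (by positivity : 0 ≤ d)
        unfold gaussExponent
        generalize p * (1 - p) = w at *
        field_simp
        rw [sd2]
        ring
    _ ≤ 16 * d ^ 2 / Real.sqrt (p * (1 - p) * n) * Real.exp (a * S / (4 * d)) := by
        have : 32 * Real.sqrt 2 / 3 ≤ 16 := by
          have : Real.sqrt 2 ≤ 3 / 2 := by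
            rw [Real.sqrt_le_left (by norm_num)]; norm_num
          linarith
        gcongr

lemma one_div_sqrt_one_sub_pow_le {d : ℕ} (hd : 0 < d) :
    Real.sqrt (1 / (1 - 1 / (2 * d))) ^ d ≤ 2 := by
  have hd1 : (1 : ℝ) ≤ d := by exact_mod_cast hd
  have hx : 1 / (2 * (d : ℝ)) ≤ 1 / 2 := by
    apply one_div_le_one_div_of_le <;> linarith
  have hb := one_add_mul_le_pow (a := -(1 / (2 * (d : ℝ)))) (by linarith) d
  have e : 1 + (d : ℝ) * -(1 / (2 * d)) = 1 / 2 := by field_simp; norm_num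
  rw [e, ← sub_eq_add_neg] at hb
  have hpos : 0 < 1 - 1 / (2 * (d : ℝ)) := by linarith
  refine le_of_sq_le_sq ?_ (by norm_num)
  rw [← pow_mul, mul_comm d 2, pow_mul, Real.sq_sqrt (by positivity), div_pow, one_pow,
    div_le_iff₀ (by positivity)]
  linarith

/-- The integral of the Gaussian approximation of `charProd`. -/
noncomputable def gaussMass (Ψ : A → B → ℤ) (p : ℝ) : ℝ :=
  Real.sqrt (Real.pi / gaussExponent p) ^ Fintype.card A / Real.sqrt (gramInt Ψ).det

lemma IsPrimitiveBasis.integral_gaussian_loss_le (h : IsPrimitiveBasis V Ψ) {p : ℝ}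
    (h0 : 0 < p) (h1 : p < 1) (hA : 0 < Fintype.card A) :
    Integrable (fun θ : A → ℝ =>
      Real.exp (-(gaussExponent p * (1 - 1 / (2 * Fintype.card A))) * ∑ b, intEval Ψ θ b ^ 2)) ∧
      ∫ θ : A → ℝ,
        Real.exp (-(gaussExponent p * (1 - 1 / (2 * Fintype.card A))) * ∑ b, intEval Ψ θ b ^ 2)
        ≤ 2 * gaussMass Ψ p := by
  have hp : 0 < p * (1 - p) := mul_pos h0 (by linarith)
  have hpi0 := Real.pi_pos
  have ha0 : 0 < gaussExponent p := by unfold gaussExponent; positivity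
  have hd1 : (1 : ℝ) ≤ Fintype.card A := by exact_mod_cast hA
  have hx : 1 / (2 * (Fintype.card A : ℝ)) ≤ 1 / 2 := by
    apply one_div_le_one_div_of_le <;> linarith
  have hpos : 0 < 1 - 1 / (2 * (Fintype.card A : ℝ)) := by linarith
  obtain ⟨i1, i2⟩ := h.integral_gaussian (mul_pos ha0 hpos)
  refine ⟨i1, i2.trans_le ?_⟩
  have e : Real.pi / (gaussExponent p * (1 - 1 / (2 * (Fintype.card A : ℝ))))
      = Real.pi / gaussExponent p * (1 / (1 - 1 / (2 * (Fintype.card A : ℝ)))) := by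
    field_simp
  rw [e, Real.sqrt_mul (by positivity), mul_pow, gaussMass]
  have := one_div_sqrt_one_sub_pow_le hA
  calc _ ≤ Real.sqrt (Real.pi / gaussExponent p) ^ Fintype.card A * 2
      / Real.sqrt (gramInt Ψ).det := by gcongr
    _ = _ := by ring

lemma IsPrimitiveBasis.norm_integral_charProd_sub_gaussMass_le (h : IsPrimitiveBasis V Ψ)
    (hsym : ∀ b₁ b₂ : B, ∃ π : Equiv.Perm B, IsSymmetry V π ∧ π b₁ = b₂) {p κ : ℝ}
    (h0 : 0 < p) (h1 : p < 1) (hA : 0 < Fintype.card A) (hB : 0 < Fintype.card B)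
    (hκ0 : 0 < κ) (hκ : κ ≤ 1 / (8 * Fintype.card A))
    (hint : IntegrableOn (charProd Ψ p) {θ | ∀ b, |intEval Ψ θ b| < κ}) :
    ‖(∫ θ in {θ | ∀ b, |intEval Ψ θ b| < κ}, charProd Ψ p θ) - (gaussMass Ψ p : ℝ)‖
      ≤ gaussMass Ψ p * (32 * Fintype.card A ^ 2 / Real.sqrt (p * (1 - p) * Fintype.card B) +
        2 * Real.exp (-(9 * (p * (1 - p)) * Fintype.card B * κ ^ 2 / Fintype.card A ^ 2))) := by
  set D : Set (A → ℝ) := {θ | ∀ b, |intEval Ψ θ b| < κ} with hD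
  set d : ℝ := (Fintype.card A : ℝ) with hd
  set n : ℝ := (Fintype.card B : ℝ) with hn
  set a := gaussExponent p with ha
  have hd1 : (1 : ℝ) ≤ d := by rw [hd]; exact_mod_cast hA
  have hn0 : 0 < n := by rw [hn]; exact_mod_cast hB
  have hpi0 := Real.pi_pos
  have hpi3 := Real.pi_gt_three
  have hp : 0 < p * (1 - p) := mul_pos h0 (by linarith)
  have ha0 : 0 < a := by rw [ha]; unfold gaussExponent; positivity
  have hDm : MeasurableSet D := by
    rw [hD, Set.ofPred_forall]
    exact MeasurableSet.iInter fun b =>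
      (isOpen_lt (continuous_intEval b).abs continuous_const).measurableSet
  obtain ⟨g1, g2⟩ := h.integral_gaussian ha0
  obtain ⟨l1, l2⟩ := h.integral_gaussian_loss_le h0 h1 hA
  rw [← ha, ← hd] at l1 l2
  set g : (A → ℝ) → ℝ := fun θ => Real.exp (-a * ∑ b, intEval Ψ θ b ^ 2) with hg
  set l : (A → ℝ) → ℝ := fun θ => Real.exp (-(a * (1 - 1 / (2 * d))) * ∑ b, intEval Ψ θ b ^ 2)
    with hl
  have gc : Integrable (fun θ => (g θ : ℂ)) := g1.ofReal
  have hsplit : ((gaussMass Ψ p : ℝ) : ℂ) = (∫ θ in D, (g θ : ℂ)) + ∫ θ in Dᶜ, (g θ : ℂ) := by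
    rw [integral_add_compl hDm gc, integral_complex_ofReal, g2, gaussMass]
  have e : (∫ θ in D, charProd Ψ p θ) - ((gaussMass Ψ p : ℝ) : ℂ)
      = (∫ θ in D, (charProd Ψ p θ - (g θ : ℂ))) - ∫ θ in Dᶜ, (g θ : ℂ) := by
    rw [hsplit, integral_sub hint gc.integrableOn]; ring
  have lpos : ∀ θ, 0 ≤ l θ := fun θ => (Real.exp_pos _).le
  have b1 : ‖∫ θ in D, (charProd Ψ p θ - (g θ : ℂ))‖
      ≤ 16 * d ^ 2 / Real.sqrt (p * (1 - p) * n) * (2 * gaussMass Ψ p) := by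
    calc ‖∫ θ in D, (charProd Ψ p θ - (g θ : ℂ))‖
        ≤ ∫ θ in D, 16 * d ^ 2 / Real.sqrt (p * (1 - p) * n) * l θ := by
          refine norm_integral_le_of_norm_le (l1.const_mul _).integrableOn ?_
          refine (ae_restrict_iff' hDm).2 (Filter.Eventually.of_forall fun θ hθ => ?_)
          exact h.norm_charProd_sub_gaussian_le hsym h0 h1 hA hB θ fun b => (hθ b).le.trans hκ
      _ ≤ ∫ θ, 16 * d ^ 2 / Real.sqrt (p * (1 - p) * n) * l θ :=
          setIntegral_le_integral (l1.const_mul _) (Filter.Eventually.of_forall fun θ =>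
            mul_nonneg (by positivity) (lpos θ))
      _ ≤ _ := by
          rw [integral_const_mul]
          exact mul_le_mul_of_nonneg_left l2 (by positivity)
  have b2 : ‖∫ θ in Dᶜ, (g θ : ℂ)‖
      ≤ Real.exp (-(9 * (p * (1 - p)) * n * κ ^ 2 / d ^ 2)) * (2 * gaussMass Ψ p) := by
    calc ‖∫ θ in Dᶜ, (g θ : ℂ)‖
        ≤ ∫ θ in Dᶜ, Real.exp (-(9 * (p * (1 - p)) * n * κ ^ 2 / d ^ 2)) * l θ := by
          refine norm_integral_le_of_norm_le (l1.const_mul _).integrableOn ?_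
          refine (ae_restrict_iff' hDm.compl).2 (Filter.Eventually.of_forall fun θ hθ => ?_)
          rw [Complex.norm_real, Real.norm_eq_abs, Real.abs_exp, ← Real.exp_add, Real.exp_le_exp]
          have : ∃ b, κ ≤ |intEval Ψ θ b| := by
            by_contra! hcon; exact hθ hcon
          obtain ⟨b, hb⟩ := this
          have h5 := h.sq_intEval_le hsym θ b
          rw [← hd, ← hn] at h5
          have h6 : κ ^ 2 ≤ intEval Ψ θ b ^ 2 := by
            rw [← sq_abs (intEval Ψ θ b)]; exact pow_le_pow_left₀ hκ0.le hb 2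
          have h7 : n * κ ^ 2 / d ≤ ∑ b, intEval Ψ θ b ^ 2 := by
            rw [div_le_iff₀ (by positivity)]
            have := h6.trans h5
            rw [div_mul_eq_mul_div, le_div_iff₀ hn0] at this
            linarith
          have h8 : 9 * (p * (1 - p)) * n * κ ^ 2 / d ^ 2
              ≤ a / (2 * d) * ∑ b, intEval Ψ θ b ^ 2 := by
            calc 9 * (p * (1 - p)) * n * κ ^ 2 / d ^ 2
                = 9 * (p * (1 - p)) / d * (n * κ ^ 2 / d) := by field_simp
              _ ≤ a / (2 * d) * ∑ b, intEval Ψ θ b ^ 2 := by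
                  gcongr ?_ * ?_
                  · rw [div_le_div_iff₀ (by positivity) (by positivity), ha]
                    unfold gaussExponent
                    have : 9 ≤ Real.pi ^ 2 := by nlinarith
                    have h9 := mul_le_mul_of_nonneg_right this
                      (by positivity : 0 ≤ p * (1 - p) * (2 * d))
                    linarith
          have : a * (1 - 1 / (2 * d)) = a - a / (2 * d) := by ring
          rw [this]
          linarith
      _ ≤ ∫ θ, Real.exp (-(9 * (p * (1 - p)) * n * κ ^ 2 / d ^ 2)) * l θ :=
          setIntegral_le_integral (l1.const_mul _) (Filter.Eventually.of_forall fun θ =>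
            mul_nonneg (by positivity) (lpos θ))
      _ ≤ _ := by
          rw [integral_const_mul]
          exact mul_le_mul_of_nonneg_left l2 (by positivity)
  rw [e]
  refine (norm_sub_le _ _).trans ((add_le_add b1 b2).trans (le_of_eq ?_))
  ring

end CentralRegion

section Parameters

lemma exists_pow_lt_two_pow {c d : ℕ} (hc : 1 ≤ c) (hd : 1 ≤ d) :
    ∃ k : ℕ, 8 * d ≤ k ∧ (2 * k * c + 1) ^ d < 2 ^ k ∧ (k : ℝ) ≤ 12 * d * Real.log (2 * c * d) := by
  set L := Nat.log 2 (c * d) + 1 with hL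
  have h1 : c * d < 2 ^ L := Nat.lt_pow_succ_log_self (by norm_num) _
  have hcd : c * d ≠ 0 := Nat.mul_ne_zero (by omega) (by omega)
  have h2 : 2 ^ (L - 1) ≤ c * d := Nat.pow_log_le_self 2 hcd
  have h3 : L < 2 ^ L := Nat.lt_two_pow_self
  refine ⟨8 * d * L, Nat.le_mul_of_pos_right _ (by omega), ?_, ?_⟩
  · rw [show 2 ^ (8 * d * L) = ((2 ^ L) ^ 8) ^ d by rw [← pow_mul, ← pow_mul]; ring_nf]
    refine Nat.pow_lt_pow_left ?_ (by omega)
    have h4 : c * d * L ≤ 2 ^ L * 2 ^ L := Nat.mul_le_mul h1.le h3.le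
    have h5 : 2 ≤ 2 ^ L := by
      calc 2 = 2 ^ 1 := rfl
        _ ≤ 2 ^ L := Nat.pow_le_pow_right (by norm_num) (by omega)
    generalize 2 ^ L = x at *
    have h6 : 2 ^ 6 * (x * x) ≤ x ^ 8 := by
      rw [show x ^ 8 = x ^ 6 * (x * x) by ring]
      exact Nat.mul_le_mul_right _ (Nat.pow_le_pow_left h5 6)
    have h7 : 2 * (8 * d * L) * c + 1 = 16 * (c * d * L) + 1 := by ring
    nlinarith
  · have hlog2 := Real.log_two_gt_d9
    have h8 : (2 : ℝ) ^ L ≤ 2 * c * d := by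
      rw [show L = (L - 1) + 1 by omega, pow_succ]
      have : ((2 : ℝ) ^ (L - 1)) ≤ c * d := by exact_mod_cast h2
      linarith
    have h9 : L * Real.log 2 ≤ Real.log (2 * c * d) := by
      rw [← Real.log_pow]; exact Real.log_le_log (by positivity) h8
    have h10 : (L : ℝ) ≤ 3 / 2 * Real.log (2 * c * d) := by
      have : (0 : ℝ) ≤ L := by positivity
      nlinarith
    push_cast
    have : (0 : ℝ) ≤ d := by positivity
    nlinarith

lemma one_add_log_pow_five_le {c : ℝ} (hc : 1 ≤ c) :
    (1 + 3 / 2 * Real.log c) ^ 5 ≤ 2000 * c := by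
  have hu : 0 ≤ Real.log c := Real.log_nonneg hc
  have h1 := Real.pow_div_factorial_le_exp (Real.log c + 2 / 3) (by positivity) 5
  rw [Real.exp_add, Real.exp_log (by linarith)] at h1
  have h2 : Real.exp (2 / 3) ≤ 2 := by
    rw [← Real.le_log_iff_exp_le (by norm_num)]
    have := Real.log_two_gt_d9
    linarith
  have h3 : (1 + 3 / 2 * Real.log c) ^ 5
      = (3 / 2) ^ 5 * 120 * ((Real.log c + 2 / 3) ^ 5 / (Nat.factorial 5 : ℕ)) := by
    have : ((Nat.factorial 5 : ℕ) : ℝ) = 120 := by norm_num [Nat.factorial]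
    rw [this]; ring
  rw [h3]
  nlinarith

lemma log_mul_le_of_large {c₂ c₃ d μ : ℝ} (h2 : 1 ≤ c₂) (h3 : 1 ≤ c₃) (hd : 1 ≤ d)
    (hμ : 2 ^ 31 * c₂ * c₃ ^ 2 * d ^ 6 * Real.log (2 * c₃ * d) ^ 6 ≤ μ) :
    2592 * c₃ ^ 2 * d ^ 5 * Real.log (2 * c₂ * d) ^ 4 * Real.log (7 * d * c₂ ^ 2 * μ) ≤ μ := by
  set l := Real.log (2 * c₃ * d) with hl
  set u := Real.log c₂ with hu
  have hu0 : 0 ≤ u := Real.log_nonneg h2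
  have hlog2 := Real.log_two_gt_d9
  have hlog2' := Real.log_two_lt_d9
  have hd0 : 0 ≤ Real.log d := Real.log_nonneg hd
  have hc30 : 0 ≤ Real.log c₃ := Real.log_nonneg h3
  have el : l = Real.log 2 + Real.log c₃ + Real.log d := by
    rw [hl, Real.log_mul (by positivity) (by positivity), Real.log_mul (by positivity)
      (by positivity)]
  have el2 : Real.log (2 * c₂ * d) = Real.log 2 + u + Real.log d := by
    rw [Real.log_mul (by positivity) (by positivity), Real.log_mul (by positivity)
      (by positivity)]
  have hl0 : 2 / 3 ≤ l := by linarith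
  set z := 1 + 3 / 2 * u with hz
  have hz1 : 1 ≤ z := by linarith
  have hz5 : z ^ 5 ≤ 2000 * c₂ := one_add_log_pow_five_le h2
  have hell : Real.log (2 * c₂ * d) ≤ l * z := by
    rw [el2, hz]; nlinarith
  have hell0 : 0 ≤ Real.log (2 * c₂ * d) := by rw [el2]; linarith
  set W := 2 ^ 31 * c₂ * c₃ ^ 2 * d ^ 6 * l ^ 6 with hW
  have hW0 : 0 < W := by positivity
  have hμ0 : 0 < μ := hW0.trans_le hμ
  have hlg : Real.log (7 * d * c₂ ^ 2 * μ) ≤ μ / W + 49 * (l * z) := by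
    have e1 : 7 * d * c₂ ^ 2 * μ = 7 * d * c₂ ^ 2 * (W * (μ / W)) := by field_simp
    have e2 : Real.log (7 * d * c₂ ^ 2 * μ)
        = Real.log 7 + Real.log d + 2 * u + (Real.log W + Real.log (μ / W)) := by
      rw [e1, Real.log_mul (by positivity) (by positivity), Real.log_mul (by positivity)
        (by positivity), Real.log_mul (by positivity) (by positivity), Real.log_mul (by positivity)
        (by positivity), Real.log_pow]
      push_cast; ring
    have e3 : Real.log W = 31 * Real.log 2 + u + 2 * Real.log c₃ + 6 * Real.log d
        + 6 * Real.log l := by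
      rw [hW, Real.log_mul (by positivity) (by positivity), Real.log_mul (by positivity)
        (by positivity), Real.log_mul (by positivity) (by positivity), Real.log_mul (by positivity)
        (by positivity), Real.log_pow, Real.log_pow, Real.log_pow, Real.log_pow]
      push_cast; ring
    have h4 := Real.log_le_sub_one_of_pos (div_pos hμ0 hW0)
    have h5 := Real.log_le_sub_one_of_pos (by linarith : 0 < l)
    have h6 : Real.log 7 ≤ 3 * Real.log 2 := by
      rw [show (3 : ℝ) * Real.log 2 = Real.log (2 ^ 3) by rw [Real.log_pow]; norm_num]
      exact Real.log_le_log (by norm_num) (by norm_num)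
    have h7 : l + u ≤ l * z := by rw [hz]; nlinarith
    rw [e2, e3]
    linarith
  have hz4 : z ^ 4 ≤ 2000 * c₂ :=
    (pow_le_pow_right₀ hz1 (by norm_num)).trans hz5
  have hlz : 0 ≤ l * z := by positivity
  have hT1 : 2592 * c₃ ^ 2 * d ^ 5 * (l * z) ^ 4 ≤ W / 2 := by
    calc 2592 * c₃ ^ 2 * d ^ 5 * (l * z) ^ 4 = 2592 * (c₃ ^ 2 * d ^ 5) * l ^ 4 * 1 * 1 * z ^ 4 := by
          ring
      _ ≤ 2592 * (c₃ ^ 2 * d ^ 5) * l ^ 4 * (9 / 4 * l ^ 2) * d * (2000 * c₂) := by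
          gcongr
          nlinarith
      _ = 11664000 * (c₂ * c₃ ^ 2 * d ^ 6 * l ^ 6) := by ring
      _ ≤ 2 ^ 30 * (c₂ * c₃ ^ 2 * d ^ 6 * l ^ 6) := by gcongr; norm_num
      _ = W / 2 := by rw [hW]; ring
  have hT2 : 2592 * c₃ ^ 2 * d ^ 5 * (l * z) ^ 4 * (49 * (l * z)) ≤ W / 2 := by
    calc 2592 * c₃ ^ 2 * d ^ 5 * (l * z) ^ 4 * (49 * (l * z))
        = 127008 * (c₃ ^ 2 * d ^ 5) * l ^ 5 * 1 * 1 * z ^ 5 := by ring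
      _ ≤ 127008 * (c₃ ^ 2 * d ^ 5) * l ^ 5 * (3 / 2 * l) * d * (2000 * c₂) := by
          gcongr
          linarith
      _ = 381024000 * (c₂ * c₃ ^ 2 * d ^ 6 * l ^ 6) := by ring
      _ ≤ 2 ^ 30 * (c₂ * c₃ ^ 2 * d ^ 6 * l ^ 6) := by gcongr; norm_num
      _ = W / 2 := by rw [hW]; ring
  calc _ ≤ 2592 * c₃ ^ 2 * d ^ 5 * Real.log (2 * c₂ * d) ^ 4 * (μ / W + 49 * (l * z)) := by
        gcongr
    _ ≤ 2592 * c₃ ^ 2 * d ^ 5 * (l * z) ^ 4 * (μ / W + 49 * (l * z)) := by gcongr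
    _ = 2592 * c₃ ^ 2 * d ^ 5 * (l * z) ^ 4 * (μ / W)
        + 2592 * c₃ ^ 2 * d ^ 5 * (l * z) ^ 4 * (49 * (l * z)) := by ring
    _ ≤ W / 2 * (μ / W) + W / 2 := by gcongr
    _ = μ / 2 + W / 2 := by field_simp
    _ ≤ μ := by linarith

end Parameters

section GramBound

open MeasureTheory Matrix

variable {A B : Type} [Fintype A] [DecidableEq A] [Fintype B] {V : Submodule ℚ (B → ℚ)}
  {Ψ : A → B → ℤ}

lemma IsPrimitiveBasis.det_gramInt_le_of_linearIndependent (h : IsPrimitiveBasis V Ψ)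
    {χ : A → B → ℤ} (hχ : LinearIndependent ℚ fun a b => (χ a b : ℚ))
    (hmem : ∀ a, (fun b => (χ a b : ℚ)) ∈ V) : (gramInt Ψ).det ≤ (gramInt χ).det := by
  choose P hP using fun a => h.exists_of_intCast_mem (χ a) (hmem a)
  have hdet : (Matrix.of P).det ≠ 0 := by
    intro h0
    obtain ⟨w, hw, hw0⟩ := exists_vecMul_eq_zero_iff.2 h0
    refine hw (funext fun a => ?_)
    have := Fintype.linearIndependent_iff.1 hχ (fun a => (w a : ℚ)) (by
      funext b
      simp only [Finset.sum_apply, Pi.smul_apply, smul_eq_mul, Pi.zero_apply]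
      have h1 : ∑ a, w a * χ a b = 0 := by
        simp only [hP, Finset.mul_sum]
        rw [Finset.sum_comm]
        refine Finset.sum_eq_zero fun a' _ => ?_
        have h2 : ∑ a, w a * P a a' = 0 := congrFun hw0 a'
        simp only [← mul_assoc]
        rw [← Finset.sum_mul, h2, zero_mul]
      exact_mod_cast h1) a
    exact_mod_cast this
  have hgram : gramInt χ = (Matrix.of P).map (Int.cast : ℤ → ℝ) * gramInt Ψ
      * ((Matrix.of P).map (Int.cast : ℤ → ℝ))ᵀ := by
    ext a a'
    simp only [gramInt, mul_apply, of_apply, map_apply, transpose_apply, hP, Int.cast_sum,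
      Int.cast_mul, Finset.sum_mul, Finset.mul_sum]
    rw [Finset.sum_comm]
    refine Finset.sum_congr rfl fun x _ => ?_
    rw [Finset.sum_comm]
    refine Finset.sum_congr rfl fun y _ => ?_
    exact Finset.sum_congr rfl fun b _ => by ring
  have hcast : ((Matrix.of P).map (Int.cast : ℤ → ℝ)).det = ((Matrix.of P).det : ℝ) :=
    (Int.cast_det _).symm
  rw [hgram, det_mul, det_mul, det_transpose, hcast]
  have h1 : (1 : ℝ) ≤ ((Matrix.of P).det : ℝ) ^ 2 := by
    have : 1 ≤ (Matrix.of P).det ^ 2 := by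
      have := Int.one_le_abs hdet
      rw [← sq_abs]; nlinarith
    exact_mod_cast this
  have := h.posDef_gramInt.det_pos
  nlinarith

lemma det_gramInt_le_of_abs_le {c : ℕ} {χ : A → B → ℤ} (hχ : ∀ a b, |χ a b| ≤ c) :
    (gramInt χ).det ≤ (Fintype.card A * (Fintype.card B * (c : ℝ) ^ 2)) ^ Fintype.card A := by
  have hentry : ∀ a a', AbsoluteValue.abs (gramInt χ a a') ≤ Fintype.card B * (c : ℝ) ^ 2 := by
    intro a a'
    rw [AbsoluteValue.abs_apply, gramInt, of_apply]
    refine (Finset.abs_sum_le_sum_abs _ _).trans ?_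
    rw [← nsmul_eq_mul, ← Finset.card_univ]
    refine Finset.sum_le_card_nsmul _ _ _ fun b _ => ?_
    have h1 : ∀ a, |(χ a b : ℝ)| ≤ c := fun a => by exact_mod_cast hχ a b
    rw [abs_mul, sq]
    exact mul_le_mul (h1 a) (h1 a') (abs_nonneg _) (by positivity)
  refine (le_abs_self _).trans ((det_le (abv := AbsoluteValue.abs) hentry).trans ?_)
  rw [nsmul_eq_mul, mul_pow (Fintype.card A : ℝ)]
  refine mul_le_mul_of_nonneg_right ?_ (by positivity)
  exact_mod_cast Nat.factorial_le_pow _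

lemma IsPrimitiveBasis.det_gramInt_le (h : IsPrimitiveBasis V Ψ) {c : ℕ}
    (hV : HasBoundedIntBasisLinf V c) :
    (gramInt Ψ).det ≤ (Fintype.card A * (Fintype.card B * (c : ℝ) ^ 2)) ^ Fintype.card A := by
  obtain ⟨χ, hb, hli, hspan⟩ := exists_bounded_int_spanning hV
  have e : A ≃ Fin (Module.finrank ℚ V) := Fintype.equivFinOfCardEq h.finrank_eq.symm
  refine (h.det_gramInt_le_of_linearIndependent (χ := fun a => χ (e a))
    (hli.comp e e.injective) fun a => ?_).trans (det_gramInt_le_of_abs_le fun a b => hb (e a) b)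
  exact hspan.le (Submodule.subset_span ⟨e a, rfl⟩)

/-- A lower bound for `gaussMass` in exponential form. -/
lemma IsPrimitiveBasis.exp_neg_le_gaussMass (h : IsPrimitiveBasis V Ψ) {c : ℕ} (hc : 1 ≤ c)
    (hV : HasBoundedIntBasisLinf V c) {p x : ℝ} (h0 : 0 < p) (h1 : p < 1)
    (hA : 0 < Fintype.card A) (hμ1 : 1 ≤ p * (1 - p) * Fintype.card B)
    (hx : Fintype.card A *
      Real.log (7 * Fintype.card A * (c : ℝ) ^ 2 * (p * (1 - p) * Fintype.card B)) ≤ x) :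
    Real.exp (-x) * Real.sqrt (p * (1 - p) * Fintype.card B) ≤ gaussMass Ψ p ∧
      Real.exp (-x) * Real.sqrt (p * (1 - p) * Fintype.card B) ≤ 1 := by
  set d := Fintype.card A with hd
  set n : ℝ := (Fintype.card B : ℝ) with hn
  set w := p * (1 - p) with hw
  have hw0 : 0 < w := mul_pos h0 (by linarith)
  have hn0 : 0 < n := by
    by_contra! hcon
    nlinarith
  have hd1 : (1 : ℝ) ≤ d := by exact_mod_cast hA
  have hc1 : (1 : ℝ) ≤ c := by exact_mod_cast hc
  have hpi := Real.pi_lt_d2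
  have hpi0 := Real.pi_pos
  set Z := 7 * d * (c : ℝ) ^ 2 * (w * n) with hZ
  have hZμ : w * n ≤ Z := by
    have : 1 ≤ 7 * d * (c : ℝ) ^ 2 := by nlinarith [one_le_pow₀ hc1 (n := 2)]
    rw [hZ]
    nlinarith
  have hZ1 : 1 ≤ Z := hμ1.trans hZμ
  have hexp : Real.exp (-x) ≤ (Z ^ d)⁻¹ := by
    rw [Real.exp_neg]
    apply inv_anti₀ (by positivity)
    rw [← Real.exp_log (show 0 < Z ^ d by positivity), Real.log_pow]
    exact Real.exp_le_exp.2 hx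
  have hsq : Real.sqrt (w * n) ≤ Real.sqrt Z := Real.sqrt_le_sqrt hZμ
  have hsZ1 : 1 ≤ Real.sqrt Z := Real.one_le_sqrt.2 hZ1
  have hZd : Z ^ d = Real.sqrt Z ^ d * Real.sqrt Z ^ d := by
    rw [← mul_pow, Real.mul_self_sqrt (by positivity)]
  have hkey : Real.exp (-x) * Real.sqrt (w * n) ≤ (Real.sqrt Z ^ d)⁻¹ := by
    calc Real.exp (-x) * Real.sqrt (w * n) ≤ (Z ^ d)⁻¹ * Real.sqrt Z ^ d := by
          refine mul_le_mul hexp (hsq.trans (le_self_pow₀ hsZ1 hA.ne')) (Real.sqrt_nonneg _)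
            (by positivity)
      _ = (Real.sqrt Z ^ d)⁻¹ := by rw [hZd]; field_simp
  refine ⟨hkey.trans ?_, hkey.trans (inv_le_one_of_one_le₀ (one_le_pow₀ hsZ1))⟩
  have hdet := h.det_gramInt_le hV
  have hpos := h.posDef_gramInt.det_pos
  have hsd : Real.sqrt (gramInt Ψ).det ≤ Real.sqrt (d * (n * (c : ℝ) ^ 2)) ^ d := by
    rw [Real.sqrt_le_left (by positivity), ← pow_mul, mul_comm d 2, pow_mul,
      Real.sq_sqrt (by positivity)]
    exact hdet
  have ha : Real.pi / gaussExponent p = (2 * Real.pi * w)⁻¹ := by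
    unfold gaussExponent; rw [← hw]; field_simp
  rw [gaussMass, ← hd, ha, le_div_iff₀ (by positivity)]
  calc (Real.sqrt Z ^ d)⁻¹ * Real.sqrt (gramInt Ψ).det
      ≤ (Real.sqrt Z ^ d)⁻¹ * Real.sqrt (d * (n * (c : ℝ) ^ 2)) ^ d := by gcongr
    _ = Real.sqrt (Z⁻¹ * (d * (n * (c : ℝ) ^ 2))) ^ d := by
        rw [Real.sqrt_mul (inv_nonneg.2 (zero_le_one.trans hZ1)), Real.sqrt_inv, mul_pow, inv_pow]
    _ ≤ Real.sqrt (2 * Real.pi * w)⁻¹ ^ d := by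
        gcongr
        have : Z⁻¹ * (d * (n * (c : ℝ) ^ 2)) = (7 * w)⁻¹ := by
          rw [hZ]; field_simp
        rw [this]
        gcongr
        linarith

/-- The bound on `charProd` away from the lattice. -/
lemma IsPrimitiveBasis.norm_charProd_le (h : IsPrimitiveBasis V Ψ)
    (hsym : ∀ b₁ b₂ : B, ∃ π : Equiv.Perm B, IsSymmetry V π ∧ π b₁ = b₂) {c₂ c₃ k : ℕ}
    (hc₃ : 1 ≤ c₃) (hA : 0 < Fintype.card A) (hV : HasBoundedIntBasisLinf V c₂)
    (hV' : PerpHasBoundedIntBasisL1 V c₃) (hk : (2 * k * c₂ + 1) ^ Fintype.card A < 2 ^ k)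
    (hdk : 8 * Fintype.card A ≤ k) {p : ℝ} (h0 : 0 ≤ p) (h1 : p ≤ 1) (θ : A → ℝ)
    (hθ : ∀ α : A → ℤ, ∃ b, min (1 / (8 * Fintype.card A : ℝ)) (1 / c₃)
      ≤ |intEval Ψ (θ - fun a => (α a : ℝ)) b|) :
    ‖charProd Ψ p θ‖
      ≤ Real.exp (-(8 * (p * (1 - p) * Fintype.card B) / ((c₃ : ℝ) ^ 2 * (k : ℝ) ^ 4))) := by
  have hs := h.le_sum_sq_sub_round hsym hc₃ hA hV hV' hk hdk θ hθ
  rw [charProd, norm_prod]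
  refine (Finset.prod_le_prod (fun _ _ => norm_nonneg _)
    fun b _ => norm_bernoulliChar_le_exp_round h0 h1 (intEval Ψ θ b)).trans ?_
  rw [← Real.exp_sum, Real.exp_le_exp, ← Finset.mul_sum]
  have hp : 0 ≤ p * (1 - p) := mul_nonneg h0 (by linarith)
  have := mul_le_mul_of_nonneg_left hs (mul_nonneg (by norm_num : (0 : ℝ) ≤ 8) hp)
  rw [neg_mul, neg_le_neg_iff]
  refine le_trans (le_of_eq ?_) this
  ring

end GramBound

section LocalLimit

open MeasureTheory

variable {A B : Type} [Fintype A] [DecidableEq A] [Fintype B] {V : Submodule ℚ (B → ℚ)}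
  {Ψ : A → B → ℤ}

lemma local_limit_error_le {g E E' s d : ℝ} (hg : 0 ≤ g) (hs : 0 < s) (hd : 1 ≤ d)
    (h1 : E * s ≤ g) (h2 : E * s ≤ 1) (hE : E' ≤ E) :
    E + g * (32 * d ^ 2 / s + 2 * E') ≤ g * (35 * d ^ 2 / s) := by
  have h1' : E ≤ g * (1 / s) := by rw [mul_one_div, le_div_iff₀ hs]; exact h1
  have h2' : E' ≤ 1 / s := by rw [le_div_iff₀ hs]; nlinarith
  have hd2 : 3 * (1 / s) ≤ 3 * d ^ 2 / s := by
    rw [mul_one_div]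
    gcongr
    nlinarith [one_le_pow₀ hd (n := 2)]
  calc E + g * (32 * d ^ 2 / s + 2 * E')
      ≤ g * (1 / s) + g * (32 * d ^ 2 / s + 2 * (1 / s)) := by gcongr
    _ = g * (32 * d ^ 2 / s + 3 * (1 / s)) := by ring
    _ ≤ g * (32 * d ^ 2 / s + 3 * d ^ 2 / s) := by gcongr
    _ = _ := by ring

/-- The local limit theorem: the torus integral of `charProd` is close to its Gaussian
prediction. -/
lemma IsPrimitiveBasis.norm_integral_unitCube_sub_gaussMass_le (h : IsPrimitiveBasis V Ψ)
    (hsym : ∀ b₁ b₂ : B, ∃ π : Equiv.Perm B, IsSymmetry V π ∧ π b₁ = b₂) {c₂ c₃ : ℕ}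
    (hc₂ : 1 ≤ c₂) (hc₃ : 1 ≤ c₃) (hA : 0 < Fintype.card A) (hB : 0 < Fintype.card B)
    (hV : HasBoundedIntBasisLinf V c₂) (hV' : PerpHasBoundedIntBasisL1 V c₃) {p : ℝ}
    (h0 : 0 < p) (h1 : p < 1) (lam : A → ℤ) (hlam : ∀ a, (lam a : ℝ) = p * ∑ b, (Ψ a b : ℝ))
    (hμ : 2 ^ 31 * (c₂ : ℝ) * (c₃ : ℝ) ^ 2 * (Fintype.card A : ℝ) ^ 6 *
      Real.log (2 * c₃ * Fintype.card A) ^ 6 ≤ p * (1 - p) * Fintype.card B) :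
    ‖(∫ θ in Set.univ.pi fun _ : A => Set.Ico (0 : ℝ) 1, charProd Ψ p θ) - (gaussMass Ψ p : ℝ)‖
      ≤ gaussMass Ψ p *
        (35 * Fintype.card A ^ 2 / Real.sqrt (p * (1 - p) * Fintype.card B)) := by
  obtain ⟨k, hdk, hk, hkl⟩ := exists_pow_lt_two_pow hc₂ hA
  have hd1 : (1 : ℝ) ≤ Fintype.card A := by exact_mod_cast hA
  have hc21 : (1 : ℝ) ≤ c₂ := by exact_mod_cast hc₂
  have hc31 : (1 : ℝ) ≤ c₃ := by exact_mod_cast hc₃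
  have hdk' : (8 : ℝ) * Fintype.card A ≤ k := by exact_mod_cast hdk
  have hlog := log_mul_le_of_large hc21 hc31 hd1 hμ
  set d : ℝ := (Fintype.card A : ℝ) with hd
  set μ : ℝ := p * (1 - p) * Fintype.card B with hμd
  set r : ℝ := (c₃ : ℝ) with hr
  set s : ℝ := (c₂ : ℝ) with hs
  set K : ℝ := (k : ℝ) with hK
  have hK0 : 0 < K := by linarith
  have hμ1 : 1 ≤ μ := by
    have hl : (0.69 : ℝ) ≤ Real.log (2 * r * d) := by
      have h3 : Real.log 2 ≤ Real.log (2 * r * d) :=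
        Real.log_le_log (by norm_num) (by nlinarith)
      linarith [Real.log_two_gt_d9]
    have h4 : (0.69 : ℝ) ^ 6 ≤ Real.log (2 * r * d) ^ 6 := by gcongr
    refine le_trans ?_ hμ
    calc (1 : ℝ) ≤ 2 ^ 31 * 1 * 1 ^ 2 * 1 ^ 6 * 0.69 ^ 6 := by norm_num
      _ ≤ _ := by gcongr
  have hμ0 : 0 < μ := by linarith
  set x : ℝ := 8 * μ / (r ^ 2 * K ^ 4) with hx
  have hxlog : d * Real.log (7 * d * s ^ 2 * μ) ≤ x := by
    rw [hx, le_div_iff₀ (by positivity)]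
    have hL0 : 0 ≤ Real.log (7 * d * s ^ 2 * μ) := by
      apply Real.log_nonneg
      have : 1 ≤ s ^ 2 := one_le_pow₀ hc21
      nlinarith [mul_le_mul this hμ1 zero_le_one (by positivity)]
    have hK4 : K ^ 4 ≤ (12 * d * Real.log (2 * s * d)) ^ 4 := by gcongr
    calc d * Real.log (7 * d * s ^ 2 * μ) * (r ^ 2 * K ^ 4)
        ≤ d * Real.log (7 * d * s ^ 2 * μ) * (r ^ 2 * (12 * d * Real.log (2 * s * d)) ^ 4) := by
          gcongr
      _ = 8 * (2592 * r ^ 2 * d ^ 5 * Real.log (2 * s * d) ^ 4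
            * Real.log (7 * d * s ^ 2 * μ)) := by ring
      _ ≤ 8 * μ := by gcongr
  obtain ⟨hE1, hE2⟩ := h.exp_neg_le_gaussMass hc₂ hV h0 h1 hA hμ1 hxlog
  set κ : ℝ := min (1 / (8 * d)) (1 / r) with hκ
  have hκ0 : 0 < κ := lt_min (by positivity) (by positivity)
  have hκ8 : κ ≤ 1 / (8 * d) := min_le_left _ _
  have hκl : 1 / (8 * d * r) ≤ κ := by
    refine le_min ?_ ?_
    · apply one_div_le_one_div_of_le (by positivity); nlinarith
    · apply one_div_le_one_div_of_le (by positivity); nlinarith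
  have hκh : κ ≤ 1 / 2 := hκ8.trans (one_div_le_one_div_of_le (by norm_num) (by linarith))
  obtain ⟨hint, hcube⟩ := h.norm_integral_unitCube_sub_le hκh (charProd Ψ p)
    (continuous_charProd p) (charProd_add_int lam hlam) (Real.exp_pos (-x)).le
    fun θ hθ => h.norm_charProd_le hsym hc₃ hA hV hV' hk hdk h0.le h1.le θ hθ
  have hbox := h.norm_integral_charProd_sub_gaussMass_le hsym h0 h1 hA hB hκ0 hκ8 hint
  rw [← hμd, ← hd] at hbox
  rw [← hμd] at hE1 hE2
  have hxκ : x ≤ 9 * (p * (1 - p)) * Fintype.card B * κ ^ 2 / d ^ 2 := by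
    have e1 : 9 * (p * (1 - p)) * Fintype.card B * κ ^ 2 / d ^ 2 = 9 * μ * (κ ^ 2 / d ^ 2) := by
      rw [hμd]; ring
    have h5 : (1 / (8 * d * r)) ^ 2 / d ^ 2 ≤ κ ^ 2 / d ^ 2 := by gcongr
    have h6 : (8 * d) ^ 4 ≤ K ^ 4 := by gcongr
    have h7 : 1 / (r ^ 2 * K ^ 4) ≤ 1 / (r ^ 2 * (8 * d) ^ 4) := by gcongr
    have h8 : 1 / (r ^ 2 * (8 * d) ^ 4) = (1 / (8 * d * r)) ^ 2 / d ^ 2 / 64 := by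
      field_simp; norm_num
    have h9 : 0 ≤ κ ^ 2 / d ^ 2 := by positivity
    rw [e1, hx, div_eq_mul_one_div]
    nlinarith
  have hexp : Real.exp (-(9 * (p * (1 - p)) * Fintype.card B * κ ^ 2 / d ^ 2)) ≤ Real.exp (-x) :=
    Real.exp_le_exp.2 (neg_le_neg hxκ)
  have hsμ : 0 < Real.sqrt μ := Real.sqrt_pos.2 hμ0
  have hg0 : 0 ≤ gaussMass Ψ p := by unfold gaussMass; positivity
  exact (norm_sub_le_norm_sub_add_norm_sub _ _ _).trans ((add_le_add hcube hbox).trans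
    (local_limit_error_le hg0 hsμ hd1 hE1 hE2 hexp))

end LocalLimit

section Lattice

open Matrix

variable {A B : Type} [Fintype A] [DecidableEq A] [Fintype B] {V : Submodule ℚ (B → ℚ)}
  {Ψ : A → B → ℤ}

/-- Expressing a basis of `V` in a `ℤ`-basis of the lattice it generates gives a primitive
integral basis. -/
lemma exists_isPrimitiveBasis {φ : A → B → ℚ} (hφ : LinearIndependent ℚ φ)
    (hspan : Submodule.span ℚ (Set.range φ) = V) {M : Matrix A A ℚ}
    (hM : Submodule.span ℤ (Set.range M) = Submodule.span ℤ (Set.range fun b => fun a => φ a b)) :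
    M.det ≠ 0 ∧ ∃ Ψ : A → B → ℤ, IsPrimitiveBasis V Ψ ∧ ∀ a b, φ a b = ∑ c, M c a * Ψ c b := by
  have h1 : ∀ b, ∃ c : A → ℤ, ∑ i, c i • M i = fun a => φ a b := fun b =>
    (Submodule.mem_span_range_iff_exists_fun ℤ).1 (hM.ge (Submodule.subset_span ⟨b, rfl⟩))
  have h2 : ∀ c, ∃ γ : B → ℤ, ∑ b, γ b • (fun a => φ a b) = M c := fun c =>
    (Submodule.mem_span_range_iff_exists_fun ℤ).1 (hM.le (Submodule.subset_span ⟨c, rfl⟩))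
  choose u hu using h1
  choose γ hγ using h2
  set P : Matrix A B ℚ := Matrix.of fun c b => (u b c : ℚ) with hP
  set G : Matrix A B ℚ := Matrix.of fun c b => (γ c b : ℚ) with hG
  have hφP : Matrix.of φ = Mᵀ * P := by
    ext a b
    rw [of_apply, ← congrFun (hu b) a]
    simp [mul_apply, hP, mul_comm]
  have hMG : M = G * Pᵀ * M := by
    have : M = G * (Matrix.of φ)ᵀ := by
      ext c a
      rw [← congrFun (hγ c) a]
      simp [mul_apply, hG]
    rw [hφP, transpose_mul, transpose_transpose, ← Matrix.mul_assoc] at this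
    exact this
  have hdet : M.det ≠ 0 := by
    intro h0
    obtain ⟨w, hw, hw0⟩ := exists_mulVec_eq_zero_iff.2 h0
    refine hw (funext fun a => Fintype.linearIndependent_iff.1 hφ w ?_ a)
    have : w ᵥ* Matrix.of φ = 0 := by
      rw [hφP, ← vecMul_vecMul, vecMul_transpose, hw0, zero_vecMul]
    funext b
    have := congrFun this b
    simpa [vecMul, dotProduct] using this
  have hunit : IsUnit M.det := isUnit_iff_ne_zero.2 hdet
  have hGP : G * Pᵀ = 1 := by
    have : G * Pᵀ * M * M⁻¹ = M * M⁻¹ := by rw [← hMG]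
    rwa [Matrix.mul_assoc, mul_nonsing_inv _ hunit, Matrix.mul_one] at this
  have hPφ : P = Mᵀ⁻¹ * Matrix.of φ := by
    rw [hφP, ← Matrix.mul_assoc, nonsing_inv_mul _ (by rwa [det_transpose]), Matrix.one_mul]
  have hcomb : ∀ {X Y : A → B → ℚ} {Q : Matrix A A ℚ}, Matrix.of X = Q * Matrix.of Y →
      Submodule.span ℚ (Set.range X) ≤ Submodule.span ℚ (Set.range Y) := by
    intro X Y Q hXY
    rw [Submodule.span_le]
    rintro _ ⟨a, rfl⟩
    refine (Submodule.mem_span_range_iff_exists_fun ℚ).2 ⟨Q a, funext fun b => ?_⟩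
    have := congrFun (congrFun hXY a) b
    rw [of_apply] at this
    simp [this, mul_apply]
  refine ⟨hdet, fun c b => u b c, ⟨?_, γ, fun a a' => ?_⟩, fun a b => ?_⟩
  · rw [← hspan]
    exact le_antisymm (hcomb hPφ) (hcomb hφP)
  · have := congrFun (congrFun hGP a) a'
    rw [one_apply] at this
    simp only [mul_apply, hG, hP, of_apply, transpose_apply] at this
    exact_mod_cast this
  · have := congrFun (congrFun hφP a) b
    simpa [mul_apply, hP] using this

/-- The value of `ρ(V)` computed from any basis agrees with the one from an integral basis. -/
lemma abs_det_div_sqrt_det_gram {φ : A → B → ℚ} {M : Matrix A A ℚ} (hM : M.det ≠ 0)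
    (hφ : ∀ a b, φ a b = ∑ c, M c a * Ψ c b) :
    ((|M.det| : ℚ) : ℝ) /
        Real.sqrt (((Matrix.of fun a a' => ∑ b, φ a b * φ a' b).det : ℚ) : ℝ)
      = 1 / Real.sqrt (gramInt Ψ).det := by
  set P : Matrix A B ℚ := Matrix.of fun c b => (Ψ c b : ℚ) with hP
  have h1 : (Matrix.of fun a a' => ∑ b, φ a b * φ a' b) = Mᵀ * (P * Pᵀ) * M := by
    have h2 : Matrix.of φ = Mᵀ * P := by
      ext a b
      simp [mul_apply, hP, hφ]
    have h3 : (Matrix.of fun a a' => ∑ b, φ a b * φ a' b) = Matrix.of φ * (Matrix.of φ)ᵀ := by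
      ext a a'
      simp [mul_apply]
    rw [h3, h2, transpose_mul, transpose_transpose]
    simp only [Matrix.mul_assoc]
  have h2 : (((P * Pᵀ).det : ℚ) : ℝ) = (gramInt Ψ).det := by
    have : gramInt Ψ = (P * Pᵀ).map (algebraMap ℚ ℝ) := by
      ext a a'
      simp [gramInt, mul_apply, hP]
    rw [this]
    exact RingHom.map_det (algebraMap ℚ ℝ) (P * Pᵀ)
  have hM' : (0 : ℝ) < |(M.det : ℝ)| := abs_pos.2 (by exact_mod_cast hM)
  rw [h1, det_mul, det_mul, det_transpose]
  rw [Rat.cast_mul, Rat.cast_mul, Rat.cast_abs, h2,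
    show (M.det : ℝ) * (gramInt Ψ).det * M.det = |(M.det : ℝ)| ^ 2 * (gramInt Ψ).det by
      rw [sq_abs]; ring,
    Real.sqrt_mul (sq_nonneg _), Real.sqrt_sq hM'.le, div_mul_eq_div_div, div_self hM'.ne']

end Lattice

section Counting

open MeasureTheory

variable {A B : Type} [Fintype A] [DecidableEq A] [Fintype B] {V : Submodule ℚ (B → ℚ)}
  {Ψ : A → B → ℤ}

lemma IsPrimitiveBasis.sum_eq_iff (h : IsPrimitiveBasis V Ψ) (hone : (fun _ => (1 : ℚ)) ∈ V)
    {N : ℕ} (hN : 0 < N) (hB : 0 < Fintype.card B) {lam : A → ℤ}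
    (hlam : ∀ a, (lam a : ℚ) = N / Fintype.card B * ∑ b, (Ψ a b : ℚ)) (T : Finset B) :
    (fun a => ∑ b ∈ T, Ψ a b) = lam ↔ T.card = N ∧ ∀ f ∈ V,
      ((T.card : ℚ))⁻¹ * ∑ x ∈ T, f x = ((Fintype.card B : ℚ))⁻¹ * ∑ b, f b := by
  have hN' : (N : ℚ) ≠ 0 := by exact_mod_cast hN.ne'
  have hB' : (Fintype.card B : ℚ) ≠ 0 := by exact_mod_cast hB.ne'
  constructor
  · intro hT
    have hsum : ∀ f ∈ V, ∑ x ∈ T, f x = N / Fintype.card B * ∑ b, f b := by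
      intro f hf
      rw [← h.span] at hf
      induction hf using Submodule.span_induction with
      | mem f hf =>
        obtain ⟨a, rfl⟩ := hf
        rw [← hlam a, ← congrFun hT a]
        push_cast
        rfl
      | zero => simp
      | add f g _ _ hf hg => simp only [Pi.add_apply, Finset.sum_add_distrib, hf, hg, mul_add]
      | smul c f _ hf =>
        simp only [Pi.smul_apply, smul_eq_mul, ← Finset.mul_sum, hf]
        ring
    have hcard : T.card = N := by
      have := hsum _ hone
      simp only [Finset.sum_const, nsmul_eq_mul, mul_one, Finset.card_univ] at this
      rw [div_mul_cancel₀ _ hB'] at this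
      exact_mod_cast this
    refine ⟨hcard, fun f hf => ?_⟩
    rw [hsum f hf, hcard]
    field_simp
  · rintro ⟨hcard, hT⟩
    funext a
    have := hT _ (h.mem a)
    rw [hcard] at this
    have h2 : ((∑ b ∈ T, Ψ a b : ℤ) : ℚ) = lam a := by
      rw [hlam a]
      push_cast
      field_simp at this ⊢
      linarith
    exact_mod_cast h2

/-- The number of balanced subsets as a torus integral. -/
lemma IsPrimitiveBasis.integral_charProd_eq_card_mul (h : IsPrimitiveBasis V Ψ)
    (hone : (fun _ => (1 : ℚ)) ∈ V) {N : ℕ} (hN : 0 < N) (hB : 0 < Fintype.card B) {lam : A → ℤ}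
    (hlam : ∀ a, (lam a : ℚ) = N / Fintype.card B * ∑ b, (Ψ a b : ℚ)) {p : ℝ}
    (hp : p = N / Fintype.card B) :
    ∫ θ in Set.univ.pi fun _ : A => Set.Ico (0 : ℝ) 1, charProd Ψ p θ
      = (((Nat.card {T : Finset B // T.card = N ∧ ∀ f ∈ V,
        ((T.card : ℚ))⁻¹ * ∑ x ∈ T, f x = ((Fintype.card B : ℚ))⁻¹ * ∑ b, f b} : ℝ)
          * (p ^ N * (1 - p) ^ (Fintype.card B - N)) : ℝ) : ℂ) := by
  classical
  have hlam' : ∀ a, (lam a : ℝ) = p * ∑ b, (Ψ a b : ℝ) := fun a => by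
    rw [hp]
    have := congrArg (Rat.cast : ℚ → ℝ) (hlam a)
    push_cast at this
    exact this
  rw [integral_charProd p lam hlam', ← Finset.sum_filter]
  rw [Finset.sum_congr rfl (g := fun _ => (p : ℂ) ^ N * (1 - p : ℂ) ^ (Fintype.card B - N))
    fun T hT => by
      rw [((h.sum_eq_iff hone hN hB hlam T).1 (Finset.mem_filter.1 hT).2).1]]
  rw [Finset.sum_const, nsmul_eq_mul, Nat.card_eq_fintype_card, Fintype.card_subtype,
    Finset.filter_congr fun T _ => h.sum_eq_iff hone hN hB hlam T]
  push_cast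
  rfl

end Counting

section Assembly

variable {A B : Type} [Fintype A] [DecidableEq A] [Fintype B] {V : Submodule ℚ (B → ℚ)}
  {Ψ : A → B → ℤ}

lemma min_le_two_mul_variance {x n : ℝ} (hx : 0 ≤ x) (hxn : x ≤ n) (hn : 0 < n) :
    min x (n - x) ≤ 2 * (x / n * (1 - x / n) * n) := by
  have e : x / n * (1 - x / n) * n = x * (n - x) / n := by field_simp
  rw [e, ← mul_div_assoc, le_div_iff₀ hn]
  rcases le_total x (n - x) with h | h
  · rw [min_eq_left h]; nlinarith
  · rw [min_eq_right h]; nlinarith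

lemma relative_error_le {c d m μ : ℝ} (hc : 1 ≤ c) (hd : 1 ≤ d) (hm : 0 < m) (hmμ : m ≤ 2 * μ) :
    35 * d ^ 2 / Real.sqrt μ ≤
      2 ^ 32 * d ^ 3 * Real.log (2 * c * d) ^ ((3 : ℝ) / 2) / Real.sqrt m := by
  have hμ : 0 < μ := by linarith
  have hl : (0.69 : ℝ) ≤ Real.log (2 * c * d) := by
    have : Real.log 2 ≤ Real.log (2 * c * d) := Real.log_le_log (by norm_num) (by nlinarith)
    linarith [Real.log_two_gt_d9]
  have hl2 : (0.69 : ℝ) ^ 2 ≤ Real.log (2 * c * d) ^ ((3 : ℝ) / 2) := by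
    calc (0.69 : ℝ) ^ 2 = 0.69 ^ (2 : ℝ) := (Real.rpow_ofNat _ _).symm
      _ ≤ 0.69 ^ ((3 : ℝ) / 2) :=
        Real.rpow_le_rpow_of_exponent_ge (by norm_num) (by norm_num) (by norm_num)
      _ ≤ _ := Real.rpow_le_rpow (by norm_num) hl (by norm_num)
  have hs : Real.sqrt m ≤ 2 * Real.sqrt μ := by
    rw [Real.sqrt_le_left (by positivity), mul_pow, Real.sq_sqrt hμ.le]
    linarith
  rw [div_le_div_iff₀ (Real.sqrt_pos.2 hμ) (Real.sqrt_pos.2 hm)]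
  have hd3 : d ^ 2 ≤ d ^ 3 := pow_le_pow_right₀ hd (by norm_num)
  calc 35 * d ^ 2 * Real.sqrt m ≤ 35 * d ^ 3 * (2 * Real.sqrt μ) := by gcongr
    _ = 70 * d ^ 3 * Real.sqrt μ := by ring
    _ ≤ 2 ^ 32 * d ^ 3 * 0.69 ^ 2 * Real.sqrt μ := by
        gcongr ?_ * _
        nlinarith [pow_pos (zero_lt_one.trans_le hd) 3]
    _ ≤ _ := by gcongr

lemma gaussMass_eq {p : ℝ} (h0 : 0 < p) (h1 : p < 1) :
    gaussMass Ψ p = 1 / Real.sqrt (gramInt Ψ).det /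
      (2 * Real.pi * p * (1 - p)) ^ ((Fintype.card A : ℝ) / 2) := by
  have hw : 0 < p * (1 - p) := mul_pos h0 (by linarith)
  have hpi := Real.pi_pos
  have ha : Real.pi / gaussExponent p = (2 * Real.pi * p * (1 - p))⁻¹ := by
    have h3 : (1 - p) ≠ 0 := by linarith
    unfold gaussExponent; field_simp
  have hx : 0 ≤ 2 * Real.pi * p * (1 - p) := by nlinarith
  rw [gaussMass, ha, Real.sqrt_inv, inv_pow, Real.sqrt_eq_rpow, ← Real.rpow_natCast,
    ← Real.rpow_mul hx, one_div_mul_eq_div, one_div, div_eq_inv_mul (_ ^ _)⁻¹,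
    div_eq_mul_inv _ (_ ^ _)]

/-- The counting estimate in terms of a primitive integral basis. -/
lemma IsPrimitiveBasis.abs_card_mul_div_gaussMass_sub_one_le (h : IsPrimitiveBasis V Ψ)
    (hsym : ∀ b₁ b₂ : B, ∃ π : Equiv.Perm B, IsSymmetry V π ∧ π b₁ = b₂) {c₁ c₂ c₃ N : ℕ}
    (hc₂ : 1 ≤ c₂) (hc₃ : 1 ≤ c₃) (hA : 0 < Fintype.card A) (hB : 0 < Fintype.card B)
    (hdiv : IsDivisibilityConstant V c₁) (hV : HasBoundedIntBasisLinf V c₂)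
    (hV' : PerpHasBoundedIntBasisL1 V c₃) (hone : (fun _ => (1 : ℚ)) ∈ V) (hN : c₁ ∣ N)
    (hN0 : 0 < N) (hNB : N < Fintype.card B) {p : ℝ} (hp : p = N / Fintype.card B)
    (hμ : 2 ^ 31 * (c₂ : ℝ) * (c₃ : ℝ) ^ 2 * (Fintype.card A : ℝ) ^ 6 *
      Real.log (2 * c₃ * Fintype.card A) ^ 6 ≤ p * (1 - p) * Fintype.card B) :
    0 < gaussMass Ψ p ∧ |(Nat.card {T : Finset B // T.card = N ∧ ∀ f ∈ V,
        ((T.card : ℚ))⁻¹ * ∑ x ∈ T, f x = ((Fintype.card B : ℚ))⁻¹ * ∑ b, f b} : ℝ)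
          * (p ^ N * (1 - p) ^ (Fintype.card B - N)) / gaussMass Ψ p - 1| ≤
      35 * Fintype.card A ^ 2 / Real.sqrt (p * (1 - p) * Fintype.card B) := by
  have hB' : (0 : ℝ) < Fintype.card B := by exact_mod_cast hB
  have h0 : 0 < p := by rw [hp]; positivity
  have h1 : p < 1 := by rw [hp, div_lt_one hB']; exact_mod_cast hNB
  obtain ⟨γ, hγ⟩ := (hdiv.2 N).2 (by exact_mod_cast hN)
  set lam : A → ℤ := fun a => ∑ b, γ b * Ψ a b with hlam
  have hlamQ : ∀ a, (lam a : ℚ) = N / Fintype.card B * ∑ b, (Ψ a b : ℚ) := fun a => by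
    have := hγ _ (h.mem a)
    rw [Int.cast_natCast] at this
    rw [← this, hlam]
    push_cast
    rfl
  have hlamR : ∀ a, (lam a : ℝ) = p * ∑ b, (Ψ a b : ℝ) := fun a => by
    rw [hp]
    have := congrArg (Rat.cast : ℚ → ℝ) (hlamQ a)
    push_cast at this
    exact this
  have hmain := h.norm_integral_unitCube_sub_gaussMass_le hsym hc₂ hc₃ hA hB hV hV' h0 h1 lam
    hlamR hμ
  rw [h.integral_charProd_eq_card_mul hone hN0 hB hlamQ hp, ← Complex.ofReal_sub,
    Complex.norm_real, Real.norm_eq_abs] at hmain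
  have hg : 0 < gaussMass Ψ p := by
    have hdet := h.posDef_gramInt.det_pos
    have hpi := Real.pi_pos
    have : 0 < gaussExponent p := by
      have : 0 < p * (1 - p) := mul_pos h0 (by linarith)
      unfold gaussExponent
      positivity
    unfold gaussMass
    positivity
  refine ⟨hg, ?_⟩
  rw [div_sub_one hg.ne', abs_div, abs_of_pos hg, div_le_iff₀ hg, mul_comm _ (gaussMass Ψ p)]
  exact hmain

end Assembly

/-- Counting theorem: under the assumptions of the main theorem, the number of subsets
`T ⊆ B` of size `N` averaging every `f ∈ V` exactly as `B` does equals
`ρ(V)/((2πp(1−p))^(dim V/2) p^N (1−p)^(|B|−N)) · (1+δ)`, where `ρ(V)` is expressed via an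
arbitrary basis `φ` of `V` and an arbitrary `ℤ`-basis `M` of the lattice `L(φ)` as
`|det M| / √(det φᵗφ)`. -/
theorem main_theorem_counting :
    ∃ C : ℝ, 0 < C ∧
      ∀ (B : Type) [Fintype B] (V : Submodule ℚ (B → ℚ)) (c₁ c₂ c₃ : ℕ),
        1 ≤ c₁ → 1 ≤ c₂ → 1 ≤ c₃ →
        IsDivisibilityConstant V c₁ →
        HasBoundedIntBasisLinf V c₂ →
        PerpHasBoundedIntBasisL1 V c₃ →
        (∀ b₁ b₂ : B, ∃ π : Equiv.Perm B, IsSymmetry V π ∧ π b₁ = b₂) →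
        (fun _ => (1 : ℚ)) ∈ V →
        ∀ (A : Type) [Fintype A] [DecidableEq A] (φ : A → (B → ℚ)),
          LinearIndependent ℚ φ →
          Submodule.span ℚ (Set.range φ) = V →
          ∀ M : Matrix A A ℚ,
            Submodule.span ℤ (Set.range M)
              = Submodule.span ℤ (Set.range fun b => fun a => φ a b) →
        ∀ N : ℕ, c₁ ∣ N →
          C * c₂ * (c₃ : ℝ) ^ 2 * (Module.finrank ℚ V : ℝ) ^ 6 *
              (Real.log (2 * c₃ * (Module.finrank ℚ V : ℝ))) ^ 6
            ≤ min (N : ℝ) ((Fintype.card B : ℝ) - N) →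
          ∃ δ : ℝ,
            |δ| ≤ C * (Module.finrank ℚ V : ℝ) ^ 3 *
                (Real.log (2 * c₂ * (Module.finrank ℚ V : ℝ))) ^ ((3 : ℝ) / 2)
                / Real.sqrt (min (N : ℝ) ((Fintype.card B : ℝ) - N)) ∧
            (Nat.card {T : Finset B // T.card = N ∧
                ∀ f ∈ V, ((T.card : ℚ))⁻¹ * ∑ x ∈ T, f x
                  = ((Fintype.card B : ℚ))⁻¹ * ∑ b, f b} : ℝ)
              = ((|M.det| : ℚ) : ℝ)
                  / Real.sqrt (((Matrix.of fun a a' => ∑ b, φ a b * φ a' b).det : ℚ) : ℝ)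
                  / ((2 * Real.pi * ((N : ℝ) / (Fintype.card B : ℝ))
                        * (1 - (N : ℝ) / (Fintype.card B : ℝ)))
                          ^ ((Module.finrank ℚ V : ℝ) / 2)
                      * ((N : ℝ) / (Fintype.card B : ℝ)) ^ N
                      * (1 - (N : ℝ) / (Fintype.card B : ℝ)) ^ (Fintype.card B - N))
                  * (1 + δ) := by
  refine ⟨2 ^ 32, by norm_num, ?_⟩
  intro B _ V c₁ c₂ c₃ hc₁ hc₂ hc₃ hdiv hV hV' hsym hone A _ _ φ hφ hspan M hM N hN hbig
  obtain ⟨hdet, Ψ, hΨ, hφΨ⟩ := exists_isPrimitiveBasis hφ hspan hM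
  rw [abs_det_div_sqrt_det_gram hdet hφΨ, hΨ.finrank_eq]
  rw [hΨ.finrank_eq] at hbig
  rcases isEmpty_or_nonempty B with hB | hB
  · have hV0 : Module.finrank ℚ V = 0 := Module.finrank_zero_of_subsingleton
    have hA : Fintype.card A = 0 := hΨ.finrank_eq.symm.trans hV0
    have hAe : IsEmpty A := Fintype.card_eq_zero_iff.1 hA
    have hN0 : N = 0 := by
      rw [hA] at hbig
      have := hbig.trans (min_le_right _ _)
      simp only [Fintype.card_eq_zero, Nat.cast_zero] at this
      have h2 : (N : ℝ) ≤ 0 := by linarith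
      exact Nat.le_zero.1 (by exact_mod_cast h2)
    refine ⟨0, by simp, ?_⟩
    subst hN0
    have hcard : Nat.card {T : Finset B // T.card = 0 ∧ ∀ f ∈ V,
        ((T.card : ℚ))⁻¹ * ∑ x ∈ T, f x = ((Fintype.card B : ℚ))⁻¹ * ∑ b, f b} = 1 := by
      have : Unique {T : Finset B // T.card = 0 ∧ ∀ f ∈ V,
          ((T.card : ℚ))⁻¹ * ∑ x ∈ T, f x = ((Fintype.card B : ℚ))⁻¹ * ∑ b, f b} :=
        { default := ⟨∅, by simp⟩
          uniq := fun T => Subtype.ext (Subsingleton.elim _ _) }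
      exact Nat.card_unique
    rw [hcard]
    simp [Matrix.det_isEmpty]
  have hB0 : 0 < Fintype.card B := Fintype.card_pos
  have hA0 : 0 < Fintype.card A := by
    rw [← hΨ.finrank_eq, Module.finrank_pos_iff_exists_ne_zero]
    refine ⟨⟨_, hone⟩, fun h0 => ?_⟩
    have := congrFun (congrArg Subtype.val h0) (Classical.arbitrary B)
    simp at this
  have hd1 : (1 : ℝ) ≤ Fintype.card A := by exact_mod_cast hA0
  have hc21 : (1 : ℝ) ≤ c₂ := by exact_mod_cast hc₂
  have hc31 : (1 : ℝ) ≤ c₃ := by exact_mod_cast hc₃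
  have hBr : (0 : ℝ) < Fintype.card B := by exact_mod_cast hB0
  have hm : 0 < min (N : ℝ) ((Fintype.card B : ℝ) - N) := by
    refine lt_of_lt_of_le ?_ hbig
    have : 0 < Real.log (2 * c₃ * Fintype.card A) := Real.log_pos (by nlinarith)
    positivity
  have hN0 : 0 < N := by exact_mod_cast hm.trans_le (min_le_left _ _)
  have hNB : N < Fintype.card B := by
    have := hm.trans_le (min_le_right _ _)
    rw [sub_pos] at this
    exact_mod_cast this
  have hmμ := min_le_two_mul_variance (Nat.cast_nonneg N) (by exact_mod_cast hNB.le) hBr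
  set p : ℝ := (N : ℝ) / Fintype.card B with hp
  have hp0 : 0 < p := by positivity
  have hp1 : p < 1 := by rw [hp, div_lt_one hBr]; exact_mod_cast hNB
  obtain ⟨hg, hδ⟩ := hΨ.abs_card_mul_div_gaussMass_sub_one_le hsym hc₂ hc₃ hA0 hB0 hdiv hV hV'
    hone hN hN0 hNB hp (by linarith)
  refine ⟨_, hδ.trans (relative_error_le hc21 hd1 hm hmμ), ?_⟩
  have hw : 0 < p ^ N * (1 - p) ^ (Fintype.card B - N) :=
    mul_pos (pow_pos hp0 _) (pow_pos (by linarith) _)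
  rw [mul_assoc (_ ^ _) (p ^ N), ← div_div, ← gaussMass_eq hp0 hp1, add_sub_cancel,
    div_mul_div_comm, mul_comm (gaussMass Ψ p), mul_div_mul_right _ _ hg.ne',
    mul_div_cancel_right₀ _ hw.ne']
end

section
/- Let q ≥ 2, n ≥ 1, 1 ≤ t ≤ n, B = [q]^n, A = {(I,v) : I ⊆ [n], |I| ≤ t, v ∈ [q−1]^I}, and φ : B → ℤ^A defined by φ(x)_{(I,v)} = 1 if x_i = v_i for all i ∈ I and 0 otherwise (with φ(x)_{(∅,∅)} = 1). Then for every a ∈ A there exists γ^a ∈ ℤ^B with ‖γ^a‖₁ ≤ 2^t and Σ_{b∈B} γ^a_b·φ(b) = e^a (the unit vector at coordinate a); consequently the functions (φ_a)_{a∈A} with φ_a(b) = φ(b)_a are linearly independent and the lattice generated by {φ(b) : b ∈ B} equals ℤ^A. -/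
/-- The index set `A = {(I,v) : I ⊆ [n], |I| ≤ t, v ∈ [q−1]^I}`. -/
abbrev OAIdx (n q t : ℕ) :=
  Σ I : {s : Finset (Fin n) // s.card ≤ t}, ({i // i ∈ I.1} → Fin (q - 1))

/-- The map `φ : [q]^n → ℤ^A`, `φ(x)_{(I,v)} = 1` iff `x_i = v_i` for all `i ∈ I`
(so `φ(x)_{(∅,∅)} = 1`); values in `[q−1]` are the first `q−1` elements of `Fin q`. -/
def oaPhi (n q t : ℕ) (x : Fin n → Fin q) (a : OAIdx n q t) : ℤ :=
  if ∀ i : {i // i ∈ a.1.1}, x i.1 = Fin.castLE (Nat.sub_le q 1) (a.2 i) then 1 else 0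

/-- The partial assignment `(I,v)` seen as a function into `Option`, with `none` off `I`. -/
def oaCode {n q t : ℕ} (a : OAIdx n q t) (i : Fin n) : Option (Fin (q - 1)) :=
  if h : i ∈ a.1.1 then some (a.2 ⟨i, h⟩) else none

theorem oaCode_of_mem {n q t : ℕ} {a : OAIdx n q t} {i : Fin n} (h : i ∈ a.1.1) :
    oaCode a i = some (a.2 ⟨i, h⟩) := dif_pos h

theorem oaCode_of_notMem {n q t : ℕ} {a : OAIdx n q t} {i : Fin n} (h : i ∉ a.1.1) :
    oaCode a i = none := dif_neg h

theorem oaCode_injective {n q t : ℕ} : Function.Injective (oaCode (n := n) (q := q) (t := t)) := by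
  rintro ⟨⟨I, hI⟩, v⟩ ⟨⟨J, hJ⟩, w⟩ h
  have hIJ : I = J := by
    ext i
    have hi := congrFun h i
    by_cases h1 : i ∈ I <;> by_cases h2 : i ∈ J <;> simp_all [oaCode]
  subst hIJ
  have hvw : v = w := by
    funext ⟨i, hi⟩
    have := congrFun h i
    simpa [oaCode, hi] using this
  rw [hvw]

/-- The factor of `oaPhi` at a coordinate with code `o`. -/
def oaFactor {q : ℕ} (o : Option (Fin (q - 1))) (y : Fin q) : ℤ :=
  o.elim 1 fun c => if y = Fin.castLE (Nat.sub_le q 1) c then 1 else 0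

theorem oaPhi_eq_prod {n q t : ℕ} (x : Fin n → Fin q) (a : OAIdx n q t) :
    oaPhi n q t x a = ∏ i, oaFactor (oaCode a i) (x i) := by
  unfold oaPhi
  split_ifs with h
  · refine (Finset.prod_eq_one fun i _ => ?_).symm
    by_cases hi : i ∈ a.1.1
    · simpa [oaCode_of_mem hi, oaFactor] using h ⟨i, hi⟩
    · simp [oaCode_of_notMem hi, oaFactor]
  · push Not at h
    obtain ⟨⟨i, hi⟩, hne⟩ := h
    refine (Finset.prod_eq_zero (Finset.mem_univ i) ?_).symm
    simpa [oaCode_of_mem hi, oaFactor] using hne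

/-- The decoding weight at a coordinate with code `o`, relative to the base symbol `z`:
`δ_z` if `o = none` and `δ_c - δ_z` if `o = some c`. -/
def oaWeight {q : ℕ} (z : Fin q) (o : Option (Fin (q - 1))) (y : Fin q) : ℤ :=
  o.elim (if y = z then 1 else 0) fun c =>
    (if y = Fin.castLE (Nat.sub_le q 1) c then 1 else 0) - if y = z then 1 else 0

theorem sum_oaWeight_mul_oaFactor {q : ℕ} {z : Fin q}
    (hz : ∀ c : Fin (q - 1), z ≠ Fin.castLE (Nat.sub_le q 1) c) (o o' : Option (Fin (q - 1))) :
    ∑ y, oaWeight z o y * oaFactor o' y = if o' = o then 1 else 0 := by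
  cases o <;> cases o' <;>
    simp [oaWeight, oaFactor, Finset.sum_sub_distrib, hz, eq_comm]

theorem sum_abs_oaWeight_le {q : ℕ} (z : Fin q) (o : Option (Fin (q - 1))) :
    ∑ y, |oaWeight z o y| ≤ if o = none then 1 else 2 := by
  cases o with
  | none => simp [oaWeight, apply_ite abs]
  | some c =>
    calc ∑ y, |oaWeight z (some c) y|
        ≤ ∑ y, (|if y = Fin.castLE (Nat.sub_le q 1) c then (1 : ℤ) else 0|
            + |if y = z then (1 : ℤ) else 0|) := Finset.sum_le_sum fun y _ => abs_sub _ _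
      _ = 2 := by simp [Finset.sum_add_distrib, apply_ite abs]
      _ ≤ _ := by simp

theorem prod_oaCode_eq {n q t : ℕ} (a : OAIdx n q t) :
    ∏ i, (if oaCode a i = none then (1 : ℤ) else 2) = 2 ^ a.1.1.card := by
  have h : ∀ i, (if oaCode a i = none then (1 : ℤ) else 2) = if i ∈ a.1.1 then 2 else 1 := by
    intro i
    by_cases hi : i ∈ a.1.1
    · simp [oaCode_of_mem hi, hi]
    · simp [oaCode_of_notMem hi, hi]
  simp [h]

theorem sum_prod_eq_prod_sum {n q : ℕ} (f : Fin n → Fin q → ℤ) :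
    ∑ x : Fin n → Fin q, ∏ i, f i (x i) = ∏ i, ∑ y, f i y := by
  rw [Finset.prod_univ_sum, Fintype.piFinset_univ]

theorem exists_oaDecoder {n q t : ℕ} (hq : 2 ≤ q) (a : OAIdx n q t) :
    ∃ γ : (Fin n → Fin q) → ℤ, (∑ x, |γ x|) ≤ 2 ^ t ∧
      ∀ a' : OAIdx n q t, ∑ x, γ x * oaPhi n q t x a' = if a' = a then 1 else 0 := by
  let z : Fin q := ⟨q - 1, by lia⟩
  have hz : ∀ c : Fin (q - 1), z ≠ Fin.castLE (Nat.sub_le q 1) c := fun c h =>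
    c.isLt.ne' (congrArg Fin.val h)
  refine ⟨fun x => ∏ i, oaWeight z (oaCode a i) (x i), ?_, fun a' => ?_⟩
  · simp only [Finset.abs_prod]
    rw [sum_prod_eq_prod_sum fun i y => |oaWeight z (oaCode a i) y|]
    calc ∏ i, ∑ y, |oaWeight z (oaCode a i) y|
        ≤ ∏ i, (if oaCode a i = none then (1 : ℤ) else 2) :=
          Finset.prod_le_prod (fun i _ => Finset.sum_nonneg fun y _ => abs_nonneg _)
            fun i _ => sum_abs_oaWeight_le z _
      _ = 2 ^ a.1.1.card := prod_oaCode_eq a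
      _ ≤ 2 ^ t := pow_le_pow_right₀ (by norm_num) a.1.2
  · simp only [oaPhi_eq_prod, ← Finset.prod_mul_distrib]
    rw [sum_prod_eq_prod_sum fun i y => oaWeight z (oaCode a i) y * oaFactor (oaCode a' i) y]
    simp only [sum_oaWeight_mul_oaFactor hz]
    split_ifs with h
    · simp [h]
    · obtain ⟨i, hi⟩ := Function.ne_iff.mp (oaCode_injective.ne h)
      exact Finset.prod_eq_zero (Finset.mem_univ i) (if_neg hi)

/-- For each `a ∈ A` there is `γ^a ∈ ℤ^B` with `‖γ^a‖₁ ≤ 2^t` and `Σ_b γ^a_b·φ(b) = e^a`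
(local decodability with bound `2^t` and `m = 1`); consequently the functions
`(φ_a)_{a∈A}` are linearly independent and the lattice generated by `{φ(b)}` is `ℤ^A`. -/
theorem oa_locally_decodable (n q t : ℕ) (hq : 2 ≤ q) (hn : 1 ≤ n)
    (ht : 1 ≤ t) (htn : t ≤ n) :
    (∀ a : OAIdx n q t, ∃ γ : (Fin n → Fin q) → ℤ,
        (∑ x, |γ x|) ≤ 2 ^ t ∧
        ∀ a' : OAIdx n q t,
          ∑ x, γ x * oaPhi n q t x a' = if a' = a then 1 else 0) ∧
    LinearIndependent ℚ (fun a : OAIdx n q t => fun x => (oaPhi n q t x a : ℚ)) ∧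
    Submodule.span ℤ (Set.range fun x : Fin n → Fin q => fun a => oaPhi n q t x a)
      = (⊤ : Submodule ℤ (OAIdx n q t → ℤ)) := by
  have hdec := fun a => exists_oaDecoder (n := n) (t := t) hq a
  refine ⟨hdec, ?_, ?_⟩
  · rw [linearIndependent_iff']
    intro s g hg a ha
    obtain ⟨γ, -, hγ⟩ := hdec a
    have hγ' : ∀ a', ∑ x, (γ x : ℚ) * (oaPhi n q t x a' : ℚ) = if a' = a then 1 else 0 :=
      fun a' => by exact_mod_cast congrArg (Int.cast (R := ℚ)) (hγ a')
    have hsum : ∑ x, (γ x : ℚ) * ∑ a' ∈ s, g a' * (oaPhi n q t x a' : ℚ) = g a := by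
      simp only [Finset.mul_sum, mul_left_comm _ (g _)]
      rw [Finset.sum_comm]
      simp only [← Finset.mul_sum, hγ']
      simp [ha]
    rw [← hsum]
    refine Finset.sum_eq_zero fun x _ => ?_
    have hx := congrFun hg x
    simp only [Finset.sum_apply, Pi.smul_apply, smul_eq_mul, Pi.zero_apply] at hx
    rw [hx, mul_zero]
  · rw [eq_top_iff, ← (Pi.basisFun ℤ (OAIdx n q t)).span_eq, Submodule.span_le]
    rintro _ ⟨a, rfl⟩
    obtain ⟨γ, -, hγ⟩ := hdec a
    have hunit : Pi.basisFun ℤ (OAIdx n q t) a = ∑ x, γ x • fun a' => oaPhi n q t x a' := by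
      funext a'
      simp [Finset.sum_apply, hγ, Pi.single_apply]
    rw [hunit]
    exact Submodule.sum_mem _ fun x _ =>
      Submodule.smul_mem _ _ (Submodule.subset_span ⟨x, rfl⟩)
end

section
/- Let q ≥ 2, n ≥ 1, 1 ≤ t ≤ n, and let V ⊆ ℚ^([q]^n) be the span of all functions f_{(I,v)}(x) = 1 if x_i = v_i for all i ∈ I and 0 otherwise, over subsets I ⊆ [n] of size t and v ∈ [q]^I. Then the divisibility constant of V equals q^t. -/
/-- The subspace `V ⊆ ℚ^([q]^n)` spanned by the indicators `f_{(I,v)}` over subsets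
`I ⊆ [n]` of size `t` and `v ∈ [q]^I`, where `f_{(I,v)}(x) = 1` iff `x_i = v_i` for all
`i ∈ I`. -/
def oaSpace (n q t : ℕ) : Submodule ℚ ((Fin n → Fin q) → ℚ) :=
  Submodule.span ℚ {f : (Fin n → Fin q) → ℚ |
    ∃ I : Finset (Fin n), I.card = t ∧ ∃ v : {i // i ∈ I} → Fin q,
      f = fun x => if ∀ i : {i // i ∈ I}, x i.1 = v i then 1 else 0}

/-- The integral measure on `[q]^n` whose marginal on every `t`-subset of coordinates is the
counting measure: `U^{⊗ t}` is expanded along `U = q δ + (U - q δ)`, with `δ` the point mass at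
`a` and `U` the counting measure on `[q]`. -/
def signedArray {n q : ℕ} (t : ℕ) (a : Fin q) (x : Fin n → Fin q) : ℤ :=
  ∑ S : Finset (Fin n) with S.card ≤ t, (q : ℤ) ^ (t - S.card) *
    ∏ i, if i ∈ S then 1 - (q : ℤ) * (if x i = a then 1 else 0) else if x i = a then 1 else 0

theorem sum_prod_mul_cylinder {n q : ℕ} {R : Type*} [CommRing R] (I : Finset (Fin n))
    (w : Fin n → Fin q) (h : Fin n → Fin q → R) :
    ∑ x : Fin n → Fin q, (∏ i, h i (x i)) * (∏ i ∈ I, if x i = w i then 1 else 0) =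
      ∏ i, if i ∈ I then h i (w i) else ∑ b, h i b := by
  have key (x : Fin n → Fin q) : (∏ i, h i (x i)) * (∏ i ∈ I, if x i = w i then (1 : R) else 0) =
      ∏ i, h i (x i) * (if i ∈ I then (if x i = w i then 1 else 0) else 1) := by
    rw [Finset.prod_mul_distrib, Finset.prod_ite_mem, Finset.univ_inter]
  simp_rw [key]
  rw [← Fintype.prod_sum (fun i b => h i b * (if i ∈ I then (if b = w i then 1 else 0) else 1))]
  refine Finset.prod_congr rfl fun i _ => ?_
  split_ifs <;> simp

theorem sum_cylinder {n q : ℕ} (I : Finset (Fin n)) (w : Fin n → Fin q) :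
    ∑ x : Fin n → Fin q, (∏ i ∈ I, if x i = w i then (1 : ℚ) else 0) =
      (q : ℚ) ^ (n - I.card) := by
  have h := sum_prod_mul_cylinder I w (fun _ _ => (1 : ℚ))
  simp only [Finset.prod_const_one, one_mul] at h
  rw [h, Finset.prod_ite]
  simp [Finset.filter_not, Finset.card_sdiff]

theorem sum_signedArray_mul_cylinder {n q : ℕ} (a : Fin q) (I : Finset (Fin n))
    (w : Fin n → Fin q) :
    ∑ x, signedArray I.card a x * (∏ i ∈ I, if x i = w i then 1 else 0) = 1 := by
  simp only [signedArray, Finset.sum_mul, mul_assoc]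
  rw [Finset.sum_comm]
  simp only [← Finset.mul_sum]
  have key (S : Finset (Fin n)) := sum_prod_mul_cylinder I w (fun i b =>
    if i ∈ S then 1 - (q : ℤ) * (if b = a then 1 else 0) else if b = a then 1 else 0)
  simp only [key]
  have hone : ∏ i ∈ I, ((1 - (q : ℤ) * (if w i = a then 1 else 0)) +
      (q : ℤ) * (if w i = a then 1 else 0)) = 1 := by simp
  rw [Finset.prod_add] at hone
  refine Eq.trans (Eq.symm ?_) hone
  refine Finset.sum_subset_zero_on_sdiff ?_ ?_ ?_
  · intro S hS
    simpa using Finset.card_le_card (Finset.mem_powerset.1 hS)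
  · intro S hS
    obtain ⟨i, hiS, hiI⟩ : ∃ i ∈ S, i ∉ I := by
      simpa [Finset.not_subset] using (Finset.mem_sdiff.1 hS).2
    refine mul_eq_zero_of_right _ (Finset.prod_eq_zero (Finset.mem_univ i) ?_)
    simp [hiS, hiI]
  · intro S hS
    have hSI := Finset.mem_powerset.1 hS
    rw [Finset.prod_mul_distrib, Finset.prod_const, Finset.card_sdiff_of_subset hSI,
      mul_left_comm, ← Finset.prod_subset (Finset.subset_univ I), ← Finset.prod_sdiff hSI,
      mul_comm (∏ i ∈ I \ S, _)]
    · congr 2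
      · refine Finset.prod_congr rfl fun i hi => ?_
        simp [hi, hSI hi]
      · refine Finset.prod_congr rfl fun i hi => ?_
        simp [(Finset.mem_sdiff.1 hi).1, (Finset.mem_sdiff.1 hi).2]
    · intro i _ hiI
      have hiS : i ∉ S := fun h => hiI (hSI h)
      simp [hiI, hiS]

theorem cylinder_eq_prod {n q : ℕ} (I : Finset (Fin n)) (w x : Fin n → Fin q) :
    (if ∀ i : {i // i ∈ I}, x i.1 = w i.1 then (1 : ℚ) else 0) =
      ∏ i ∈ I, if x i = w i then 1 else 0 := by
  rw [Finset.prod_ite_zero]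
  simp

theorem card_div_mul_sum_cylinder {n q : ℕ} (hq : q ≠ 0) (N : ℚ) (I : Finset (Fin n))
    (w : Fin n → Fin q) :
    N / (Fintype.card (Fin n → Fin q) : ℚ) *
      ∑ x : Fin n → Fin q, (∏ i ∈ I, if x i = w i then (1 : ℚ) else 0) = N / (q : ℚ) ^ I.card := by
  have hq' : (q : ℚ) ≠ 0 := Nat.cast_ne_zero.2 hq
  have hI : I.card ≤ n := by simpa using I.card_le_univ
  have hpow : (q : ℚ) ^ n = (q : ℚ) ^ (n - I.card) * (q : ℚ) ^ I.card := by
    rw [← pow_add, Nat.sub_add_cancel hI]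
  rw [sum_cylinder]
  simp only [Fintype.card_fun, Fintype.card_fin, Nat.cast_pow]
  rw [hpow]
  field_simp

/-- The divisibility constant of the orthogonal-array subspace equals `q^t`. -/
theorem oa_divisibility_constant (n q t : ℕ) (hq : 2 ≤ q) (hn : 1 ≤ n)
    (ht : 1 ≤ t) (htn : t ≤ n) :
    IsDivisibilityConstant (oaSpace n q t) (q ^ t) := by
  have hq0 : q ≠ 0 := by omega
  have hqt : (q : ℚ) ^ t ≠ 0 := pow_ne_zero _ (Nat.cast_ne_zero.2 hq0)
  let a : Fin q := ⟨0, by omega⟩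
  refine ⟨pow_pos (by omega) t, fun N => ⟨?_, ?_⟩⟩
  · rintro ⟨γ, hγ⟩
    obtain ⟨I, -, hI⟩ := Finset.exists_subset_card_eq
      (show t ≤ (Finset.univ : Finset (Fin n)).card by simpa using htn)
    have h := hγ _ (Submodule.subset_span ⟨I, hI, fun _ => a, rfl⟩)
    have hc (x : Fin n → Fin q) := cylinder_eq_prod I (fun _ => a) x
    simp only [hc] at h
    rw [card_div_mul_sum_cylinder hq0, hI, eq_div_iff hqt] at h
    refine ⟨∑ x, γ x * ∏ i ∈ I, if x i = a then 1 else 0, ?_⟩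
    rw [mul_comm]
    exact_mod_cast h.symm
  · rintro ⟨m, rfl⟩
    refine ⟨fun x => m * signedArray t a x, fun f hf => ?_⟩
    induction hf using Submodule.span_induction with
    | mem f hf =>
      obtain ⟨I, rfl, v, rfl⟩ := hf
      obtain ⟨w, rfl⟩ : ∃ w : Fin n → Fin q, v = fun i => w i.1 :=
        ⟨fun i => if h : i ∈ I then v ⟨i, h⟩ else a, by ext i; simp⟩
      simp only [cylinder_eq_prod]
      rw [card_div_mul_sum_cylinder hq0]
      have h : ((∑ x, signedArray I.card a x *
          (∏ i ∈ I, if x i = w i then 1 else 0) : ℤ) : ℚ) = 1 := by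
        rw [sum_signedArray_mul_cylinder, Int.cast_one]
      push_cast at h ⊢
      simp only [mul_assoc, ← Finset.mul_sum]
      rw [h, mul_one, mul_div_cancel_left₀ _ hqt]
    | zero => simp
    | add f g _ _ hf hg =>
      simp only [Pi.add_apply, mul_add, Finset.sum_add_distrib, hf, hg]
    | smul c f _ hf =>
      simp only [Pi.smul_apply, smul_eq_mul, mul_left_comm _ c, ← Finset.mul_sum, hf]
end

section
/- Let q ≥ 2, n ≥ 1, 0 ≤ t ≤ n, B = [q]^n, A = {(I,v) : I ⊆ [n], |I| ≤ t, v ∈ [q−1]^I}, and φ the B×A matrix with φ(x)_{(I,v)} = 1 if x_i = v_i for all i ∈ I and 0 otherwise (with φ(x)_{(∅,∅)} = 1). Then det(φᵗφ) = q^(n·C(n−1,t)·(q−1)^t), where (φᵗφ)_{a,a'} = Σ_{x∈[q]^n} φ(x)_a·φ(x)_{a'}. -/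
namespace Matrix

variable {R : Type*} [CommRing R]

theorem det_blockDiagonal' {o : Type*} {m : o → Type*} [Fintype o] [DecidableEq o]
    [∀ i, Fintype (m i)] [∀ i, DecidableEq (m i)] (M : ∀ i, Matrix (m i) (m i) R) :
    (blockDiagonal' M).det = ∏ i, (M i).det := by
  classical
  let _ : LinearOrder o := LinearOrder.lift' (Fintype.equivFin o) (Fintype.equivFin o).injective
  have h : BlockTriangular (blockDiagonal' M) Sigma.fst := by
    rintro ⟨i, i'⟩ ⟨j, j'⟩ hij
    exact blockDiagonal'_apply_ne M i' j' (ne_of_gt hij)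
  rw [h.det_fintype]
  refine Finset.prod_congr rfl fun k _ => ?_
  rw [← det_submatrix_equiv_self (Equiv.sigmaSubtype k).symm]
  congr 1
  ext i j
  exact blockDiagonal'_apply_eq M k i j

theorem det_of_prod_fin {κ : Type*} [Fintype κ] [DecidableEq κ] (M : Matrix κ κ R) (n : ℕ) :
    (of fun v w : Fin n → κ => ∏ i, M (v i) (w i)).det =
      M.det ^ (n * Fintype.card κ ^ (n - 1)) := by
  induction n with
  | zero => simp
  | succ n ih =>
    have h : (of fun v w : Fin (n + 1) → κ => ∏ i, M (v i) (w i)).submatrix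
        (Fin.consEquiv fun _ => κ) (Fin.consEquiv fun _ => κ) =
        kroneckerMap (· * ·) M (of fun v w : Fin n → κ => ∏ i, M (v i) (w i)) := by
      ext ⟨a, v⟩ ⟨b, w⟩
      simp [Fin.prod_univ_succ, Fin.consEquiv]
    rw [← det_submatrix_equiv_self (Fin.consEquiv fun _ => κ), h, det_kronecker, ih, ← pow_mul,
      ← pow_add, Fintype.card_fun, Fintype.card_fin]
    congr 1
    cases n with
    | zero => simp
    | succ n => simp only [Nat.add_sub_cancel]; ring

theorem det_of_prod {ι κ : Type*} [Fintype ι] [DecidableEq ι] [Fintype κ] [DecidableEq κ]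
    (M : Matrix κ κ R) :
    (of fun v w : ι → κ => ∏ i, M (v i) (w i)).det =
      M.det ^ (Fintype.card ι * Fintype.card κ ^ (Fintype.card ι - 1)) := by
  rw [← det_of_prod_fin, ← det_submatrix_equiv_self
    (Equiv.arrowCongr (Fintype.equivFin ι).symm (Equiv.refl κ))]
  congr 1
  ext v w
  simpa using (Fintype.equivFin ι).prod_comp fun i => M (v i) (w i)

theorem det_one_sub_const {κ : Type*} [Fintype κ] [DecidableEq κ] (c : R) :
    (of fun v w : κ => (if v = w then 1 else 0) - c).det = 1 - Fintype.card κ * c := by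
  have h : (of fun v w : κ => (if v = w then 1 else 0) - c) =
      1 - (of fun (_ : κ) (_ : Unit) => c) * (of fun (_ : Unit) (_ : κ) => (1 : R)) := by
    ext v w
    simp [mul_apply, one_apply]
  rw [h, det_one_sub_mul_comm, det_unique]
  simp [mul_apply]

end Matrix

/-- The `i`-th factor of the orthogonalised column `(I,v)`: the indicator of `v i` minus its mean
if `i ∈ I`, and the constant `1` otherwise. -/
def oaCenteredFactor (n q t : ℕ) (a : OAIdx n q t) (i : Fin n) (y : Fin q) : ℚ :=
  if hi : i ∈ a.1.1 then
    (if y = Fin.castLE (Nat.sub_le q 1) (a.2 ⟨i, hi⟩) then 1 else 0) - 1 / (q : ℚ)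
  else 1

/-- The change of basis from the columns of `oaPhi` to their orthogonalisation. -/
def oaCentering (n q t : ℕ) : Matrix (OAIdx n q t) (OAIdx n q t) ℚ := fun a b =>
  if b.1.1 ⊆ a.1.1 ∧ ∀ i (hb : i ∈ b.1.1) (ha : i ∈ a.1.1), b.2 ⟨i, hb⟩ = a.2 ⟨i, ha⟩ then
    (-(1 / (q : ℚ))) ^ (a.1.1.card - b.1.1.card)
  else 0

theorem oaCentering_eq_ite_of_card_le {n q t : ℕ} {a b : OAIdx n q t}
    (h : a.1.1.card ≤ b.1.1.card) : oaCentering n q t a b = if a = b then 1 else 0 := by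
  obtain ⟨⟨I, hI⟩, v⟩ := a
  obtain ⟨⟨J, hJ⟩, w⟩ := b
  unfold oaCentering
  by_cases hab : (⟨⟨I, hI⟩, v⟩ : OAIdx n q t) = ⟨⟨J, hJ⟩, w⟩
  · cases hab
    simp
  · rw [if_neg hab, if_neg]
    rintro ⟨hs, hv⟩
    obtain rfl := Finset.eq_of_subset_of_card_le hs h
    exact hab (by
      congr 1
      funext i
      exact (hv i.1 i.2 i.2).symm)

theorem det_oaCentering (n q t : ℕ) : (oaCentering n q t).det = 1 := by
  have h : Matrix.BlockTriangular (oaCentering n q t)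
      (fun a => OrderDual.toDual a.1.1.card) := by
    intro a b hab
    have hab' : a.1.1.card < b.1.1.card := hab
    rw [oaCentering_eq_ite_of_card_le hab'.le, if_neg]
    rintro rfl
    exact lt_irrefl _ hab'
  rw [h.det]
  refine Finset.prod_eq_one fun k _ => ?_
  suffices h : (oaCentering n q t).toSquareBlock (fun a => OrderDual.toDual a.1.1.card) k = 1 by
    rw [h, Matrix.det_one]
  ext ⟨a, ha⟩ ⟨b, hb⟩
  have hab : a.1.1.card ≤ b.1.1.card := (OrderDual.toDual.injective (ha.trans hb.symm)).le
  simp [Matrix.toSquareBlock_def, oaCentering_eq_ite_of_card_le hab, Matrix.one_apply]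

theorem prod_oaCenteredFactor_eq_sum (n q t : ℕ) (x : Fin n → Fin q) (a : OAIdx n q t) :
    ∏ i, oaCenteredFactor n q t a i (x i) =
      ∑ b, (oaPhi n q t x b : ℚ) * oaCentering n q t a b := by
  classical
  obtain ⟨⟨I, hI⟩, v⟩ := a
  let e : Fin n → ℚ := fun i =>
    if hi : i ∈ I then if x i = Fin.castLE (Nat.sub_le q 1) (v ⟨i, hi⟩) then 1 else 0 else 0
  have hprod : ∏ i, oaCenteredFactor n q t ⟨⟨I, hI⟩, v⟩ i (x i) =
      ∏ i ∈ I, (e i + -(1 / (q : ℚ))) := by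
    rw [← Finset.prod_subset (Finset.subset_univ I)]
    · refine Finset.prod_congr rfl fun i hi => ?_
      simp [oaCenteredFactor, e, hi, sub_eq_add_neg]
    · intro i _ hi
      simp [oaCenteredFactor, hi]
  have hinner (J : {s : Finset (Fin n) // s.card ≤ t}) :
      ∑ w, (oaPhi n q t x ⟨J, w⟩ : ℚ) * oaCentering n q t ⟨⟨I, hI⟩, v⟩ ⟨J, w⟩ =
        if J.1 ⊆ I then (∏ i ∈ J.1, e i) * (-(1 / (q : ℚ))) ^ (I.card - J.1.card) else 0 := by
    split_ifs with hJ
    · rw [Finset.sum_eq_single fun i => v ⟨i.1, hJ i.2⟩]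
      · congr 1
        · rw [← Finset.prod_coe_sort J.1 e]
          have he (i : J.1) : e i =
              if x i = Fin.castLE (Nat.sub_le q 1) (v ⟨i.1, hJ i.2⟩) then 1 else 0 := by
            simp [e, hJ i.2]
          simp [he, Finset.prod_ite_zero, oaPhi]
        · simp [oaCentering, hJ]
      · intro w _ hw
        rw [oaCentering, if_neg, mul_zero]
        rintro ⟨-, h⟩
        exact hw (funext fun i => h i.1 i.2 (hJ i.2))
      · simp
    · refine Finset.sum_eq_zero fun w _ => ?_
      rw [oaCentering, if_neg fun h => hJ h.1, mul_zero]
  rw [hprod, Finset.prod_add, Fintype.sum_sigma, Finset.sum_congr rfl fun J _ => hinner J,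
    ← Finset.sum_filter]
  refine (Finset.sum_bij (fun J _ => J.1) ?_ ?_ ?_ ?_).symm
  · intro J hJ
    simpa using hJ
  · intro J _ K _ h
    exact Subtype.ext h
  · intro J hJ
    rw [Finset.mem_powerset] at hJ
    exact ⟨⟨J, (Finset.card_le_card hJ).trans hI⟩, by simpa using hJ, rfl⟩
  · intro J hJ
    have hJ' : J.1 ⊆ I := by simpa using hJ
    simp [Finset.card_sdiff_of_subset hJ']

/-- The Gram matrix, with respect to counting measure on `q` points, of the centred indicators of
`q - 1` of these points. -/
def oaCenteredGram (q : ℕ) : Matrix (Fin (q - 1)) (Fin (q - 1)) ℚ :=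
  Matrix.of fun v w => (if v = w then 1 else 0) - 1 / (q : ℚ)

theorem det_oaCenteredGram {q : ℕ} (hq : 1 ≤ q) : (oaCenteredGram q).det = 1 / (q : ℚ) := by
  have hq0 : (q : ℚ) ≠ 0 := by positivity
  rw [oaCenteredGram, Matrix.det_one_sub_const, Fintype.card_fin, Nat.cast_sub hq]
  field_simp
  simp

theorem sum_oaCenteredFactor_mul {n q t : ℕ} (hq : 1 ≤ q) (a b : OAIdx n q t) (i : Fin n) :
    ∑ y, oaCenteredFactor n q t a i y * oaCenteredFactor n q t b i y =
      if ha : i ∈ a.1.1 then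
        if hb : i ∈ b.1.1 then oaCenteredGram q (a.2 ⟨i, ha⟩) (b.2 ⟨i, hb⟩) else 0
      else if i ∈ b.1.1 then 0 else (q : ℚ) := by
  have hq0 : (q : ℚ) ≠ 0 := by positivity
  by_cases ha : i ∈ a.1.1 <;> by_cases hb : i ∈ b.1.1
  · simp only [oaCenteredFactor, ha, hb, dif_pos, sub_mul, mul_sub, Finset.sum_sub_distrib,
      ← Finset.sum_mul, ite_mul, mul_ite, Finset.sum_ite_eq', Finset.mem_univ,
      if_true, oaCenteredGram, Matrix.of_apply, mul_one, mul_zero, one_mul, zero_mul,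
      Finset.sum_const, Finset.card_univ, Fintype.card_fin, nsmul_eq_mul,
      (Fin.castLE_injective (Nat.sub_le q 1)).eq_iff]
    field_simp
    simp [eq_comm]
  · simp [oaCenteredFactor, ha, hb, Finset.sum_sub_distrib, hq0]
  · simp [oaCenteredFactor, ha, hb, Finset.sum_sub_distrib, hq0]
  · simp [oaCenteredFactor, ha, hb]

theorem sum_prod_oaCenteredFactor {n q t : ℕ} (hq : 1 ≤ q) (a b : OAIdx n q t) :
    ∑ x : Fin n → Fin q, (∏ i, oaCenteredFactor n q t a i (x i)) *
        ∏ i, oaCenteredFactor n q t b i (x i) =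
      Matrix.blockDiagonal' (fun I : {s : Finset (Fin n) // s.card ≤ t} =>
        (q : ℚ) ^ (n - I.1.card) • Matrix.of fun v w : {i // i ∈ I.1} → Fin (q - 1) =>
          ∏ i, oaCenteredGram q (v i) (w i)) a b := by
  classical
  have h : ∑ x : Fin n → Fin q, (∏ i, oaCenteredFactor n q t a i (x i)) *
        ∏ i, oaCenteredFactor n q t b i (x i) =
      ∏ i, ∑ y, oaCenteredFactor n q t a i y * oaCenteredFactor n q t b i y := by
    simp_rw [← Finset.prod_mul_distrib]
    rw [Finset.prod_univ_sum, Fintype.piFinset_univ]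
  rw [h]
  simp_rw [sum_oaCenteredFactor_mul hq]
  obtain ⟨⟨I, hI⟩, v⟩ := a
  obtain ⟨⟨J, hJ⟩, w⟩ := b
  by_cases hIJ : I = J
  · subst hIJ
    rw [Matrix.blockDiagonal'_apply_eq, ← Finset.prod_mul_prod_compl I, mul_comm]
    simp only [Matrix.smul_apply, Matrix.of_apply, smul_eq_mul]
    congr 1
    · rw [Finset.prod_congr rfl (g := fun _ => (q : ℚ)), Finset.prod_const, Finset.card_compl,
        Fintype.card_fin]
      intro i hi
      simp [Finset.mem_compl.1 hi]
    · rw [← Finset.prod_coe_sort I]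
      exact Finset.prod_congr rfl fun i _ => by simp [i.2]
  · rw [Matrix.blockDiagonal'_apply_ne _ _ _ fun h => hIJ (congrArg Subtype.val h)]
    obtain ⟨i, hi⟩ : ∃ i, ¬(i ∈ I ↔ i ∈ J) := by
      by_contra! h
      exact hIJ (Finset.ext h)
    refine Finset.prod_eq_zero (Finset.mem_univ i) ?_
    by_cases h₁ : i ∈ I <;> by_cases h₂ : i ∈ J <;> simp_all

theorem prod_card_le_pow {K : Type*} [Field K] {c : K} (hc : c ≠ 0) (n m t : ℕ) :
    ∏ I : Finset (Fin (n + 1)) with I.card ≤ t,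
        (c ^ (n + 1 - I.card)) ^ m ^ I.card * (1 / c) ^ (I.card * m ^ (I.card - 1)) =
      c ^ ((n + 1) * n.choose t * m ^ t) := by
  classical
  induction t with
  | zero =>
    have h : (Finset.univ.filter fun I : Finset (Fin (n + 1)) => I.card ≤ 0) = {∅} := by
      ext I
      simp
    rw [h]
    simp
  | succ t ih =>
    have h : (Finset.univ.filter fun I : Finset (Fin (n + 1)) => I.card ≤ t + 1) =
        (Finset.univ.filter fun I : Finset (Fin (n + 1)) => I.card ≤ t) ∪
          Finset.powersetCard (t + 1) Finset.univ := by
      ext I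
      simp [Finset.mem_powersetCard]
      omega
    have hd : Disjoint (Finset.univ.filter fun I : Finset (Fin (n + 1)) => I.card ≤ t)
        (Finset.powersetCard (t + 1) Finset.univ) := by
      rw [Finset.disjoint_left]
      intro I hI
      simp [Finset.mem_powersetCard] at hI ⊢
      omega
    rw [h, Finset.prod_union hd, ih, Finset.prod_congr rfl
      (g := fun _ => (c ^ (n + 1 - (t + 1))) ^ m ^ (t + 1) * (1 / c) ^ ((t + 1) * m ^ t))]
    · rw [Finset.prod_const, Finset.card_powersetCard, Finset.card_univ, Fintype.card_fin, mul_pow,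
        ← pow_mul, ← pow_mul, ← pow_mul, one_div, inv_pow]
      have h₁ : (n + 1 - (t + 1)) * (m ^ (t + 1) * (n + 1).choose (t + 1)) =
          (n + 1) * n.choose (t + 1) * m ^ (t + 1) := by
        linear_combination m ^ (t + 1) * (Nat.choose_mul_succ_eq n (t + 1)).symm
      have h₂ : (t + 1) * m ^ t * (n + 1).choose (t + 1) = (n + 1) * n.choose t * m ^ t := by
        linear_combination m ^ t * (Nat.add_one_mul_choose_eq n t).symm
      rw [h₁, h₂]
      field_simp
    · intro I hI
      rw [(Finset.mem_powersetCard.1 hI).2, Nat.add_sub_cancel]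

/-- `det(φᵗφ) = q^(n·C(n−1,t)·(q−1)^t)`, where `φᵗφ` is the `A×A` Gram matrix
`(φᵗφ)_{a,a'} = Σ_{x ∈ [q]^n} φ(x)_a·φ(x)_{a'}`. -/
theorem oa_gram_determinant (n q t : ℕ) (hq : 2 ≤ q) (hn : 1 ≤ n) (htn : t ≤ n) :
    (Matrix.of fun a a' : OAIdx n q t =>
        ∑ x : Fin n → Fin q, (oaPhi n q t x a : ℚ) * (oaPhi n q t x a' : ℚ)).det
      = (q : ℚ) ^ (n * (n - 1).choose t * (q - 1) ^ t) := by
  have hq1 : 1 ≤ q := one_le_two.trans hq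
  have hq0 : (q : ℚ) ≠ 0 := by positivity
  let Φ : Matrix (Fin n → Fin q) (OAIdx n q t) ℚ := Matrix.of fun x a => (oaPhi n q t x a : ℚ)
  let U := oaCentering n q t
  have hΦ : (Matrix.of fun a a' : OAIdx n q t =>
      ∑ x : Fin n → Fin q, (oaPhi n q t x a : ℚ) * (oaPhi n q t x a' : ℚ)) =
      Φ.transpose * Φ := rfl
  have hΨ : (Φ * U.transpose).transpose * (Φ * U.transpose) =
      Matrix.blockDiagonal' (fun I : {s : Finset (Fin n) // s.card ≤ t} =>
        (q : ℚ) ^ (n - I.1.card) • Matrix.of fun v w : {i // i ∈ I.1} → Fin (q - 1) =>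
          ∏ i, oaCenteredGram q (v i) (w i)) := by
    ext a b
    rw [← sum_prod_oaCenteredFactor hq1]
    simp_rw [prod_oaCenteredFactor_eq_sum]
    rfl
  have hdet : (Φ.transpose * Φ).det =
      ((Φ * U.transpose).transpose * (Φ * U.transpose)).det := by
    rw [Matrix.transpose_mul, Matrix.transpose_transpose,
      show U * Φ.transpose * (Φ * U.transpose) = U * (Φ.transpose * Φ) * U.transpose by
        simp only [Matrix.mul_assoc],
      Matrix.det_mul, Matrix.det_mul, Matrix.det_transpose, det_oaCentering, one_mul, mul_one]
  rw [hΦ, hdet, hΨ, Matrix.det_blockDiagonal']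
  simp_rw [Matrix.det_smul, Matrix.det_of_prod, det_oaCenteredGram hq1, Fintype.card_fun,
    Fintype.card_fin, Fintype.card_coe]
  obtain ⟨n, rfl⟩ := Nat.exists_eq_add_of_le' hn
  rw [Nat.add_sub_cancel, ← prod_card_le_pow hq0]
  exact (Finset.prod_subtype _ (by simp) fun I : Finset (Fin (n + 1)) =>
    ((q : ℚ) ^ (n + 1 - I.card)) ^ (q - 1) ^ I.card *
      (1 / (q : ℚ)) ^ (I.card * (q - 1) ^ (I.card - 1))).symm
end

section
/- For every integer t ≥ 1, the least common multiple of the binomial coefficients C(t,0), C(t,1), ..., C(t,t) is at most 4^t. -/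
namespace Nat

open Finset in
theorem log_eq_sum_ite {p n b : ℕ} (hp : 1 < p) (hn : n ≠ 0) (hb : Nat.log p n < b) :
    Nat.log p n = ∑ i ∈ Ico 1 b, if p ^ i ≤ n then 1 else 0 := by
  rw [← card_filter]
  have : {i ∈ Ico 1 b | p ^ i ≤ n} = Icc 1 (Nat.log p n) := by
    ext i
    simp only [mem_filter, mem_Ico, mem_Icc, ← Nat.le_log_iff_pow_le hp hn]
    omega
  simp [this]

theorem ite_add_div_le (m d : ℕ) (hd : 0 < d) :
    (if d ≤ 6 * m then 1 else 0) + (3 * m / d + 2 * m / d + m / d) ≤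
      (if d ≤ m then 1 else 0) + 6 * m / d := by
  have h3 := Nat.div_mul_le_self (3 * m) d
  have h2 := Nat.div_mul_le_self (2 * m) d
  have h1 := Nat.div_mul_le_self m d
  by_cases hdm : d ≤ m
  · rw [if_pos hdm, if_pos (by omega)]
    gcongr
    rw [Nat.le_div_iff_mul_le hd]
    linarith
  · rw [if_neg hdm]
    have h0 : m / d = 0 := Nat.div_eq_of_lt (by omega)
    have h3' : 3 * m / d < 3 := by rw [Nat.div_lt_iff_lt_mul hd]; omega
    have h2' : 2 * m / d < 2 := by rw [Nat.div_lt_iff_lt_mul hd]; omega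
    split_ifs
    · rw [zero_add, Nat.le_div_iff_mul_le hd, h0]
      generalize 3 * m / d = a at *
      generalize 2 * m / d = b at *
      interval_cases a <;> interval_cases b <;> omega
    · rw [zero_add, zero_add, Nat.le_div_iff_mul_le hd]
      linarith

theorem lcmUpto_six_mul_dvd {m : ℕ} (hm : m ≠ 0) :
    lcmUpto (6 * m) ∣ lcmUpto m * ((6 * m).choose (3 * m) * (3 * m).choose m) := by
  have hfac : (6 * m).choose (3 * m) * (3 * m).choose m *
      ((3 * m).factorial * (2 * m).factorial * m.factorial) = (6 * m).factorial := by
    have h₁ := Nat.choose_mul_factorial_mul_factorial (show 3 * m ≤ 6 * m by omega)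
    have h₂ := Nat.choose_mul_factorial_mul_factorial (show m ≤ 3 * m by omega)
    rw [show 6 * m - 3 * m = 3 * m by omega] at h₁
    rw [show 3 * m - m = 2 * m by omega] at h₂
    calc _ = (6 * m).choose (3 * m) * ((3 * m).choose m * m.factorial * (2 * m).factorial) *
          (3 * m).factorial := by ring
      _ = (6 * m).factorial := by rw [h₂, h₁]
  have hpos : (3 * m).factorial * (2 * m).factorial * m.factorial ≠ 0 := by positivity
  refine Nat.dvd_of_mul_dvd_mul_right (Nat.pos_of_ne_zero hpos) ?_
  rw [mul_assoc (lcmUpto m), hfac]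
  have h0 := lcmUpto_ne_zero
  have hf := Nat.factorial_ne_zero
  rw [← Nat.factorization_prime_le_iff_dvd (mul_ne_zero (h0 _) hpos) (mul_ne_zero (h0 _) (hf _))]
  intro p hp
  obtain ⟨b, hb⟩ := exists_gt (Nat.log p (6 * m))
  have hlog : ∀ k ≤ 6 * m, Nat.log p k < b := fun k hk ↦ (Nat.log_mono_right hk).trans_lt hb
  rw [Nat.factorization_mul (h0 _) hpos, Nat.factorization_mul (mul_ne_zero (hf _) (hf _)) (hf _),
    Nat.factorization_mul (hf _) (hf _), Nat.factorization_mul (h0 _) (hf _)]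
  simp only [Finsupp.add_apply, factorization_lcmUpto _ hp]
  rw [Nat.factorization_factorial hp (hlog (3 * m) (by omega)),
    Nat.factorization_factorial hp (hlog (2 * m) (by omega)),
    Nat.factorization_factorial hp (hlog m (by omega)),
    Nat.factorization_factorial hp (hlog (6 * m) le_rfl),
    Nat.log_eq_sum_ite hp.one_lt (show 6 * m ≠ 0 by omega) (hlog (6 * m) le_rfl),
    Nat.log_eq_sum_ite hp.one_lt hm (hlog m (by omega))]
  simp only [← Finset.sum_add_distrib]
  exact Finset.sum_le_sum fun i _ ↦ Nat.ite_add_div_le m (p ^ i) (pow_pos hp.pos i)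

theorem lcmUpto_six_mul_le {m : ℕ} (hm : m ≠ 0) :
    lcmUpto (6 * m) ≤ lcmUpto m * 2 ^ (9 * m) := by
  have hpos : 0 < lcmUpto m * ((6 * m).choose (3 * m) * (3 * m).choose m) :=
    mul_pos (lcmUpto_pos m) (mul_pos (Nat.choose_pos (by omega)) (Nat.choose_pos (by omega)))
  refine (Nat.le_of_dvd hpos (lcmUpto_six_mul_dvd hm)).trans ?_
  rw [show 9 * m = 6 * m + 3 * m by ring, pow_add]
  gcongr <;> exact Nat.choose_le_two_pow _ _

theorem lcmUpto_mono : Monotone lcmUpto := fun _ n h ↦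
  Nat.le_of_dvd (lcmUpto_pos n) (Finset.lcm_mono (Finset.Icc_subset_Icc_right h))

theorem lcmUpto_le_four_pow (n : ℕ) : lcmUpto n ≤ 4 ^ n := by
  induction n using Nat.strong_induction_on with
  | _ n ih =>
    by_cases hn : n < 66
    · revert n
      have : ∀ n < 66, (Finset.Icc 1 n).lcm id ≤ 4 ^ n := by decide +kernel
      exact fun n _ hn ↦ this n hn
    · calc lcmUpto n ≤ lcmUpto (6 * (n / 6 + 1)) := lcmUpto_mono (by omega)
        _ ≤ lcmUpto (n / 6 + 1) * 2 ^ (9 * (n / 6 + 1)) := lcmUpto_six_mul_le (by omega)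
        _ ≤ 4 ^ (n / 6 + 1) * 2 ^ (9 * (n / 6 + 1)) := by gcongr; exact ih _ (by omega)
        _ = 2 ^ (11 * (n / 6 + 1)) := by
          rw [show 4 = 2 ^ 2 by rfl, ← pow_mul, ← pow_add]; ring_nf
        _ ≤ 2 ^ (2 * n) := Nat.pow_le_pow_right (by norm_num) (by omega)
        _ = 4 ^ n := by rw [pow_mul]; norm_num

end Nat

/-- For every integer `t ≥ 1`, the least common multiple of the binomial coefficients
`C(t,0), C(t,1), ..., C(t,t)` is at most `4^t`. -/
theorem lcm_binomials_le_four_pow (t : ℕ) (ht : 1 ≤ t) :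
    (Finset.range (t + 1)).lcm (fun s => t.choose s) ≤ 4 ^ t := by
  refine (Nat.le_of_dvd (Nat.lcmUpto_pos t) (Finset.lcm_dvd fun s hs ↦ ?_)).trans
    (Nat.lcmUpto_le_four_pow t)
  exact Chebyshev.choose_dvd_lcmUpto (Nat.lt_succ_iff.mp (Finset.mem_range.mp hs))
end

section
/- Let v ≥ 1 and t < k ≤ v − t be integers. Let B be the family of k-element subsets of [v], A the family of t-element subsets of [v], and φ : B → ℤ^A given by φ(b)_a = 1 if a ⊆ b and 0 otherwise. For a ∈ A and a (k+t)-element subset u of [v] with a ⊆ u, define γ_{a,u} ∈ ℤ^B by γ_{a,u} = Σ_{s=0}^{t} Σ_{b⊆u, |b|=k, |a∩b|=s} (−1)^(t−s) · (s!·(k−s−1)!/(k−t−1)!) · u_b, where u_b ∈ {0,1}^B is the unit vector at coordinate b. Then Σ_{b∈B} (γ_{a,u})_b · φ(b) = (k!/(k−t)!) · e_a, where e_a is the unit vector in ℤ^A at coordinate a. -/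
open Finset in
/-- The number of `k`-subsets of `P ∪ X ∪ Z` which contain `P` and meet `X` in `i` points,
counted by the intersection with `X` and by the `j` points of `Z` that are left out. -/
theorem card_powersetCard_filter_inter {α : Type*} [DecidableEq α] {P X Z : Finset α}
    (hPX : Disjoint P X) (hPZ : Disjoint P Z) (hXZ : Disjoint X Z) {k i j : ℕ}
    (h : #P + i + #Z = k + j) :
    #{b ∈ powersetCard k (P ∪ X ∪ Z) | P ⊆ b ∧ #(b ∩ X) = i} = (#X).choose i * (#Z).choose j := by
  rw [← card_powersetCard, ← card_powersetCard, ← card_product]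
  rw [disjoint_left] at hPX hPZ hXZ
  refine card_bij' (fun b _ ↦ (b ∩ X, Z \ b)) (fun q _ ↦ P ∪ q.1 ∪ (Z \ q.2)) ?_ ?_ ?_ ?_
  · intro b hb
    simp only [mem_filter, mem_powersetCard] at hb
    obtain ⟨⟨hbu, hbk⟩, hPb, hi⟩ := hb
    have hb : b = P ∪ b ∩ X ∪ b ∩ Z := by grind
    have hcard : #b = #P + #(b ∩ X) + #(b ∩ Z) := by
      conv_lhs => rw [hb]
      rw [card_union_of_disjoint, card_union_of_disjoint]
      · rw [disjoint_left]; grind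
      · rw [disjoint_left]; grind
    have hZ := card_sdiff_add_card_inter Z b
    rw [inter_comm Z b] at hZ
    simp only [mem_product, mem_powersetCard, inter_subset_right, sdiff_subset, true_and]
    omega
  · rintro ⟨A, B⟩ hq
    simp only [mem_product, mem_powersetCard] at hq
    obtain ⟨⟨hAX, hA⟩, hBZ, hB⟩ := hq
    have hcard : #(P ∪ A ∪ (Z \ B)) = #P + #A + #(Z \ B) := by
      rw [card_union_of_disjoint, card_union_of_disjoint]
      · rw [disjoint_left]; grind
      · rw [disjoint_left]; grind
    have hZ := card_sdiff_add_card_eq_card hBZ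
    have hX : (P ∪ A ∪ (Z \ B)) ∩ X = A := by grind
    simp only [mem_filter, mem_powersetCard, hX]
    refine ⟨⟨by grind, by omega⟩, by grind, hA⟩
  · intro b hb
    simp only [mem_filter, mem_powersetCard] at hb
    grind
  · rintro ⟨A, B⟩ hq
    simp only [mem_product, mem_powersetCard] at hq
    ext x <;> grind

open Finset in
/-- Finite differences of order `n` annihilate a falling factorial of order less than `n`. -/
theorem sum_neg_one_pow_choose_mul_descFactorial_sub {n d N : ℕ} (hd : d < n) (hN : n ≤ N) :
    ∑ i ∈ range (n + 1), (-1 : ℤ) ^ (n - i) * n.choose i * ((N - i).descFactorial d : ℤ) = 0 := by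
  let p : Polynomial ℤ := (descPochhammer ℤ d).comp (Polynomial.C (N : ℤ) - Polynomial.X)
  have hp : p.natDegree < n := by
    refine lt_of_le_of_lt Polynomial.natDegree_comp_le ?_
    rw [descPochhammer_natDegree]
    have : (Polynomial.C (N : ℤ) - Polynomial.X).natDegree ≤ 1 := by compute_degree
    nlinarith
  have h := congrFun (Polynomial.fwdDiff_iter_eq_zero_of_degree_lt hp) 0
  rw [fwdDiff_iter_eq_sum_shift, Pi.zero_apply] at h
  rw [← h]
  refine sum_congr rfl fun i hi ↦ ?_
  have hi : i ≤ N := by grind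
  simp [p, ← Nat.cast_sub hi, descPochhammer_eval_eq_descFactorial]

open Nat in
theorem factorial_mul_descFactorial_mul_descFactorial {k n s t : ℕ} (hn : 1 ≤ n) (hnt : n ≤ t)
    (hst : s ≤ t) (htk : t < k) :
    (k - 1 - t)! * ((k - n).descFactorial s * (k - 1 - s).descFactorial (t - s)) =
      (k - n)! * (k - 1 - s).descFactorial (n - 1) := by
  have h1 := Nat.factorial_mul_descFactorial (n := k - 1 - s) (k := t - s) (by omega)
  rw [show k - 1 - s - (t - s) = k - 1 - t by omega] at h1
  rcases le_or_gt s (k - n) with hs | hs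
  · have h2 := Nat.factorial_mul_descFactorial hs
    have h3 := Nat.factorial_mul_descFactorial (n := k - 1 - s) (k := n - 1) (by omega)
    rw [show k - 1 - s - (n - 1) = k - n - s by omega] at h3
    apply Nat.eq_of_mul_eq_mul_left (Nat.factorial_pos (k - n - s))
    rw [← h2, ← mul_assoc]
    linear_combination (k - n - s)! * (k - n).descFactorial s * (h1.trans h3.symm)
  · rw [Nat.descFactorial_of_lt hs, Nat.descFactorial_of_lt (n := k - 1 - s) (k := n - 1) (by omega)]
    simp

open Finset Nat in
theorem sum_choose_mul_neg_one_pow_mul_descFactorial {k t n m : ℕ} (htk : t < k)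
    (hmn : m + n = t) :
    ∑ i ∈ range (n + 1), ((n.choose i * (k - n).choose (m + i) : ℕ) : ℤ) *
        ((-1) ^ (t - (m + i)) * ((m + i)! : ℤ) *
          ((k - (m + i) - 1).descFactorial (t - (m + i)) : ℤ)) =
      if n = 0 then (k.descFactorial t : ℤ) else 0 := by
  split_ifs with hn
  · subst hn
    obtain rfl : m = t := by omega
    simp [Nat.descFactorial_eq_factorial_mul_choose, mul_comm]
  · have hf : ((k - 1 - t)! : ℤ) ≠ 0 := by exact_mod_cast (Nat.factorial_pos _).ne'
    apply mul_left_cancel₀ hf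
    rw [mul_zero, mul_sum]
    have h := sum_neg_one_pow_choose_mul_descFactorial_sub (n := n) (d := n - 1)
      (N := k - 1 - m) (by omega) (by omega)
    rw [← mul_zero ((k - n)! : ℤ), ← h, mul_sum]
    refine sum_congr rfl fun i hi ↦ ?_
    rw [mem_range] at hi
    have h1 := factorial_mul_descFactorial_mul_descFactorial (k := k) (n := n) (s := m + i)
      (t := t) (by omega) (by omega) (by omega) htk
    rw [Nat.descFactorial_eq_factorial_mul_choose (k - n)] at h1
    rw [show k - (m + i) - 1 = k - 1 - (m + i) by omega,
      show k - 1 - m - i = k - 1 - (m + i) by omega, show n - i = t - (m + i) by omega]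
    zify at h1
    push_cast
    linear_combination (-1 : ℤ) ^ (t - (m + i)) * n.choose i * h1


/-- For the inclusion map `φ : B → ℤ^A` between `k`-subsets and `t`-subsets of `[v]`
(`φ(b)_a = 1` iff `a ⊆ b`), the explicit vector
`γ_{a,u} = Σ_{s=0}^{t} Σ_{b ⊆ u, |b| = k, |a∩b| = s} (−1)^(t−s)·s!·(k−s−1)!/(k−t−1)!·u_b`
satisfies `Σ_b (γ_{a,u})_b·φ(b) = (k!/(k−t)!)·e_a`, for any `(k+t)`-subset `u ⊇ a`. -/
theorem design_local_decodability (v t k : ℕ) (hv : 1 ≤ v) (htk : t < k)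
    (hkv : k ≤ v - t)
    (a : {a : Finset (Fin v) // a.card = t})
    (u : Finset (Fin v)) (hu : u.card = k + t) (hau : a.1 ⊆ u) :
    ∀ a' : {a : Finset (Fin v) // a.card = t},
      (∑ b : {b : Finset (Fin v) // b.card = k},
        (if b.1 ⊆ u then
            (-1 : ℤ) ^ (t - (a.1 ∩ b.1).card) * ((a.1 ∩ b.1).card.factorial : ℤ) *
              ((k - (a.1 ∩ b.1).card - 1).descFactorial (t - (a.1 ∩ b.1).card) : ℤ)
          else 0) *
        (if a'.1 ⊆ b.1 then 1 else 0))
      = if a' = a then (k.descFactorial t : ℤ) else 0 := by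
  intro a'
  obtain ⟨a, ha⟩ := a
  obtain ⟨a', ha'⟩ := a'
  simp only [Subtype.mk.injEq] at hau ⊢
  let g : ℕ → ℤ := fun s ↦ (-1 : ℤ) ^ (t - s) * (s.factorial : ℤ) *
    ((k - s - 1).descFactorial (t - s) : ℤ)
  have hsum : (∑ b : {b : Finset (Fin v) // b.card = k},
      (if b.1 ⊆ u then g (a ∩ b.1).card else 0) * (if a' ⊆ b.1 then 1 else 0)) =
      ∑ b ∈ Finset.powersetCard k u with a' ⊆ b, g (a ∩ b).card := by
    rw [← Finset.sum_subtype (Finset.univ.filter fun b : Finset (Fin v) ↦ b.card = k) (by simp)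
      (fun b ↦ (if b ⊆ u then g (a ∩ b).card else 0) * (if a' ⊆ b then 1 else 0))]
    simp only [mul_ite, mul_one, mul_zero, ← Finset.sum_filter]
    refine Finset.sum_congr ?_ fun _ _ ↦ rfl
    ext b
    simp only [Finset.mem_filter, Finset.mem_powersetCard, Finset.mem_univ, true_and]
    tauto
  change (∑ b : {b : Finset (Fin v) // b.card = k},
      (if b.1 ⊆ u then g (a ∩ b.1).card else 0) * (if a' ⊆ b.1 then 1 else 0)) = _
  rw [hsum]
  by_cases hau' : a' ⊆ u
  · have hm := Finset.card_inter_add_card_sdiff a a'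
    have hunion : (a' ∪ a \ a').card = a'.card + (a \ a').card :=
      Finset.card_union_of_disjoint Finset.disjoint_sdiff
    have hsub : a' ∪ a \ a' ⊆ u := by grind
    have hZ := Finset.card_sdiff_add_card_eq_card hsub
    have hu' : a' ∪ a \ a' ∪ u \ (a' ∪ a \ a') = u := Finset.union_sdiff_of_subset hsub
    have hfiber := Finset.sum_fiberwise_of_maps_to'
      (s := (Finset.powersetCard k u).filter (a' ⊆ ·))
      (t := Finset.range ((a \ a').card + 1)) (g := fun b ↦ (b ∩ (a \ a')).card)
      (fun b _ ↦ Finset.mem_range_succ_iff.2 (Finset.card_le_card Finset.inter_subset_right))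
      (fun i ↦ g ((a ∩ a').card + i))
    have hinter : ∀ b ∈ (Finset.powersetCard k u).filter (a' ⊆ ·),
        g (a ∩ b).card = g ((a ∩ a').card + (b ∩ (a \ a')).card) := by
      intro b hb
      rw [← Finset.card_union_of_disjoint (by rw [Finset.disjoint_left]; grind)]
      congr 2
      grind
    rw [Finset.sum_congr rfl hinter, ← hfiber]
    have hiff : a' = a ↔ (a \ a').card = 0 := by
      rw [Finset.card_eq_zero, Finset.sdiff_eq_empty_iff_subset]
      exact ⟨fun h ↦ h.ge, fun h ↦ (Finset.eq_of_subset_of_card_le h (by omega)).symm⟩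
    simp only [hiff]
    rw [← sum_choose_mul_neg_one_pow_mul_descFactorial htk (hm.trans ha)]
    refine Finset.sum_congr rfl fun i _ ↦ ?_
    rw [Finset.sum_const, nsmul_eq_mul, Finset.filter_filter]
    have hcard := card_powersetCard_filter_inter (P := a') (X := a \ a')
      (Z := u \ (a' ∪ a \ a')) (k := k) (i := i) (j := (a ∩ a').card + i)
      Finset.disjoint_sdiff (by rw [Finset.disjoint_left]; grind)
      (by rw [Finset.disjoint_left]; grind) (by omega)
    rw [hu', show (u \ (a' ∪ a \ a')).card = k - (a \ a').card by omega] at hcard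
    rw [hcard]
  · rw [if_neg (by rintro rfl; exact hau' hau), Finset.filter_false_of_mem, Finset.sum_empty]
    intro b hb hab
    exact hau' (hab.trans (Finset.mem_powersetCard.1 hb).1)
end
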